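/- arXiv:1512.06089 — 3 statements merged into one kernel-verified Lean document; each statement's English description precedes it below -/
import Mathlib

section
/- Let u ∈ (0,1) and write m₁ = 1 − m. As m → 1 with m ∈ ℂ∖[1,∞), the following asymptotic expansions hold (powers of m₁ taken with the principal branch): sn(K(m)u | m) = 1 − 2^{1−4u} m₁^{u} + o(m₁^{u}), cn(K(m)u | m) = 2^{1−2u} m₁^{u/2} + o(m₁^{u/2}), and dn(K(m)u | m) = 2^{1−2u} m₁^{u/2} + o(m₁^{u/2}). -/
noncomputable section

open Complex Filter Set Asymptotics

/-- Complete elliptic integral of the first kind with complex parameter `m`,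
using the principal branch of the square root. -/
def ellK (m : ℂ) : ℂ :=
  ∫ t in (0:ℝ)..1, 1 / ((1 - (t : ℂ) ^ 2) * (1 - m * (t : ℂ) ^ 2)) ^ ((1 : ℂ) / 2)

/-- The nome `q = exp (-π K(1-m)/K(m))`. -/
def nome (m : ℂ) : ℂ := Complex.exp (-(Real.pi : ℂ) * ellK (1 - m) / ellK m)

/-- Jacobi theta function θ₁(z, q). -/
def theta1 (z q : ℂ) : ℂ :=
  2 * ∑' n : ℕ, (-1 : ℂ) ^ n * q ^ (((n : ℂ) + 1 / 2) ^ 2) *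
    Complex.sin ((2 * (n : ℂ) + 1) * z)

/-- Jacobi theta function θ₂(z, q). -/
def theta2 (z q : ℂ) : ℂ :=
  2 * ∑' n : ℕ, q ^ (((n : ℂ) + 1 / 2) ^ 2) * Complex.cos ((2 * (n : ℂ) + 1) * z)

/-- Jacobi theta function θ₃(z, q). -/
def theta3 (z q : ℂ) : ℂ :=
  1 + 2 * ∑' n : ℕ, q ^ ((n + 1) ^ 2) * Complex.cos (2 * ((n : ℂ) + 1) * z)

/-- Jacobi theta function θ₄(z, q). -/
def theta4 (z q : ℂ) : ℂ :=
  1 + 2 * ∑' n : ℕ, (-1 : ℂ) ^ (n + 1) * q ^ ((n + 1) ^ 2) *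
    Complex.cos (2 * ((n : ℂ) + 1) * z)

/-- Jacobian elliptic function sn(z | m) with complex argument and parameter,
defined through quotients of Jacobi theta functions with nome
`q = exp (-π K(1-m)/K(m))` (so that `sn (K m * u) m` corresponds to the
theta quotient at `π u / 2`). -/
def sn (z m : ℂ) : ℂ :=
  (theta3 0 (nome m) / theta2 0 (nome m)) *
    (theta1 ((Real.pi : ℂ) * z / (2 * ellK m)) (nome m) /
      theta4 ((Real.pi : ℂ) * z / (2 * ellK m)) (nome m))

/-- Jacobian elliptic function cn(z | m). -/
def cn (z m : ℂ) : ℂ :=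
  (theta4 0 (nome m) / theta2 0 (nome m)) *
    (theta2 ((Real.pi : ℂ) * z / (2 * ellK m)) (nome m) /
      theta4 ((Real.pi : ℂ) * z / (2 * ellK m)) (nome m))

/-- Jacobian elliptic function dn(z | m). -/
def dn (z m : ℂ) : ℂ :=
  (theta4 0 (nome m) / theta3 0 (nome m)) *
    (theta3 ((Real.pi : ℂ) * z / (2 * ellK m)) (nome m) /
      theta4 ((Real.pi : ℂ) * z / (2 * ellK m)) (nome m))

/-- The lattice ratio τ = i K(1-m)/K(m). -/
def tauC (m : ℂ) : ℂ := Complex.I * ellK (1 - m) / ellK m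

/-- Subsidiary Jacobian elliptic function sc = sn/cn. -/
def sc (z m : ℂ) : ℂ := sn z m / cn z m

/-- Subsidiary Jacobian elliptic function nc = 1/cn. -/
def nc (z m : ℂ) : ℂ := 1 / cn z m

/-- Subsidiary Jacobian elliptic function dc = dn/cn. -/
def dcC (z m : ℂ) : ℂ := dn z m / cn z m

/-- The branch cut [1, ∞) on the real axis. -/
def cut : Set ℂ := {z : ℂ | z.im = 0 ∧ 1 ≤ z.re}

/-- Real complete elliptic integral of the first kind (for real parameter `m < 1`
the complex integral is real-valued). -/
def KR (m : ℝ) : ℝ := (ellK (m : ℂ)).re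

/-- Classical real Jacobian elliptic function sn(x | m). -/
def snR (x m : ℝ) : ℝ := (sn (x : ℂ) (m : ℂ)).re

/-- Classical real Jacobian elliptic function cn(x | m). -/
def cnR (x m : ℝ) : ℝ := (cn (x : ℂ) (m : ℂ)).re

/-- Classical real Jacobian elliptic function dn(x | m). -/
def dnR (x m : ℝ) : ℝ := (dn (x : ℂ) (m : ℂ)).re

/-- φ(u, μ) = dc²(K(1-μ)u | 1-μ) − dc²(K(μ)u | μ) with real dc = dn/cn. -/
def phi (u μ : ℝ) : ℝ :=
  (dnR (KR (1 - μ) * u) (1 - μ) / cnR (KR (1 - μ) * u) (1 - μ)) ^ 2 -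
    (dnR (KR μ * u) μ / cnR (KR μ * u) μ) ^ 2

/-- The square of the continuously extended modulus |sn(K(m)u | m)|² for `m > 1`,
given by μ(s²d₁² + c²d²s₁²c₁²)/(1 − d²s₁²)² with μ = 1/m, μ₁ = 1 − μ. -/
def snAbsSq (u m : ℝ) : ℝ :=
  let μ := 1 / m
  let μ₁ := 1 - μ
  let s := snR (KR μ * u) μ
  let c := cnR (KR μ * u) μ
  let d := dnR (KR μ * u) μ
  let s₁ := snR (KR μ₁ * u) μ₁
  let c₁ := cnR (KR μ₁ * u) μ₁
  let d₁ := dnR (KR μ₁ * u) μ₁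
  μ * (s ^ 2 * d₁ ^ 2 + c ^ 2 * d ^ 2 * s₁ ^ 2 * c₁ ^ 2) / (1 - d ^ 2 * s₁ ^ 2) ^ 2


open Topology MeasureTheory

/-- principal square root in the form used in the definition of `ellK` -/
def rt (z : ℂ) : ℂ := z ^ ((1 : ℂ) / 2)

lemma rt_mul_self (z : ℂ) : rt z * rt z = z := by
  have := Complex.cpow_ofNat_inv_pow z 2
  rw [rt, ← sq, one_div]; exact_mod_cast this

lemma rt_re_pos {z : ℂ} (hz : z ∈ slitPlane) : 0 < (rt z).re := by
  rw [rt, one_div, Complex.cpow_inv_two_re]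
  apply Real.sqrt_pos.mpr
  have h1 := Complex.abs_re_le_norm z
  rcases hz with h | h
  · have := norm_nonneg z; linarith
  · have h2 : |z.re| < ‖z‖ := Complex.abs_re_lt_norm.mpr h
    have := neg_abs_le z.re
    linarith

lemma rt_ne_zero {z : ℂ} (hz : z ∈ slitPlane) : rt z ≠ 0 := by
  intro h; have := rt_re_pos hz; rw [h] at this; simp at this

lemma norm_rt_sq (z : ℂ) : ‖rt z‖ * ‖rt z‖ = ‖z‖ := by
  rw [← norm_mul, rt_mul_self]

lemma rt_one : rt 1 = 1 := by simp [rt]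

lemma rt_ofReal {a : ℝ} (ha : 0 ≤ a) : rt a = ((√a : ℝ) : ℂ) := by
  rw [rt, Real.sqrt_eq_rpow, Complex.ofReal_cpow ha]; norm_num

lemma rt_real_mul {a : ℝ} (ha : 0 ≤ a) (z : ℂ) : rt (a * z) = rt a * rt z := by
  rcases ha.eq_or_lt with rfl | ha
  · simp [rt]
  by_cases hz : z = 0
  · simp [rt, hz]
  have ha' : (a : ℂ) ≠ 0 := by exact_mod_cast ha.ne'
  simp only [rt, Complex.cpow_def_of_ne_zero ha', Complex.cpow_def_of_ne_zero hz,
    Complex.cpow_def_of_ne_zero (mul_ne_zero ha' hz), Complex.log_ofReal_mul ha hz,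
    ← Complex.exp_add, Complex.ofReal_log ha.le]
  ring_nf

lemma continuousAt_rt {z : ℂ} (hz : z ∈ slitPlane) : ContinuousAt rt z :=
  continuousAt_id.cpow continuousAt_const hz

lemma log_rt {z : ℂ} (hz : z ≠ 0) : Complex.log (rt z) = Complex.log z / 2 := by
  rw [rt, Complex.cpow_def_of_ne_zero hz, Complex.log_exp]
  · ring
  · have := Complex.neg_pi_lt_arg z
    have := Real.pi_pos
    simp [Complex.mul_im, Complex.log_im]; linarith
  · have := Complex.arg_le_pi z
    have := Real.pi_pos
    simp [Complex.mul_im, Complex.log_im]; linarith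

lemma hasDerivAt_rt_comp {f : ℂ → ℂ} {f' x : ℂ} (hf : HasDerivAt f f' x) (h : f x ∈ slitPlane) :
    HasDerivAt (fun z => rt (f z)) (f' / (2 * rt (f x))) x := by
  have := hf.cpow_const (c := (1 : ℂ) / 2) h
  refine this.congr_deriv ?_
  have h0 := rt_ne_zero h
  have h1 : f x ^ ((1 : ℂ) / 2 - 1) = 1 / rt (f x) := by
    rw [Complex.cpow_sub _ _ (slitPlane_ne_zero h), Complex.cpow_one]
    rw [div_eq_div_iff (slitPlane_ne_zero h) h0, one_mul]
    exact rt_mul_self _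
  rw [h1]; field_simp

lemma one_sub_mem_slit {m : ℂ} (hm : m ∉ cut) {t : ℝ} (ht : t ∈ Icc (0:ℝ) 1) :
    1 - m * (t : ℂ) ^ 2 ∈ slitPlane := by
  have hre : (1 - m * (t : ℂ) ^ 2).re = 1 - m.re * t ^ 2 := by
    rw [← Complex.ofReal_pow]; simp [-Complex.ofReal_pow]
  have him : (1 - m * (t : ℂ) ^ 2).im = - (m.im * t ^ 2) := by
    rw [← Complex.ofReal_pow]; simp [-Complex.ofReal_pow]
  rw [Complex.mem_slitPlane_iff, hre, him]
  by_cases h0 : t = 0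
  · left; simp [h0]
  have ht2 : 0 < t ^ 2 := by positivity
  by_cases hi : m.im = 0
  · left
    have : m.re < 1 := by
      by_contra h; exact hm ⟨hi, not_lt.mp h⟩
    have : t ^ 2 ≤ 1 := by nlinarith [ht.1, ht.2]
    nlinarith
  · right; exact neg_ne_zero.mpr (mul_ne_zero hi ht2.ne')

lemma one_sub_mem_slit_one {m : ℂ} (hm : m ∉ cut) : 1 - m ∈ slitPlane := by
  simpa using one_sub_mem_slit hm (t := 1) (by simp)

lemma intervalIntegrable_inv_sqrt_one_sub_sq :
    IntervalIntegrable (fun t : ℝ => 1 / √(1 - t ^ 2)) volume 0 1 := by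
  apply intervalIntegral.intervalIntegrable_deriv_of_nonneg (g := Real.arcsin)
  · exact Real.continuous_arcsin.continuousOn
  · intro x hx
    simp at hx
    exact Real.hasDerivAt_arcsin (by linarith) (by linarith)
  · intro x hx; positivity

lemma integral_inv_sqrt_one_sub_sq :
    ∫ t in (0:ℝ)..1, 1 / √(1 - t ^ 2) = Real.pi / 2 := by
  rw [intervalIntegral.integral_eq_sub_of_hasDerivAt_of_le zero_le_one
    Real.continuous_arcsin.continuousOn _ intervalIntegrable_inv_sqrt_one_sub_sq]
  · simp
  · intro x hx
    exact Real.hasDerivAt_arcsin (by linarith [hx.1]) (by linarith [hx.2])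

lemma intervalIntegrable_ofReal' {f : ℝ → ℝ} {a b : ℝ} (h : IntervalIntegrable f volume a b) :
    IntervalIntegrable (fun t => (f t : ℂ)) volume a b :=
  ⟨h.1.ofReal, h.2.ofReal⟩

lemma ellK_integrand {m : ℂ} {t : ℝ} (ht : t ∈ Icc (0:ℝ) 1) :
    1 / ((1 - (t : ℂ) ^ 2) * (1 - m * (t : ℂ) ^ 2)) ^ ((1 : ℂ) / 2) =
      ((1 / √(1 - t ^ 2) : ℝ) : ℂ) * (1 / rt (1 - m * (t : ℂ) ^ 2)) := by
  have h : 0 ≤ 1 - t ^ 2 := by nlinarith [ht.1, ht.2]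
  have := rt_real_mul h (1 - m * (t : ℂ) ^ 2)
  rw [rt_ofReal h] at this
  push_cast at this ⊢
  change 1 / rt _ = _
  rw [this]
  field_simp

lemma continuousOn_rt_aux {m : ℂ} (hm : m ∉ cut) :
    ContinuousOn (fun t : ℝ => rt (1 - m * (t : ℂ) ^ 2)) (Icc 0 1) := by
  intro t ht
  apply ContinuousAt.continuousWithinAt
  exact ContinuousAt.comp (f := fun t : ℝ => 1 - m * (t : ℂ) ^ 2) (g := rt)
    (continuousAt_rt (one_sub_mem_slit hm ht)) (by fun_prop)

lemma intervalIntegrable_ellK {m : ℂ} (hm : m ∉ cut) :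
    IntervalIntegrable (fun t : ℝ => ((1 / √(1 - t ^ 2) : ℝ) : ℂ) *
      (1 / rt (1 - m * (t : ℂ) ^ 2))) volume 0 1 := by
  apply IntervalIntegrable.mul_continuousOn
  · exact intervalIntegrable_ofReal' intervalIntegrable_inv_sqrt_one_sub_sq
  · rw [uIcc_of_le zero_le_one]
    exact continuousOn_const.div (continuousOn_rt_aux hm)
      (fun t ht => rt_ne_zero (one_sub_mem_slit hm ht))

lemma ellK_eq (m : ℂ) : ellK m = ∫ t in (0:ℝ)..1, ((1 / √(1 - t ^ 2) : ℝ) : ℂ) *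
      (1 / rt (1 - m * (t : ℂ) ^ 2)) := by
  apply intervalIntegral.integral_congr
  intro t ht
  rw [uIcc_of_le zero_le_one] at ht
  exact ellK_integrand ht

/-- weight in the remainder integral -/
def gw (t : ℝ) : ℝ :=
  √(1 - t ^ 2) / (1 + t) + √(1 - t ^ 2) / (1 + t) ^ 2 - (1 / √(1 - t ^ 2)) * (t ^ 2 / (1 + t))

lemma intervalIntegrable_gw : IntervalIntegrable gw volume 0 1 := by
  unfold gw
  apply IntervalIntegrable.sub
  · apply ContinuousOn.intervalIntegrable
    rw [uIcc_of_le zero_le_one]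
    apply ContinuousOn.add
    · exact ContinuousOn.div (by fun_prop) (by fun_prop) (fun t ht => by linarith [ht.1])
    · exact ContinuousOn.div (by fun_prop) (by fun_prop)
        (fun t ht => by have := ht.1; positivity)
  · apply intervalIntegrable_inv_sqrt_one_sub_sq.mul_continuousOn
    rw [uIcc_of_le zero_le_one]
    exact ContinuousOn.div (by fun_prop) (by fun_prop) (fun t ht => by linarith [ht.1])

lemma ellK_formula {m : ℂ} (hm : m ∉ cut) (hms : m ∈ slitPlane) :
    ellK m = (1 / rt m) * Complex.log (rt m + 1) - (1 / rt m) * (Complex.log (1 - m) / 2) +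
      ∫ t in (0:ℝ)..1, rt (1 - m * (t : ℂ) ^ 2) * (gw t : ℂ) := by
  set Ψ : ℝ → ℂ := fun t => -(1 / rt m) * Complex.log (rt m * rt (1 - (t:ℂ) ^ 2) +
    rt (1 - m * (t : ℂ) ^ 2)) - (t:ℂ) / (1 + t) * (rt (1 - (t:ℂ) ^ 2) * rt (1 - m * (t : ℂ) ^ 2))
    with hΨ
  have hi1 := intervalIntegrable_ellK hm
  have hi2 : IntervalIntegrable (fun t : ℝ => rt (1 - m * (t : ℂ) ^ 2) * (gw t : ℂ))
      volume 0 1 := by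
    apply IntervalIntegrable.continuousOn_mul
    · exact intervalIntegrable_ofReal' intervalIntegrable_gw
    · rw [uIcc_of_le zero_le_one]; exact continuousOn_rt_aux hm
  have hrtm := rt_ne_zero hms
  have hP : ∀ t ∈ Icc (0:ℝ) 1, rt (1 - (t:ℂ) ^ 2) = ((√(1 - t ^ 2) : ℝ) : ℂ) := by
    intro t ht
    have h : 0 ≤ 1 - t ^ 2 := by nlinarith [ht.1, ht.2]
    rw [← rt_ofReal h]; push_cast; rfl
  have hlogarg : ∀ t ∈ Icc (0:ℝ) 1, rt m * rt (1 - (t:ℂ) ^ 2) +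
    rt (1 - m * (t : ℂ) ^ 2) ∈ slitPlane := by
    intro t ht
    left
    rw [hP t ht]
    have h1 := rt_re_pos hms
    have h2 := rt_re_pos (one_sub_mem_slit hm ht)
    have h3 := Real.sqrt_nonneg (1 - t ^ 2)
    simp only [Complex.add_re, Complex.re_mul_ofReal]
    positivity
  have hcP : ContinuousOn (fun t : ℝ => rt (1 - (t:ℂ) ^ 2)) (Icc 0 1) := by
    refine ContinuousOn.congr (f := fun t : ℝ => ((√(1 - t ^ 2) : ℝ) : ℂ)) (by fun_prop) ?_
    intro t ht; exact hP t ht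
  have hcR := continuousOn_rt_aux hm
  have hcont : ContinuousOn Ψ (Icc 0 1) := by
    apply ContinuousOn.sub
    · apply ContinuousOn.mul continuousOn_const
      exact ContinuousOn.clog ((continuousOn_const.mul hcP).add hcR) hlogarg
    · apply ContinuousOn.mul _ (hcP.mul hcR)
      refine ContinuousOn.div (by fun_prop) (by fun_prop) (fun t ht => ?_)
      have : (1 + t : ℝ) ≠ 0 := by linarith [ht.1]
      exact_mod_cast this
  have hderiv : ∀ t ∈ Ioo (0:ℝ) 1, HasDerivAt Ψ (((1 / √(1 - t ^ 2) : ℝ) : ℂ) *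
      (1 / rt (1 - m * (t : ℂ) ^ 2)) - rt (1 - m * (t : ℂ) ^ 2) * (gw t : ℂ)) t := by
    intro t ht
    have ht' : t ∈ Icc (0:ℝ) 1 := ⟨ht.1.le, ht.2.le⟩
    have hpos : 0 < 1 - t ^ 2 := by nlinarith [ht.1, ht.2]
    have hs1 : 1 - (t:ℂ) ^ 2 ∈ slitPlane := by
      left; rw [← Complex.ofReal_pow, ← Complex.ofReal_one, ← Complex.ofReal_sub, Complex.ofReal_re]; exact hpos
    have hs2 := one_sub_mem_slit hm ht'
    have hd1 : HasDerivAt (fun z : ℂ => rt (1 - z ^ 2)) _ (t:ℂ) :=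
      hasDerivAt_rt_comp (((hasDerivAt_id (t:ℂ)).pow 2).const_sub 1) hs1
    have hd2 : HasDerivAt (fun z : ℂ => rt (1 - m * z ^ 2)) _ (t:ℂ) :=
      hasDerivAt_rt_comp ((((hasDerivAt_id (t:ℂ)).pow 2).const_mul m).const_sub 1) hs2
    have hne : (1 + (t:ℂ)) ≠ 0 := by
      have : (1 + t : ℝ) ≠ 0 := by linarith [ht.1]
      exact_mod_cast this
    have hd3 : HasDerivAt (fun z : ℂ => z / (1 + z)) _ (t:ℂ) :=
      (hasDerivAt_id (t:ℂ)).div ((hasDerivAt_id (t:ℂ)).const_add 1) hne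
    have hd4 := (((hd1.const_mul (rt m)).add hd2).clog (hlogarg t ht')).const_mul (-(1 / rt m))
    have hd5 := (hd4.sub (hd3.mul (hd1.mul hd2))).comp_ofReal
    refine hd5.congr_deriv ?_
    have e1 := rt_mul_self (1 - (t:ℂ) ^ 2)
    have e2 := rt_mul_self (1 - m * (t:ℂ) ^ 2)
    have e3 := rt_mul_self m
    have n1 := rt_ne_zero hs1
    have n2 := rt_ne_zero hs2
    have n4 := slitPlane_ne_zero (hlogarg t ht')
    have hg : (gw t : ℂ) = rt (1 - (t:ℂ) ^ 2) / (1 + t) + rt (1 - (t:ℂ) ^ 2) / (1 + t) ^ 2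
        - (1 / rt (1 - (t:ℂ) ^ 2)) * (t ^ 2 / (1 + t)) := by
      rw [gw, hP t ht']; push_cast; rfl
    rw [hg]
    have hs : ((1 / √(1 - t ^ 2) : ℝ) : ℂ) = 1 / rt (1 - (t:ℂ) ^ 2) := by
      rw [hP t ht']; push_cast; rfl
    rw [hs]
    simp only [Pi.mul_apply, Pi.add_apply, id]
    generalize rt (1 - (t:ℂ) ^ 2) = P at *
    generalize rt (1 - m * (t:ℂ) ^ 2) = R at *
    generalize rt m = s at *
    generalize (t:ℂ) = z at *
    have hlogpart : -(1 / s) * ((s * (-(2 * z ^ (2 - 1) * 1) / (2 * P)) +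
        -(m * (2 * z ^ (2 - 1) * 1)) / (2 * R)) / (s * P + R)) = z / (P * R) := by
      rw [← e3]
      field_simp
      ring
    have key : z / (P * R) - (((1 * (1 + z) - z * 1) / (1 + z) ^ 2) * (P * R) + z / (1 + z) *
       ((-(2 * z ^ (2 - 1) * 1) / (2 * P)) * R + P * (-(m * (2 * z ^ (2 - 1) * 1)) / (2 * R)))) =
       1 / P * (1 / R) - R * (P / (1 + z) + P / (1 + z) ^ 2 - 1 / P * (z ^ 2 / (1 + z))) := by
      rw [← sub_eq_zero]
      have : ∀ A B : ℂ, A - B = -((1 - z ^ 2) - P * P * (m * z ^ 2 + R * R)) / (P * R * (1 + z)) →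
          A - B = 0 := by
        intro A B h; rw [h, e1, e2]; ring
      apply this
      field_simp
      ring
    rw [← key, ← hlogpart]
    norm_num
  have hft := intervalIntegral.integral_eq_sub_of_hasDerivAt_of_le zero_le_one hcont hderiv
    (hi1.sub hi2)
  rw [intervalIntegral.integral_sub hi1 hi2, ← ellK_eq] at hft
  have h0 : Ψ 0 = -(1 / rt m) * Complex.log (rt m + 1) := by
    simp [hΨ, rt_one]
  have h1 : Ψ 1 = -(1 / rt m) * (Complex.log (1 - m) / 2) := by
    have hz : rt 0 = 0 := by simp [rt]
    simp [hΨ, hz, log_rt (slitPlane_ne_zero (one_sub_mem_slit_one hm))]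
  rw [h0, h1] at hft
  linear_combination hft

/-- the filter of the theorem -/
abbrev lf : Filter ℂ := nhdsWithin 1 cutᶜ

lemma tendsto_one_sub : Tendsto (fun m : ℂ => 1 - m) lf (𝓝 0) := by
  have : Tendsto (fun m : ℂ => 1 - m) (𝓝 1) (𝓝 (1 - 1)) := by
    apply Continuous.tendsto; fun_prop
  rw [sub_self] at this
  exact this.mono_left nhdsWithin_le_nhds

lemma ev_notMem_cut : ∀ᶠ m in lf, m ∉ cut := eventually_mem_nhdsWithin

lemma ev_slit : ∀ᶠ m in lf, m ∈ slitPlane :=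
  eventually_nhdsWithin_of_eventually_nhds
    (Complex.isOpen_slitPlane.mem_nhds Complex.one_mem_slitPlane)

lemma tendsto_rt : Tendsto rt lf (𝓝 1) := by
  have := (continuousAt_rt Complex.one_mem_slitPlane).tendsto
  rw [rt_one] at this
  exact this.mono_left nhdsWithin_le_nhds

lemma sqrt_mul_gw {t : ℝ} (ht : t ∈ Ioo (0:ℝ) 1) :
    √(1 - t ^ 2) * gw t = 1 - 2 * t + 1 / (1 + t) := by
  have hpos : 0 < 1 - t ^ 2 := by nlinarith [ht.1, ht.2]
  have h1 := Real.mul_self_sqrt hpos.le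
  have h2 := Real.sqrt_pos.mpr hpos
  have h3 : 1 + t ≠ 0 := by linarith [ht.1]
  unfold gw
  have : √(1 - t ^ 2) * (√(1 - t ^ 2) / (1 + t) + √(1 - t ^ 2) / (1 + t) ^ 2 -
      (1 / √(1 - t ^ 2)) * (t ^ 2 / (1 + t))) =
      (√(1 - t ^ 2) * √(1 - t ^ 2)) / (1 + t) + (√(1 - t ^ 2) * √(1 - t ^ 2)) / (1 + t) ^ 2 -
      t ^ 2 / (1 + t) := by
    field_simp
  rw [this, h1]
  field_simp
  ring

lemma integral_log_two : ∫ t in (0:ℝ)..1, (1 - 2 * t + 1 / (1 + t)) = Real.log 2 := by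
  have hd : ∀ t ∈ uIcc (0:ℝ) 1, HasDerivAt (fun t : ℝ => t - t ^ 2 + Real.log (1 + t))
      (1 - 2 * t + 1 / (1 + t)) t := by
    intro t ht
    rw [uIcc_of_le zero_le_one] at ht
    have h := ((hasDerivAt_id t).sub ((hasDerivAt_id t).pow 2)).add
      (((hasDerivAt_id t).const_add 1).log (by simp; linarith [ht.1]))
    refine h.congr_deriv ?_
    simp
  rw [intervalIntegral.integral_eq_sub_of_hasDerivAt hd]
  · norm_num
  · apply ContinuousOn.intervalIntegrable
    rw [uIcc_of_le zero_le_one]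
    exact ContinuousOn.add (by fun_prop) (ContinuousOn.div (by fun_prop) (by fun_prop)
      (fun t ht => by linarith [ht.1]))

lemma integral_rt_gw :
    ∫ t in (0:ℝ)..1, rt (1 - (t : ℂ) ^ 2) * (gw t : ℂ) = (Real.log 2 : ℂ) := by
  rw [← integral_log_two, ← intervalIntegral.integral_ofReal]
  apply intervalIntegral.integral_congr_ae
  have : ∀ᵐ t : ℝ, t ≠ 1 := by simp [ae_iff, measure_singleton]
  filter_upwards [this] with t ht1 ht
  rw [uIoc_of_le zero_le_one] at ht
  have ht' : t ∈ Ioo (0:ℝ) 1 := ⟨ht.1, lt_of_le_of_ne ht.2 ht1⟩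
  have hpos : 0 ≤ 1 - t ^ 2 := by nlinarith [ht.1, ht.2]
  rw [← sqrt_mul_gw ht', Complex.ofReal_mul, ← rt_ofReal hpos]
  push_cast; rfl

lemma tendsto_integral_rt :
    Tendsto (fun m => ∫ t in (0:ℝ)..1, rt (1 - m * (t : ℂ) ^ 2) * (gw t : ℂ)) lf
      (𝓝 (Real.log 2 : ℂ)) := by
  rw [← integral_rt_gw]
  apply intervalIntegral.tendsto_integral_filter_of_dominated_convergence (fun t => 2 * |gw t|)
  · filter_upwards [ev_notMem_cut] with m hm
    have hi2 : IntervalIntegrable (fun t : ℝ => rt (1 - m * (t : ℂ) ^ 2) * (gw t : ℂ))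
        volume 0 1 := by
      apply IntervalIntegrable.continuousOn_mul
      · exact intervalIntegrable_ofReal' intervalIntegrable_gw
      · rw [uIcc_of_le zero_le_one]; exact continuousOn_rt_aux hm
    rw [uIoc_of_le zero_le_one]
    exact hi2.1.aestronglyMeasurable
  · have : ∀ᶠ m : ℂ in lf, ‖m‖ < 2 :=
      eventually_nhdsWithin_of_eventually_nhds
        (continuous_norm.continuousAt.eventually_lt continuousAt_const (by simp))
    filter_upwards [this] with m hm
    refine Eventually.of_forall fun t ht => ?_
    rw [uIoc_of_le zero_le_one] at ht
    rw [norm_mul, Complex.norm_real, Real.norm_eq_abs]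
    gcongr
    have h1 := norm_rt_sq (1 - m * (t : ℂ) ^ 2)
    have h2 : ‖1 - m * (t : ℂ) ^ 2‖ ≤ 1 + 2 * 1 := by
      refine (norm_sub_le _ _).trans ?_
      rw [norm_one, norm_mul, norm_pow, Complex.norm_real, Real.norm_eq_abs, abs_of_pos ht.1]
      have : t ^ 2 ≤ 1 := by nlinarith [ht.1, ht.2]
      gcongr
    nlinarith [norm_nonneg (rt (1 - m * (t : ℂ) ^ 2))]
  · exact (intervalIntegrable_gw.abs).const_mul 2
  · have : ∀ᵐ t : ℝ, t ≠ 1 := by simp [ae_iff, measure_singleton]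
    filter_upwards [this] with t ht1 ht
    rw [uIoc_of_le zero_le_one] at ht
    have ht' : t ∈ Ioo (0:ℝ) 1 := ⟨ht.1, lt_of_le_of_ne ht.2 ht1⟩
    have hpos : 0 < 1 - t ^ 2 := by nlinarith [ht'.1, ht'.2]
    have hs1 : 1 - (1:ℂ) * (t:ℂ) ^ 2 ∈ slitPlane := by
      left; rw [one_mul, ← Complex.ofReal_pow, ← Complex.ofReal_one, ← Complex.ofReal_sub, Complex.ofReal_re]; exact hpos
    have hc : ContinuousAt (fun m : ℂ => rt (1 - m * (t : ℂ) ^ 2)) 1 :=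
      ContinuousAt.comp (f := fun m : ℂ => 1 - m * (t : ℂ) ^ 2) (g := rt)
        (continuousAt_rt hs1) (by fun_prop)
    have hc' := hc.tendsto
    rw [one_mul] at hc'
    exact (hc'.mono_left nhdsWithin_le_nhds).mul_const _

lemma tendsto_mul_log : Tendsto (fun m : ℂ => (1 - m) * Complex.log (1 - m)) lf (𝓝 0) := by
  have h1 : Tendsto (fun x : ℝ => x * |Real.log x| + x * Real.pi) (𝓝 0) (𝓝 0) := by
    have h3 : Tendsto (fun x : ℝ => x * |Real.log x|) (𝓝 0) (𝓝 0) := by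
      rw [tendsto_zero_iff_abs_tendsto_zero]
      have h4 := Real.continuous_mul_log.tendsto 0
      rw [zero_mul] at h4
      have h5 := h4.abs
      simpa [abs_mul, Function.comp_def] using h5
    have h6 : Tendsto (fun x : ℝ => x * Real.pi) (𝓝 0) (𝓝 (0 * Real.pi)) := by
      apply Continuous.tendsto; fun_prop
    simpa using h3.add h6
  have h2 : Tendsto (fun m : ℂ => ‖1 - m‖) lf (𝓝 0) := by
    simpa using tendsto_one_sub.norm
  refine squeeze_zero_norm (fun m => ?_) (h1.comp h2)
  simp only [Function.comp]
  rw [norm_mul, ← mul_add]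
  gcongr
  refine (Complex.norm_le_abs_re_add_abs_im _).trans ?_
  rw [Complex.log_re, Complex.log_im]
  gcongr
  exact Complex.abs_arg_le_pi _

lemma tendsto_isBigO_mul_log {f : ℂ → ℂ} (hf : f =O[lf] (fun m => 1 - m)) :
    Tendsto (fun m => f m * Complex.log (1 - m)) lf (𝓝 0) :=
  (hf.mul (isBigO_refl _ _)).trans_tendsto tendsto_mul_log

lemma tendsto_ellK :
    Tendsto (fun m => ellK m + Complex.log (1 - m) / 2) lf (𝓝 (2 * (Real.log 2 : ℂ))) := by
  have h1 : (fun m : ℂ => 1 - 1 / rt m) =O[lf] (fun m => 1 - m) := by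
    have hd : HasDerivAt (fun m : ℂ => 1 - 1 / rt m) (1/2) 1 := by
      have h := (hasDerivAt_rt_comp (hasDerivAt_id (1:ℂ)) Complex.one_mem_slitPlane)
      have h2 := (((hasDerivAt_const (1:ℂ) (1:ℂ)).div h (rt_ne_zero Complex.one_mem_slitPlane)).const_sub 1)
      refine h2.congr_deriv ?_
      simp [rt_one]
    have := hd.differentiableAt.isBigO_sub
    simp only [rt_one, div_one, sub_self, sub_zero] at this
    have h3 := this.neg_right.mono (nhdsWithin_le_nhds (s := cutᶜ))
    simpa using h3
  have h2 := tendsto_isBigO_mul_log h1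
  have h3 : Tendsto (fun m => (1 / rt m) * Complex.log (rt m + 1)) lf
      (𝓝 ((1 / 1) * Complex.log (1 + 1))) := by
    refine (tendsto_const_nhds.div tendsto_rt one_ne_zero).mul ?_
    refine (tendsto_rt.add_const 1).clog ?_
    norm_num [Complex.mem_slitPlane_iff]
  have h4 := (h3.add (h2.div_const 2)).add tendsto_integral_rt
  have h5 : (1 / 1) * Complex.log (1 + 1) + 0 / 2 + (Real.log 2 : ℂ) = 2 * (Real.log 2 : ℂ) := by
    have : (Real.log 2 : ℂ) = Complex.log 2 := by
      rw [Complex.ofReal_log (by norm_num)]; norm_num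
    rw [this]; norm_num; ring
  rw [h5] at h4
  refine h4.congr' ?_
  filter_upwards [ev_notMem_cut, ev_slit] with m hm hs
  rw [ellK_formula hm hs]
  ring

lemma ellK_isBigO : (fun z => ellK z - (Real.pi / 2 : ℝ)) =O[𝓝 0] (fun z : ℂ => z) := by
  have hd : DifferentiableAt ℂ (fun w : ℂ => 1 / rt (1 - w)) 0 := by
    have h := (hasDerivAt_rt_comp ((hasDerivAt_id (0:ℂ)).const_sub 1)
      (by simp))
    exact ((hasDerivAt_const (0:ℂ) (1:ℂ)).div h (rt_ne_zero (by simp))).differentiableAt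
  have hO := hd.isBigO_sub
  simp only [sub_zero, rt_one, div_one] at hO
  obtain ⟨C, hC⟩ := hO.bound
  obtain ⟨ε, hε, hb⟩ := Metric.eventually_nhds_iff.mp hC
  have hcutev : ∀ᶠ z : ℂ in 𝓝 0, z ∉ cut ∧ dist z 0 < ε := by
    filter_upwards [Metric.ball_mem_nhds (0:ℂ) (lt_min one_pos hε)] with z hz
    rw [Metric.mem_ball, lt_min_iff] at hz
    refine ⟨fun h => ?_, hz.2⟩
    have h1 := (Complex.re_le_norm z).trans_lt (by simpa using hz.1)
    linarith [h.2]
  refine IsBigO.of_bound (|C| * (Real.pi / 2)) ?_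
  filter_upwards [hcutev] with z hz
  obtain ⟨hz, hze⟩ := hz
  have hintg : IntervalIntegrable (fun t : ℝ => ((1 / √(1 - t ^ 2) : ℝ) : ℂ)) volume 0 1 :=
    intervalIntegrable_ofReal' intervalIntegrable_inv_sqrt_one_sub_sq
  rw [ellK_eq, ← integral_inv_sqrt_one_sub_sq, ← intervalIntegral.integral_ofReal,
    ← intervalIntegral.integral_sub (intervalIntegrable_ellK hz) hintg]
  have hbd : IntervalIntegrable (fun t : ℝ => (|C| * ‖z‖) * (1 / √(1 - t ^ 2))) volume 0 1 :=
    intervalIntegrable_inv_sqrt_one_sub_sq.const_mul _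
  refine (intervalIntegral.norm_integral_le_of_norm_le zero_le_one ?_ hbd).trans ?_
  · refine Eventually.of_forall fun t ht => ?_
    have ht2 : t ^ 2 ≤ 1 := by nlinarith [ht.1, ht.2]
    have hn : ‖z * (t:ℂ) ^ 2‖ ≤ ‖z‖ := by
      rw [norm_mul, norm_pow, Complex.norm_real, Real.norm_eq_abs, sq_abs]
      exact mul_le_of_le_one_right (norm_nonneg _) ht2
    have h1 := hb (y := z * (t:ℂ) ^ 2) (by
      rw [dist_zero_right] at hze ⊢; linarith)
    rw [← mul_sub_one, norm_mul, Complex.norm_real, Real.norm_eq_abs, mul_comm]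
    rw [abs_of_nonneg (by positivity : (0:ℝ) ≤ 1 / √(1 - t ^ 2))]
    gcongr
    refine h1.trans ?_
    calc C * ‖z * (t:ℂ) ^ 2‖ ≤ |C| * ‖z * (t:ℂ) ^ 2‖ := by gcongr; exact le_abs_self C
      _ ≤ _ := by gcongr
  · rw [intervalIntegral.integral_const_mul, integral_inv_sqrt_one_sub_sq]
    apply le_of_eq; ring

lemma ellK'_isBigO : (fun m => ellK (1 - m) - (Real.pi / 2 : ℝ)) =O[lf] (fun m : ℂ => 1 - m) :=
  ellK_isBigO.comp_tendsto tendsto_one_sub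

lemma tendsto_ellK' : Tendsto (fun m => ellK (1 - m)) lf (𝓝 (Real.pi / 2 : ℝ)) := by
  have := ellK'_isBigO.trans_tendsto tendsto_one_sub
  simpa using this.add_const ((Real.pi / 2 : ℝ) : ℂ)

/-- the logarithm of the complementary nome -/
def QQ (m : ℂ) : ℂ := -(Real.pi : ℂ) * ellK m / ellK (1 - m)

lemma tendsto_QQ : Tendsto (fun m => QQ m - (Complex.log (1 - m) - 4 * (Real.log 2 : ℂ))) lf
    (𝓝 0) := by
  have hpi : ((Real.pi / 2 : ℝ) : ℂ) ≠ 0 := by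
    exact_mod_cast (by positivity : (Real.pi / 2 : ℝ) ≠ 0)
  have h1 := (tendsto_ellK.sub_const (2 * (Real.log 2 : ℂ))).const_mul (-(Real.pi : ℂ))
  have h2 := tendsto_isBigO_mul_log ellK'_isBigO
  have h3 := ((tendsto_ellK'.sub_const ((Real.pi / 2 : ℝ):ℂ)).mul_const (4 * (Real.log 2 : ℂ)))
  have h4 := ((h1.sub h2).add h3).div tendsto_ellK' hpi
  simp only [sub_self, mul_zero, zero_mul, add_zero, zero_div] at h4
  refine h4.congr' ?_
  filter_upwards [tendsto_ellK'.eventually_ne hpi] with m hm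
  unfold QQ
  simp only [Pi.div_apply]
  field_simp
  push_cast
  ring

lemma tendsto_log_re : Tendsto (fun m : ℂ => (Complex.log (1 - m)).re) lf atBot := by
  simp only [Complex.log_re]
  apply Real.tendsto_log_nhdsNE_zero.comp
  rw [tendsto_nhdsWithin_iff]
  constructor
  · simpa using tendsto_one_sub.norm
  · filter_upwards [ev_notMem_cut] with m hm
    simpa using slitPlane_ne_zero (one_sub_mem_slit_one hm)

lemma tendsto_QQ_re : Tendsto (fun m : ℂ => (QQ m).re) lf atBot := by
  have h := (Complex.continuous_re.tendsto _).comp tendsto_QQ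
  have h2 := tendsto_log_re.atBot_add (h.add_const (-(4 * Real.log 2)))
  refine h2.congr fun m => ?_
  have : ((4:ℂ) * (Real.log 2 : ℂ)).re = 4 * Real.log 2 := by
    rw [show (4:ℂ) = ((4:ℝ):ℂ) by norm_num, ← Complex.ofReal_mul, Complex.ofReal_re]
  simp only [Function.comp, Complex.sub_re, this]
  ring

lemma summable_nat' {f : ℤ → ℂ} (hs : Summable f) : Summable (fun n : ℕ => f (n : ℤ)) :=
  hs.comp_injective Nat.cast_injective

lemma summable_nat_succ' {f : ℤ → ℂ} (hs : Summable f) :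
    Summable (fun n : ℕ => f (n + 1 : ℤ)) := by
  have h : Function.Injective (fun n : ℕ => (n + 1 : ℤ)) := by
    intro a b h; simp only at h; omega
  exact hs.comp_injective h

lemma summable_neg_succ' {f : ℤ → ℂ} (hs : Summable f) :
    Summable (fun n : ℕ => f (-(n + 1 : ℤ))) := by
  have h : Function.Injective (fun n : ℕ => (-(n + 1 : ℤ))) := by
    intro a b h; simp only at h; omega
  exact hs.comp_injective h

lemma theta4_eq_theta3 (z q : ℂ) : theta4 z q = theta3 (z - Real.pi / 2) q := by
  unfold theta4 theta3
  congr 2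
  refine tsum_congr fun n => ?_
  have : Complex.cos (2 * ((n : ℂ) + 1) * (z - Real.pi / 2)) =
      (-1) ^ (n + 1) * Complex.cos (2 * ((n : ℂ) + 1) * z) := by
    have := Complex.cos_antiperiodic.sub_nat_mul_eq (x := 2 * ((n : ℂ) + 1) * z) (n + 1)
    rw [← this]; congr 1; push_cast; ring
  rw [this]; ring

lemma theta1_eq_theta2 (z q : ℂ) : theta1 z q = theta2 (z - Real.pi / 2) q := by
  unfold theta1 theta2
  congr 1
  refine tsum_congr fun n => ?_
  have : Complex.cos ((2 * (n : ℂ) + 1) * (z - Real.pi / 2)) =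
      (-1) ^ n * Complex.sin ((2 * (n : ℂ) + 1) * z) := by
    have := Complex.cos_antiperiodic.sub_nat_mul_eq (x := (2 * (n : ℂ) + 1) * z - Real.pi / 2) n
    rw [Complex.cos_sub_pi_div_two] at this
    rw [← this]; congr 1; ring
  rw [this]; ring

lemma theta3_eq_jT (x : ℂ) {τ : ℂ} (hτ : 0 < τ.im) :
    theta3 (Real.pi * x) (Complex.exp (Real.pi * I * τ)) = jacobiTheta₂ x τ := by
  have hs := (summable_jacobiTheta₂_term_iff x τ).mpr hτ
  have h1 : Summable (fun n : ℕ => jacobiTheta₂_term (n + 1 : ℤ) x τ) :=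
    summable_nat_succ' (f := fun n : ℤ => jacobiTheta₂_term n _ _) hs
  have h2 : Summable (fun n : ℕ => jacobiTheta₂_term (-(n + 1 : ℤ)) x τ) :=
    summable_neg_succ' (f := fun n : ℤ => jacobiTheta₂_term n _ _) hs
  have := tsum_of_add_one_of_neg_add_one (f := fun n : ℤ => jacobiTheta₂_term n x τ) h1 h2
  rw [jacobiTheta₂, this]
  have h0 : jacobiTheta₂_term 0 x τ = 1 := by simp [jacobiTheta₂_term]
  rw [h0, theta3]
  have : ∀ a b c : ℂ, c = a + b → 1 + c = a + 1 + b := by intro a b c h; rw [h]; ring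
  apply this
  rw [← h1.tsum_add h2, ← tsum_mul_left]
  refine tsum_congr fun n => ?_
  rw [Complex.cos, ← Complex.exp_nat_mul, jacobiTheta₂_term, jacobiTheta₂_term,
    Complex.exp_add, Complex.exp_add]
  push_cast
  ring_nf

lemma theta2_eq_jT (x : ℂ) {τ : ℂ} (hτ : 0 < τ.im) (hre : |τ.re| < 1) :
    theta2 (Real.pi * x) (Complex.exp (Real.pi * I * τ)) =
      Complex.exp (Real.pi * I * τ / 4) * Complex.exp (Real.pi * I * x) *
        jacobiTheta₂ (x + τ / 2) τ := by
  have hs := (summable_jacobiTheta₂_term_iff (x + τ / 2) τ).mpr hτ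
  have h1 : Summable (fun n : ℕ => jacobiTheta₂_term (n : ℤ) (x + τ / 2) τ) :=
    summable_nat' (f := fun n : ℤ => jacobiTheta₂_term n _ _) hs
  have h2 : Summable (fun n : ℕ => jacobiTheta₂_term (-(n + 1 : ℤ)) (x + τ / 2) τ) :=
    summable_neg_succ' (f := fun n : ℤ => jacobiTheta₂_term n _ _) hs
  have := tsum_of_nat_of_neg_add_one (f := fun n : ℤ => jacobiTheta₂_term n (x + τ / 2) τ) h1 h2
  rw [jacobiTheta₂, this, theta2, ← h1.tsum_add h2, ← tsum_mul_left, ← tsum_mul_left]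
  refine tsum_congr fun n => ?_
  have hlog : Complex.log (Complex.exp (Real.pi * I * τ)) = Real.pi * I * τ := by
    have him : (Real.pi * I * τ).im = Real.pi * τ.re := by simp
    have := Real.pi_pos
    rw [abs_lt] at hre
    apply Complex.log_exp <;> rw [him] <;> nlinarith
  rw [Complex.cos, Complex.cpow_def_of_ne_zero (Complex.exp_ne_zero _), hlog,
    jacobiTheta₂_term, jacobiTheta₂_term]
  have e : ∀ a b c d : ℂ, 2 * (a * ((b + c) / 2)) = a * b + a * c := by intros; ring
  rw [e _ _ _ 0, mul_add]
  simp only [← Complex.exp_add]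
  push_cast
  ring_nf

lemma theta3_transf (x : ℂ) {τ T : ℂ} (hτ : 0 < τ.im) (hT : T = -1 / τ) :
    theta3 (Real.pi * x) (Complex.exp (Real.pi * I * τ)) =
      1 / (-I * τ) ^ (1 / 2 : ℂ) * Complex.exp (Real.pi * I * T * x ^ 2) *
        jacobiTheta₂ (x * T) T := by
  have h0 : τ ≠ 0 := by rintro rfl; simp at hτ
  rw [theta3_eq_jT x hτ, jacobiTheta₂_functional_equation, ← jacobiTheta₂_neg_left (x / τ), hT]
  congr 2
  · congr 2; ring
  · ring

lemma theta2_transf (x : ℂ) {τ T : ℂ} (hτ : 0 < τ.im) (hre : |τ.re| < 1) (hT : T = -1 / τ) :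
    theta2 (Real.pi * x) (Complex.exp (Real.pi * I * τ)) =
      1 / (-I * τ) ^ (1 / 2 : ℂ) * Complex.exp (Real.pi * I * T * x ^ 2) *
        jacobiTheta₂ (x * T + 1 / 2) T := by
  have h0 : τ ≠ 0 := by rintro rfl; simp at hτ
  rw [theta2_eq_jT x hτ hre, jacobiTheta₂_functional_equation,
    ← jacobiTheta₂_neg_left ((x + τ / 2) / τ), ← hT, ← jacobiTheta₂_add_left]
  have e1 : -((x + τ / 2) / τ) + 1 = x * T + 1 / 2 := by rw [hT]; field_simp; ring
  rw [e1]
  have e2 : Complex.exp (Real.pi * I * T * x ^ 2) =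
      Complex.exp (Real.pi * I * τ / 4) * Complex.exp (Real.pi * I * x) *
      Complex.exp (-Real.pi * I * (x + τ / 2) ^ 2 / τ) := by
    rw [← Complex.exp_add, ← Complex.exp_add, hT]
    congr 1; field_simp; ring
  rw [e2]; ring

lemma jT_bound {y : ℝ} (hy : y ∈ Icc (-(1/2) : ℝ) 0) (s : ℝ) {T : ℂ}
    (hT : 1 ≤ Real.pi * T.im) :
    ‖jacobiTheta₂ (y * T + s) T - 1 - Complex.exp (Real.pi * I * T * (1 + 2 * y) +
      2 * Real.pi * I * s)‖ ≤ 4 * Real.exp (-(Real.pi * T.im)) := by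
  have hTim : 0 < T.im := by
    have := Real.pi_pos
    by_contra h; push Not at h; nlinarith
  set w : ℂ := y * T + s with hw
  set r := Real.exp (-(Real.pi * T.im)) with hr
  have hr0 : 0 < r := Real.exp_pos _
  have hr1 : r ≤ 1 / 2 := by
    have h1 : r ≤ Real.exp (-1) := Real.exp_le_exp.mpr (by linarith)
    have h2 := Real.exp_neg_one_lt_half
    linarith
  have hwim : w.im = y * T.im := by simp [hw]
  have hnorm : ∀ n : ℤ, ∀ k : ℕ, (k : ℝ) ≤ (n:ℝ) ^ 2 + 2 * n * y →
      ‖jacobiTheta₂_term n w T‖ ≤ r ^ k := by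
    intro n k hk
    rw [norm_jacobiTheta₂_term, hwim, hr, ← Real.exp_nat_mul]
    apply Real.exp_le_exp.mpr
    nlinarith
  have hs := (summable_jacobiTheta₂_term_iff w T).mpr hTim
  have h1 : Summable (fun n : ℕ => jacobiTheta₂_term (n : ℤ) w T) :=
    summable_nat' (f := fun n : ℤ => jacobiTheta₂_term n _ _) hs
  have h2 : Summable (fun n : ℕ => jacobiTheta₂_term (-(n + 1 : ℤ)) w T) :=
    summable_neg_succ' (f := fun n : ℤ => jacobiTheta₂_term n _ _) hs
  have hsum := tsum_of_nat_of_neg_add_one (f := fun n : ℤ => jacobiTheta₂_term n w T) h1 h2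
  have hsplit := h1.sum_add_tsum_nat_add 2
  have hg : HasSum (fun n : ℕ => r * r ^ n) (r * (1 - r)⁻¹) :=
    (hasSum_geometric_of_lt_one hr0.le (by linarith)).mul_left r
  have b1 : ‖∑' n : ℕ, jacobiTheta₂_term ((n + 2 : ℕ) : ℤ) w T‖ ≤ r * (1 - r)⁻¹ := by
    apply tsum_of_norm_bounded hg
    intro n
    rw [← pow_succ']
    apply hnorm
    push_cast
    nlinarith [hy.1, hy.2, (Nat.cast_nonneg n : (0:ℝ) ≤ n)]
  have b2 : ‖∑' n : ℕ, jacobiTheta₂_term (-(n + 1 : ℤ)) w T‖ ≤ r * (1 - r)⁻¹ := by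
    apply tsum_of_norm_bounded hg
    intro n
    rw [← pow_succ']
    apply hnorm
    push_cast
    nlinarith [hy.1, hy.2, (Nat.cast_nonneg n : (0:ℝ) ≤ n)]
  have hinv : r * (1 - r)⁻¹ ≤ 2 * r := by
    have : (1 - r)⁻¹ ≤ 2 := by
      rw [inv_le_comm₀ (by linarith) (by norm_num)]; linarith
    nlinarith
  have t0 : jacobiTheta₂_term ((0:ℕ):ℤ) w T = 1 := by simp [jacobiTheta₂_term]
  have t1 : jacobiTheta₂_term ((1:ℕ):ℤ) w T = Complex.exp (Real.pi * I * T * (1 + 2 * y) +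
      2 * Real.pi * I * s) := by
    rw [jacobiTheta₂_term, hw]; congr 1; push_cast; ring
  rw [Finset.sum_range_succ, Finset.sum_range_one, t0, t1] at hsplit
  have : jacobiTheta₂ w T - 1 - Complex.exp (Real.pi * I * T * (1 + 2 * y) +
      2 * Real.pi * I * s) = (∑' n : ℕ, jacobiTheta₂_term ((n + 2 : ℕ) : ℤ) w T) +
      ∑' n : ℕ, jacobiTheta₂_term (-(n + 1 : ℤ)) w T := by
    rw [jacobiTheta₂, hsum, ← hsplit]; ring
  rw [this]
  exact (norm_add_le _ _).trans (by linarith)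

lemma theta3_neg (z q : ℂ) : theta3 (-z) q = theta3 z q := by
  unfold theta3; simp only [mul_neg, Complex.cos_neg]

lemma theta2_neg (z q : ℂ) : theta2 (-z) q = theta2 z q := by
  unfold theta2; simp only [mul_neg, Complex.cos_neg]

/-- complementary lattice ratio -/
def TT (m : ℂ) : ℂ := I * ellK m / ellK (1 - m)

lemma QQ_eq (m : ℂ) : QQ m = Real.pi * I * TT m := by
  unfold QQ TT
  linear_combination (-(Real.pi : ℂ) * ellK m / ellK (1 - m)) * Complex.I_mul_I

lemma pi_mul_TT_im (m : ℂ) : Real.pi * (TT m).im = -(QQ m).re := by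
  rw [QQ_eq]; simp

/-- transformed theta series -/
def AA (y s : ℝ) (m : ℂ) : ℂ := jacobiTheta₂ (y * TT m + s) (TT m)

/-- common prefactor -/
def cc (m : ℂ) : ℂ := 1 / (-I * tauC m) ^ (1 / 2 : ℂ)

lemma ev_theta : ∀ᶠ m in lf, ellK m ≠ 0 ∧ cc m ≠ 0 ∧
    (∀ x : ℝ, theta3 (Real.pi * x) (nome m) = cc m * Complex.exp (QQ m * x ^ 2) * AA x 0 m) ∧
    (∀ x : ℝ, theta2 (Real.pi * x) (nome m) =
      cc m * Complex.exp (QQ m * x ^ 2) * AA x (1 / 2) m) := by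
  filter_upwards [tendsto_QQ_re.eventually_le_atBot (-(2 * Real.pi))] with m hm
  have hpi := Real.pi_pos
  have hT : 2 ≤ (TT m).im := by
    have := pi_mul_TT_im m
    by_contra h; push Not at h; nlinarith
  have hT0 : TT m ≠ 0 := by intro h; rw [h] at hT; norm_num at hT
  have hK : ellK m ≠ 0 := by intro h; apply hT0; simp [TT, h]
  have hK' : ellK (1 - m) ≠ 0 := by intro h; apply hT0; simp [TT, h]
  have hτT : TT m = -1 / tauC m := by
    unfold TT tauC; field_simp; rw [Complex.I_sq]
  have hτT' : tauC m = -1 / TT m := by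
    unfold TT tauC; field_simp; rw [Complex.I_sq]
  have hTn : 2 ≤ ‖TT m‖ := hT.trans (Complex.im_le_norm _)
  have hτ : 0 < (tauC m).im := by
    rw [hτT', neg_div, one_div, Complex.neg_im, Complex.inv_im, neg_div, neg_neg]
    exact div_pos (by linarith) (Complex.normSq_pos.mpr hT0)
  have hre : |(tauC m).re| < 1 := by
    refine (Complex.abs_re_le_norm _).trans_lt ?_
    rw [hτT', norm_div, norm_neg, norm_one, div_lt_one (by linarith)]
    linarith
  have hnome : nome m = Complex.exp (Real.pi * I * tauC m) := by
    unfold nome tauC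
    congr 1
    linear_combination (-(Real.pi : ℂ) * ellK (1 - m) / ellK m) * Complex.I_mul_I
  refine ⟨hK, ?_, ?_, ?_⟩
  · unfold cc
    apply one_div_ne_zero
    rw [Ne, Complex.cpow_eq_zero_iff]
    have : -I * tauC m ≠ 0 := by
      apply mul_ne_zero (by simp)
      intro h; rw [h] at hτ; simp at hτ
    tauto
  · intro x
    rw [hnome, theta3_transf _ hτ hτT, cc, QQ_eq, AA, Complex.ofReal_zero, add_zero]
  · intro x
    rw [hnome, theta2_transf _ hτ hre hτT, cc, QQ_eq, AA]
    push_cast; rfl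

lemma ev_formulas (u : ℝ) : ∀ᶠ m in lf,
    sn (ellK m * u) m = AA 0 0 m / AA 0 (1/2) m * (AA ((u - 1) / 2) (1/2) m / AA ((u - 1) / 2) 0 m)
    ∧ cn (ellK m * u) m = Complex.exp (QQ m * (u / 2 : ℝ)) *
      (AA (-(1/2)) 0 m * AA (-(u / 2)) (1/2) m / (AA 0 (1/2) m * AA ((u - 1) / 2) 0 m))
    ∧ dn (ellK m * u) m = Complex.exp (QQ m * (u / 2 : ℝ)) *
      (AA (-(1/2)) 0 m * AA (-(u / 2)) 0 m / (AA 0 0 m * AA ((u - 1) / 2) 0 m)) := by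
  filter_upwards [ev_theta] with m hm
  obtain ⟨hK, hc, h3, h2⟩ := hm
  have hz : (Real.pi : ℂ) * (ellK m * u) / (2 * ellK m) = Real.pi * (u / 2 : ℝ) := by
    push_cast; field_simp
  have e1 : theta1 (Real.pi * (u / 2 : ℝ)) (nome m) =
      cc m * Complex.exp (QQ m * ((u - 1) / 2 : ℝ) ^ 2) * AA ((u - 1) / 2) (1 / 2) m := by
    rw [theta1_eq_theta2, ← h2]; congr 1; push_cast; ring
  have e4 : theta4 (Real.pi * (u / 2 : ℝ)) (nome m) =
      cc m * Complex.exp (QQ m * ((u - 1) / 2 : ℝ) ^ 2) * AA ((u - 1) / 2) 0 m := by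
    rw [theta4_eq_theta3, ← h3]; congr 1; push_cast; ring
  have e2 : theta2 (Real.pi * (u / 2 : ℝ)) (nome m) =
      cc m * Complex.exp (QQ m * (-(u / 2) : ℝ) ^ 2) * AA (-(u / 2)) (1 / 2) m := by
    rw [← h2, ← theta2_neg]; congr 1; push_cast; ring
  have e3 : theta3 (Real.pi * (u / 2 : ℝ)) (nome m) =
      cc m * Complex.exp (QQ m * (-(u / 2) : ℝ) ^ 2) * AA (-(u / 2)) 0 m := by
    rw [← h3, ← theta3_neg]; congr 1; push_cast; ring
  have z4 : theta4 0 (nome m) =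
      cc m * Complex.exp (QQ m * (-(1/2) : ℝ) ^ 2) * AA (-(1/2)) 0 m := by
    rw [theta4_eq_theta3, ← h3]; congr 1; push_cast; ring
  have z3 : theta3 0 (nome m) = cc m * AA 0 0 m := by
    have := h3 0; simpa using this
  have z2 : theta2 0 (nome m) = cc m * AA 0 (1/2) m := by
    have := h2 0; simpa using this
  have hexp : Complex.exp (QQ m * (u / 2 : ℝ)) = Complex.exp (QQ m * (-(1/2) : ℝ) ^ 2) *
      Complex.exp (QQ m * (-(u / 2) : ℝ) ^ 2) / Complex.exp (QQ m * ((u - 1) / 2 : ℝ) ^ 2) := by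
    rw [← Complex.exp_add, ← Complex.exp_sub]; congr 1; push_cast; ring
  unfold sn cn dn
  rw [hz, e1, e2, e3, e4, z4, z3, z2, hexp]
  have n1 := Complex.exp_ne_zero (QQ m * ((u - 1) / 2 : ℝ) ^ 2)
  generalize Complex.exp (QQ m * ((u - 1) / 2 : ℝ) ^ 2) = a at *
  generalize Complex.exp (QQ m * (-(1/2) : ℝ) ^ 2) = b at *
  generalize Complex.exp (QQ m * (-(u / 2) : ℝ) ^ 2) = d at *
  have hcanc : ∀ x y : ℂ, cc m * a * x / (cc m * a * y) = x / y := fun x y =>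
    mul_div_mul_left _ _ (mul_ne_zero hc n1)
  refine ⟨?_, ?_, ?_⟩
  · rw [hcanc, mul_div_mul_left _ _ hc]
  · rw [mul_assoc, mul_assoc, mul_assoc, mul_div_mul_left _ _ hc,
      mul_div_mul_left _ _ hc]
    simp only [div_eq_mul_inv, mul_inv]; ring
  · rw [mul_assoc, mul_assoc, mul_assoc, mul_div_mul_left _ _ hc,
      mul_div_mul_left _ _ hc]
    simp only [div_eq_mul_inv, mul_inv]; ring

lemma tendsto_exp_QQ {α : ℝ} (hα : 0 < α) :
    Tendsto (fun m => Complex.exp (QQ m * α)) lf (𝓝 0) := by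
  rw [tendsto_zero_iff_norm_tendsto_zero]
  simp only [Complex.norm_exp, Complex.re_mul_ofReal]
  exact Real.tendsto_exp_atBot.comp (tendsto_QQ_re.atBot_mul_const hα)

lemma tendsto_err {y : ℝ} (hy : y ∈ Icc (-(1/2) : ℝ) 0) (s : ℝ) {α : ℝ} (hα : α < 1) :
    Tendsto (fun m => (AA y s m - 1 - Complex.exp (QQ m * (1 + 2 * y : ℝ)) *
      Complex.exp (2 * Real.pi * I * s)) / Complex.exp (QQ m * α)) lf (𝓝 0) := by
  have h := ((tendsto_exp_QQ (sub_pos.mpr hα)).norm.const_mul 4)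
  rw [norm_zero, mul_zero] at h
  refine squeeze_zero_norm' ?_ h
  filter_upwards [tendsto_QQ_re.eventually_le_atBot (-1)] with m hm
  have hb := jT_bound hy s (T := TT m) (by rw [pi_mul_TT_im]; linarith)
  rw [Complex.exp_add, ← QQ_eq, pi_mul_TT_im, neg_neg] at hb
  have he : ‖Complex.exp (QQ m * (1 - α : ℝ))‖ * ‖Complex.exp (QQ m * α)‖ = Real.exp (QQ m).re := by
    rw [← norm_mul, ← Complex.exp_add, ← mul_add, ← Complex.ofReal_add, sub_add_cancel,
      Complex.ofReal_one, mul_one, Complex.norm_exp]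
  rw [norm_div, div_le_iff₀ (by simp), mul_assoc (4:ℝ), he]
  refine le_trans (le_of_eq ?_) hb
  unfold AA; push_cast; rfl

lemma tendsto_AA {y : ℝ} (hy : y ∈ Ioc (-(1/2) : ℝ) 0) (s : ℝ) :
    Tendsto (AA y s) lf (𝓝 1) := by
  have h1 := tendsto_err ⟨hy.1.le, hy.2⟩ s (α := 0) zero_lt_one
  have h2 := (tendsto_exp_QQ (α := 1 + 2 * y) (by linarith [hy.1])).mul_const
    (Complex.exp (2 * Real.pi * I * s))
  have h3 := (h1.add h2).add_const 1
  simp only [zero_mul, zero_add] at h3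
  refine h3.congr fun m => ?_
  simp

lemma tendsto_AA_half : Tendsto (AA (-(1/2)) 0) lf (𝓝 2) := by
  have h1 := tendsto_err (y := -(1/2)) ⟨le_rfl, by norm_num⟩ 0 (α := 0) zero_lt_one
  have h3 := h1.add_const 2
  simp only [zero_add] at h3
  refine h3.congr fun m => ?_
  norm_num
  ring

lemma exp_two_pi_half : Complex.exp (2 * Real.pi * I * ((1/2 : ℝ) : ℂ)) = -1 := by
  rw [← Complex.exp_pi_mul_I]; congr 1; push_cast; ring

lemma ev_ne : ∀ᶠ m : ℂ in lf, 1 - m ≠ 0 := by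
  filter_upwards [ev_notMem_cut] with m hm
  exact slitPlane_ne_zero (one_sub_mem_slit_one hm)

lemma tendsto_ratio (α : ℝ) :
    Tendsto (fun m => Complex.exp (QQ m * α) / (1 - m) ^ (α : ℂ)) lf
      (𝓝 ((2:ℂ) ^ (-(4 * α) : ℂ))) := by
  have h1 := (tendsto_QQ.mul_const (α : ℂ)).cexp
  rw [zero_mul, Complex.exp_zero] at h1
  have h2 := h1.mul_const ((2:ℂ) ^ (-(4 * α) : ℂ))
  rw [one_mul] at h2
  refine h2.congr' ?_
  filter_upwards [ev_ne] with m hm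
  have hl : (Real.log 2 : ℂ) = Complex.log 2 := by
    rw [Complex.ofReal_log (by norm_num)]; norm_num
  rw [Complex.cpow_def_of_ne_zero hm, Complex.cpow_def_of_ne_zero two_ne_zero,
    ← Complex.exp_add, ← Complex.exp_sub, hl]
  congr 1; ring

lemma littleO_aux {f : ℂ → ℂ} {C a : ℂ}
    (h : Tendsto (fun m => f m / (1 - m) ^ a) lf (𝓝 C)) :
    (fun m => f m - C * (1 - m) ^ a) =o[lf] (fun m : ℂ => (1 - m) ^ a) := by
  have hne : ∀ᶠ m : ℂ in lf, (1 - m) ^ a ≠ 0 := by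
    filter_upwards [ev_ne] with m hm
    rw [Ne, Complex.cpow_eq_zero_iff]; tauto
  rw [isLittleO_iff_tendsto' (hne.mono fun m h1 h2 => absurd h2 h1)]
  have h2 := h.sub_const C
  rw [sub_self] at h2
  refine h2.congr' ?_
  filter_upwards [hne] with m hm
  field_simp

lemma tendsto_cd {u : ℝ} (hu : u ∈ Set.Ioo (0 : ℝ) 1) (s : ℝ) :
    Tendsto (fun m => Complex.exp (QQ m * (u / 2 : ℝ)) *
      (AA (-(1/2)) 0 m * AA (-(u / 2)) s m / (AA 0 s m * AA ((u - 1) / 2) 0 m)) /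
      (1 - m) ^ ((u : ℂ) / 2)) lf (𝓝 ((2 : ℂ) ^ ((1 : ℂ) - 2 * (u : ℂ)))) := by
  have h1 := tendsto_ratio (u / 2)
  have h2 := (tendsto_AA_half.mul (tendsto_AA (y := -(u / 2)) ⟨by linarith [hu.2], by linarith [hu.1]⟩ s)).div
    ((tendsto_AA (y := 0) ⟨by norm_num, le_rfl⟩ s).mul
      (tendsto_AA (y := (u - 1) / 2) ⟨by linarith [hu.1], by linarith [hu.2]⟩ 0)) (by norm_num)
  have h3 := h1.mul h2
  have e : (2:ℂ) ^ (-(4 * ((u / 2 : ℝ) : ℂ))) * (2 * 1 / (1 * 1)) =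
      (2 : ℂ) ^ ((1 : ℂ) - 2 * (u : ℂ)) := by
    rw [Complex.cpow_sub _ _ two_ne_zero, Complex.cpow_one, Complex.cpow_neg]
    push_cast; ring_nf
  rw [e] at h3
  refine h3.congr fun m => ?_
  simp only [Pi.div_apply]
  push_cast
  ring

lemma tendsto_s {u : ℝ} (hu : u ∈ Set.Ioo (0 : ℝ) 1) :
    Tendsto (fun m => (AA 0 0 m / AA 0 (1/2) m *
      (AA ((u - 1) / 2) (1/2) m / AA ((u - 1) / 2) 0 m) - 1) / (1 - m) ^ (u : ℂ)) lf
      (𝓝 (-(2 : ℂ) ^ ((1 : ℂ) - 4 * (u : ℂ)))) := by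
  have hy0 : (0:ℝ) ∈ Ioc (-(1/2) : ℝ) 0 := ⟨by norm_num, le_rfl⟩
  have hy1 : (u - 1) / 2 ∈ Ioc (-(1/2) : ℝ) 0 := ⟨by linarith [hu.1], by linarith [hu.2]⟩
  have hE : ∀ {y : ℝ}, y ∈ Icc (-(1/2) : ℝ) 0 → ∀ s : ℝ, _ := fun {y} hy s =>
    tendsto_err hy s hu.2
  have a00 := tendsto_AA hy0 0
  have a01 := tendsto_AA hy0 (1/2)
  have a10 := tendsto_AA hy1 0
  have a11 := tendsto_AA hy1 (1/2)
  have hq : Tendsto (fun m => Complex.exp (QQ m * (1:ℝ)) / Complex.exp (QQ m * u)) lf (𝓝 0) := by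
    refine (tendsto_exp_QQ (sub_pos.mpr hu.2)).congr fun m => ?_
    rw [← Complex.exp_sub]; congr 1; push_cast; ring
  -- errors divided by `E`
  have b00 : Tendsto (fun m => (AA 0 0 m - 1) / Complex.exp (QQ m * u)) lf (𝓝 0) := by
    have h := (hE (Ioc_subset_Icc_self hy0) 0).add hq
    rw [add_zero] at h
    refine h.congr fun m => ?_
    rw [← add_div]; congr 1; simp
  have b01 : Tendsto (fun m => (AA 0 (1/2) m - 1) / Complex.exp (QQ m * u)) lf (𝓝 0) := by
    have h := (hE (Ioc_subset_Icc_self hy0) (1/2)).sub hq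
    rw [sub_zero] at h
    refine h.congr fun m => ?_
    rw [← sub_div, exp_two_pi_half]; congr 1; simp
  have hu1 : 1 + 2 * ((u - 1) / 2) = u := by ring
  have b10 : Tendsto (fun m => (AA ((u - 1) / 2) 0 m - 1) / Complex.exp (QQ m * u)) lf (𝓝 1) := by
    have h := (hE (Ioc_subset_Icc_self hy1) 0).add_const 1
    rw [zero_add] at h
    refine h.congr fun m => ?_
    have := Complex.exp_ne_zero (QQ m * u)
    rw [hu1]; field_simp; simp
  have b11 : Tendsto (fun m => (AA ((u - 1) / 2) (1/2) m - 1) / Complex.exp (QQ m * u)) lf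
      (𝓝 (-1)) := by
    have h := (hE (Ioc_subset_Icc_self hy1) (1/2)).sub_const 1
    rw [zero_sub] at h
    refine h.congr fun m => ?_
    have := Complex.exp_ne_zero (QQ m * u)
    rw [hu1, exp_two_pi_half]; field_simp; ring
  have h1 := (((b00.mul a11).add b11).sub ((b01.mul a10).add b10)).div (a01.mul a10) (by norm_num)
  have h2 := h1.mul (tendsto_ratio u)
  have e : (0 * 1 + -1 - (0 * 1 + 1)) / (1 * 1) * (2:ℂ) ^ (-(4 * (u : ℂ))) =
      -(2 : ℂ) ^ ((1 : ℂ) - 4 * (u : ℂ)) := by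
    rw [Complex.cpow_sub _ _ two_ne_zero, Complex.cpow_one, Complex.cpow_neg]
    ring
  rw [e] at h2
  refine h2.congr' ?_
  filter_upwards [a01.eventually_ne one_ne_zero, a10.eventually_ne one_ne_zero] with m n1 n2
  have := Complex.exp_ne_zero (QQ m * u)
  simp only [Pi.div_apply]
  generalize ((1:ℂ) - m) ^ (u : ℂ) = g
  rw [← mul_div_assoc]
  congr 1
  field_simp
  ring

/-- For `u ∈ (0,1)`, as `m → 1` within `ℂ ∖ [1,∞)` and with
`m₁ = 1 − m` (principal branch powers):
`sn(K(m)u|m) = 1 − 2^{1−4u} m₁^u + o(m₁^u)`,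
`cn(K(m)u|m) = 2^{1−2u} m₁^{u/2} + o(m₁^{u/2})`,
`dn(K(m)u|m) = 2^{1−2u} m₁^{u/2} + o(m₁^{u/2})`. -/
theorem sn_cn_dn_asymp_one (u : ℝ) (hu : u ∈ Set.Ioo (0 : ℝ) 1) :
    ((fun m : ℂ =>
        sn (ellK m * u) m - (1 - (2 : ℂ) ^ ((1 : ℂ) - 4 * (u : ℂ)) * (1 - m) ^ (u : ℂ)))
      =o[nhdsWithin 1 cutᶜ] (fun m : ℂ => (1 - m) ^ (u : ℂ))) ∧
    ((fun m : ℂ =>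
        cn (ellK m * u) m - (2 : ℂ) ^ ((1 : ℂ) - 2 * (u : ℂ)) * (1 - m) ^ ((u : ℂ) / 2))
      =o[nhdsWithin 1 cutᶜ] (fun m : ℂ => (1 - m) ^ ((u : ℂ) / 2))) ∧
    ((fun m : ℂ =>
        dn (ellK m * u) m - (2 : ℂ) ^ ((1 : ℂ) - 2 * (u : ℂ)) * (1 - m) ^ ((u : ℂ) / 2))
      =o[nhdsWithin 1 cutᶜ] (fun m : ℂ => (1 - m) ^ ((u : ℂ) / 2))) := by
  refine ⟨?_, ?_, ?_⟩
  · have h := littleO_aux (f := fun m => sn (ellK m * u) m - 1)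
      (C := -(2 : ℂ) ^ ((1 : ℂ) - 4 * (u : ℂ))) (a := u) ?_
    · refine h.congr_left fun m => ?_
      ring
    · refine (tendsto_s hu).congr' ?_
      filter_upwards [ev_formulas u] with m hm
      rw [hm.1]
  · apply littleO_aux
    refine (tendsto_cd hu (1/2)).congr' ?_
    filter_upwards [ev_formulas u] with m hm
    rw [hm.2.1]
  · apply littleO_aux
    refine (tendsto_cd hu 0).congr' ?_
    filter_upwards [ev_formulas u] with m hm
    rw [hm.2.2]
end
end

section
/- For every fixed u ∈ (0,1), the function μ ↦ φ(u,μ) := dc²(K(1−μ)u | 1−μ) − dc²(K(μ)u | μ) is strictly increasing on the interval (0,1). -/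
noncomputable section

open Complex Filter Set Asymptotics

/-- General term of the weighted theta series. -/
def phG_term (c : ℝ) (k : ℕ) (z t : ℝ) (n : ℤ) : ℂ :=
  ((n : ℂ) + c) ^ k * cexp (-(t : ℂ) * ((n : ℂ) + c) ^ 2 + 2 * I * ((n : ℂ) + c) * z)

/-- Weighted theta series. -/
def phG (c : ℝ) (k : ℕ) (z t : ℝ) : ℂ := ∑' n : ℤ, phG_term c k z t n

/-- Summable bound. -/
def phBd (c : ℝ) (k : ℕ) (t : ℝ) (n : ℤ) : ℝ := |(n : ℝ) + c| ^ k * Real.exp (-t * ((n : ℝ) + c) ^ 2)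

lemma phG_term_norm (c : ℝ) (k : ℕ) (z t : ℝ) (n : ℤ) : ‖phG_term c k z t n‖ = phBd c k t n := by
  unfold phG_term phBd
  rw [norm_mul, norm_pow, Complex.norm_exp]
  have h1 : ((n : ℂ) + c) = (((n : ℝ) + c : ℝ) : ℂ) := by push_cast; rfl
  rw [h1]
  congr 2
  · rw [Complex.norm_real, Real.norm_eq_abs]
  · have : -(t : ℂ) * (((n : ℝ) + c : ℝ) : ℂ) ^ 2 + 2 * I * (((n : ℝ) + c : ℝ) : ℂ) * z
      = ((-t * ((n : ℝ) + c) ^ 2 : ℝ) : ℂ) + ((2 * ((n : ℝ) + c) * z : ℝ) : ℂ) * I := by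
      push_cast; ring
    rw [this]
    simp only [add_re, ofReal_re, re_ofReal_mul, I_re, mul_zero, add_zero]

lemma phBd_summable (c : ℝ) (k : ℕ) {t : ℝ} (ht : 0 < t) : Summable (phBd c k t) := by
  have hpi := Real.pi_pos
  have h0 := summable_pow_mul_jacobiTheta₂_term_bound (|c| * t / Real.pi) (T := t / Real.pi) (by positivity) 0
  have hk := summable_pow_mul_jacobiTheta₂_term_bound (|c| * t / Real.pi) (T := t / Real.pi) (by positivity) k
  refine Summable.of_nonneg_of_le (fun n => by unfold phBd; positivity) (fun n => ?_)
    ((hk.mul_left (2 ^ k)).add (h0.mul_left (2 ^ k * |c| ^ k)))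
  unfold phBd
  have e1 : (-Real.pi * (t / Real.pi * (n : ℝ) ^ 2 - 2 * (|c| * t / Real.pi) * |(n : ℝ)|))
      = -t * ((n : ℝ) ^ 2 - 2 * |c| * |(n : ℝ)|) := by
    field_simp
  rw [Int.cast_abs, e1]
  have e2 : Real.exp (-t * ((n : ℝ) + c) ^ 2) ≤ Real.exp (-t * ((n : ℝ) ^ 2 - 2 * |c| * |(n : ℝ)|)) := by
    apply Real.exp_le_exp.mpr
    have : -(|c| * |(n : ℝ)|) ≤ c * n := by rw [← abs_mul]; exact neg_abs_le _
    nlinarith [sq_nonneg c]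
  have e3 : |(n : ℝ) + c| ^ k ≤ 2 ^ k * |(n : ℝ)| ^ k + 2 ^ k * |c| ^ k := by
    have h1 : |(n : ℝ) + c| ≤ |(n : ℝ)| + |c| := abs_add_le _ _
    rcases le_total |(n : ℝ)| |c| with h | h
    · calc |(n : ℝ) + c| ^ k ≤ (2 * |c|) ^ k := by gcongr; linarith
        _ = 2 ^ k * |c| ^ k := by rw [mul_pow]
        _ ≤ _ := by have : 0 ≤ 2 ^ k * |(n : ℝ)| ^ k := by positivity
                    linarith
    · calc |(n : ℝ) + c| ^ k ≤ (2 * |(n : ℝ)|) ^ k := by gcongr; linarith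
        _ = 2 ^ k * |(n : ℝ)| ^ k := by rw [mul_pow]
        _ ≤ _ := by have : 0 ≤ 2 ^ k * |c| ^ k := by positivity
                    linarith
  calc _ ≤ (2 ^ k * |(n : ℝ)| ^ k + 2 ^ k * |c| ^ k) * Real.exp (-t * ((n : ℝ) ^ 2 - 2 * |c| * |(n : ℝ)|)) := by
        gcongr
    _ = _ := by ring

lemma phG_summable (c : ℝ) (k : ℕ) (z : ℝ) {t : ℝ} (ht : 0 < t) : Summable (phG_term c k z t) := by
  refine Summable.of_norm ?_
  simp_rw [phG_term_norm]
  exact phBd_summable c k ht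

lemma phG_hasDerivAt_z (c : ℝ) (k : ℕ) {t : ℝ} (ht : 0 < t) (z : ℝ) :
    HasDerivAt (fun z => phG c k z t) (2 * I * phG c (k + 1) z t) z := by
  have := hasDerivAt_tsum (g := fun (n : ℤ) (z : ℝ) => phG_term c k z t n)
    (g' := fun (n : ℤ) (z : ℝ) => 2 * I * phG_term c (k + 1) z t n)
    (u := fun n => 2 * phBd c (k + 1) t n) (y₀ := 0)
    ((phBd_summable c (k + 1) ht).mul_left 2) ?_ ?_ (phG_summable c k 0 ht) z
  · rw [tsum_mul_left] at this
    exact this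
  · intro n y
    unfold phG_term
    have h1 : HasDerivAt (fun y : ℝ => (y : ℂ)) 1 y := Complex.ofRealCLM.hasDerivAt
    have h2 := (((h1.const_mul (2 * I * ((n : ℂ) + c))).const_add
      (-(t : ℂ) * ((n : ℂ) + c) ^ 2)).cexp).const_mul (((n : ℂ) + c) ^ k)
    refine h2.congr_deriv ?_
    ring
  · intro n y
    rw [norm_mul, phG_term_norm]
    simp

lemma phG_hasDerivAt_t (c : ℝ) (k : ℕ) {t : ℝ} (ht : 0 < t) (z : ℝ) :
    HasDerivAt (fun t => phG c k z t) (-phG c (k + 2) z t) t := by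
  have := hasDerivAt_tsum_of_isPreconnected (g := fun (n : ℤ) (t : ℝ) => phG_term c k z t n)
    (g' := fun (n : ℤ) (t : ℝ) => -phG_term c (k + 2) z t n)
    (u := fun n => phBd c (k + 2) (t / 2) n) (y₀ := t) (y := t) (t := Ioi (t / 2))
    (phBd_summable c (k + 2) (by linarith)) isOpen_Ioi isPreconnected_Ioi ?_ ?_
    (by simp [ht]) (phG_summable c k z ht) (by simp [ht])
  · rw [tsum_neg] at this
    exact this
  · intro n y _
    unfold phG_term
    have h1 : HasDerivAt (fun y : ℝ => (y : ℂ)) 1 y := Complex.ofRealCLM.hasDerivAt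
    have h2 := (((h1.neg.mul_const (((n : ℂ) + c) ^ 2)).add_const
      (2 * I * ((n : ℂ) + c) * z)).cexp).const_mul (((n : ℂ) + c) ^ k)
    refine h2.congr_deriv ?_
    simp only [Pi.neg_apply]
    ring
  · intro n y hy
    rw [norm_neg, phG_term_norm]
    unfold phBd
    have hy' : t / 2 ≤ y := le_of_lt hy
    gcongr

/-- Product of two theta series. -/
lemma phG_mul (x y : ℝ) {t : ℝ} (ht : 0 < t) :
    phG 0 0 (x + y) t * phG (1 / 2) 0 (x - y) t =
      phG (1 / 4) 0 (2 * x) (2 * t) * phG (-1 / 4) 0 (2 * y) (2 * t) +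
      phG (-1 / 4) 0 (2 * x) (2 * t) * phG (1 / 4) 0 (2 * y) (2 * t) := by
  have h2t : 0 < 2 * t := by linarith
  have S1 := summable_mul_of_summable_norm (phG_summable 0 0 (x + y) ht).norm
    (phG_summable (1 / 2) 0 (x - y) ht).norm
  have T1 := tsum_mul_tsum_of_summable_norm (phG_summable 0 0 (x + y) ht).norm
    (phG_summable (1 / 2) 0 (x - y) ht).norm
  have S2 := summable_mul_of_summable_norm (phG_summable (1 / 4) 0 (2 * x) h2t).norm
    (phG_summable (-1 / 4) 0 (2 * y) h2t).norm
  have T2 := tsum_mul_tsum_of_summable_norm (phG_summable (1 / 4) 0 (2 * x) h2t).norm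
    (phG_summable (-1 / 4) 0 (2 * y) h2t).norm
  have S3 := summable_mul_of_summable_norm (phG_summable (-1 / 4) 0 (2 * x) h2t).norm
    (phG_summable (1 / 4) 0 (2 * y) h2t).norm
  have T3 := tsum_mul_tsum_of_summable_norm (phG_summable (-1 / 4) 0 (2 * x) h2t).norm
    (phG_summable (1 / 4) 0 (2 * y) h2t).norm
  unfold phG
  rw [T1, T2, T3]
  let F : ℤ × ℤ → ℂ := fun p => phG_term 0 0 (x + y) t p.1 * phG_term (1 / 2) 0 (x - y) t p.2
  let e1 : ℤ × ℤ → ℤ × ℤ := fun p => (p.1 + p.2, p.1 - p.2)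
  let e2 : ℤ × ℤ → ℤ × ℤ := fun p => (p.1 + p.2, p.1 - p.2 - 1)
  have i1 : Function.Injective e1 := by
    rintro ⟨a, b⟩ ⟨c, d⟩ h
    simp only [e1, Prod.mk.injEq] at h ⊢
    omega
  have i2 : Function.Injective e2 := by
    rintro ⟨a, b⟩ ⟨c, d⟩ h
    simp only [e2, Prod.mk.injEq] at h ⊢
    omega
  have hc : IsCompl (range e1) (range e2) := by
    constructor
    · rw [Set.disjoint_left]
      rintro ⟨m, n⟩ ⟨⟨a, b⟩, h⟩ ⟨⟨c, d⟩, h'⟩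
      simp only [e1, e2, Prod.mk.injEq] at h h'
      omega
    · rw [codisjoint_iff_le_sup]
      rintro ⟨m, n⟩ _
      rcases Int.even_or_odd' (m + n) with ⟨j, h | h⟩
      · left
        exact ⟨(j, m - j), by simp only [e1, Prod.mk.injEq]; omega⟩
      · right
        exact ⟨(j + 1, m - j - 1), by simp only [e2, Prod.mk.injEq]; omega⟩
  have c1 : F ∘ e1 = fun p => phG_term (1 / 4) 0 (2 * x) (2 * t) p.1 * phG_term (-1 / 4) 0 (2 * y) (2 * t) p.2 := by
    funext ⟨j, l⟩
    simp only [F, e1, Function.comp, phG_term, pow_zero, one_mul, ← Complex.exp_add]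
    congr 1
    push_cast
    ring
  have c2 : F ∘ e2 = fun p => phG_term (-1 / 4) 0 (2 * x) (2 * t) p.1 * phG_term (1 / 4) 0 (2 * y) (2 * t) p.2 := by
    funext ⟨j, l⟩
    simp only [F, e2, Function.comp, phG_term, pow_zero, one_mul, ← Complex.exp_add]
    congr 1
    push_cast
    ring
  have H1 : HasSum (F ∘ e1) _ := c1 ▸ S2.hasSum
  have H2 : HasSum (F ∘ e2) _ := c2 ▸ S3.hasSum
  rw [← c1, ← c2]
  exact (HasSum.add_isCompl hc (i1.hasSum_range_iff.mpr H1) (i2.hasSum_range_iff.mpr H2)).tsum_eq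

lemma phG_conj (c : ℝ) (z t : ℝ) : (starRingEnd ℂ) (phG c 0 z t) = phG (-c) 0 z t := by
  unfold phG
  rw [Complex.conj_tsum, ← Equiv.tsum_eq (Equiv.neg ℤ)]
  refine tsum_congr fun n => ?_
  simp only [phG_term, pow_zero, one_mul, ← Complex.exp_conj, Equiv.neg_apply]
  congr 1
  have h2 : (starRingEnd ℂ) 2 = 2 := Complex.conj_ofNat 2
  simp [h2]
  ring

lemma phG_conj_half (z t : ℝ) : (starRingEnd ℂ) (phG (1 / 2) 0 z t) = phG (1 / 2) 0 z t := by
  rw [phG_conj]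
  unfold phG
  rw [← Equiv.tsum_eq (Equiv.addRight (1 : ℤ))]
  refine tsum_congr fun n => ?_
  simp only [phG_term, pow_zero, one_mul, Equiv.coe_addRight]
  congr 1
  push_cast
  ring

/-- Real theta series. -/
def phR (c z t : ℝ) : ℝ := (phG c 0 z t).re
/-- First derivative in `z`. -/
def phR1 (c z t : ℝ) : ℝ := (2 * I * phG c 1 z t).re
/-- Second derivative in `z`. -/
def phR2 (c z t : ℝ) : ℝ := (-4 * phG c 2 z t).re

lemma hasDerivAt_re_of {f : ℝ → ℂ} {f' : ℂ} {x : ℝ} (h : HasDerivAt f f' x) :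
    HasDerivAt (fun x => (f x).re) f'.re x :=
  Complex.reCLM.hasFDerivAt.comp_hasDerivAt x h

lemma hasDerivAt_im_of {f : ℝ → ℂ} {f' : ℂ} {x : ℝ} (h : HasDerivAt f f' x) :
    HasDerivAt (fun x => (f x).im) f'.im x :=
  Complex.imCLM.hasFDerivAt.comp_hasDerivAt x h

lemma phR_deriv (c : ℝ) {t : ℝ} (ht : 0 < t) (z : ℝ) :
    HasDerivAt (fun z => phR c z t) (phR1 c z t) z :=
  hasDerivAt_re_of (phG_hasDerivAt_z c 0 ht z)

lemma phR1_deriv (c : ℝ) {t : ℝ} (ht : 0 < t) (z : ℝ) :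
    HasDerivAt (fun z => phR1 c z t) (phR2 c z t) z := by
  refine (hasDerivAt_re_of ((phG_hasDerivAt_z c 1 ht z).const_mul (2 * I))).congr_deriv ?_
  unfold phR2
  congr 1
  linear_combination 4 * phG c 2 z t * Complex.I_mul_I

lemma phR_deriv_t (c : ℝ) {t : ℝ} (ht : 0 < t) (z : ℝ) :
    HasDerivAt (fun t => phR c z t) (phR2 c z t / 4) t := by
  refine (hasDerivAt_re_of (phG_hasDerivAt_t c 0 ht z)).congr_deriv ?_
  unfold phR2
  simp
  ring

lemma phG_neg (c z t : ℝ) : phG c 0 (-z) t = phG (-c) 0 z t := by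
  unfold phG
  rw [← Equiv.tsum_eq (Equiv.neg ℤ)]
  refine tsum_congr fun n => ?_
  simp only [phG_term, pow_zero, one_mul, Equiv.neg_apply]
  congr 1
  push_cast
  ring

lemma phG_zero_real (z t : ℝ) : phG 0 0 z t = (phR 0 z t : ℂ) := by
  have := phG_conj 0 z t
  rw [neg_zero] at this
  exact (Complex.conj_eq_iff_re.mp this).symm

lemma phG_half_real (z t : ℝ) : phG (1 / 2) 0 z t = (phR (1 / 2) z t : ℂ) :=
  (Complex.conj_eq_iff_re.mp (phG_conj_half z t)).symm

lemma phR_zero_sub_pi (z t : ℝ) : phR 0 (z - Real.pi) t = phR 0 z t := by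
  unfold phR phG
  congr 1
  refine tsum_congr fun n => ?_
  simp only [phG_term, pow_zero, one_mul]
  rw [Complex.exp_eq_exp_iff_exists_int]
  refine ⟨-n, ?_⟩
  push_cast
  ring

lemma phR_half_sub_pi (z t : ℝ) : phR (1 / 2) (z - Real.pi) t = -phR (1 / 2) z t := by
  unfold phR phG
  rw [← Complex.neg_re, ← tsum_neg]
  congr 1
  refine tsum_congr fun n => ?_
  simp only [phG_term, pow_zero, one_mul]
  rw [← neg_one_mul (cexp _), ← Complex.exp_pi_mul_I, ← Complex.exp_add,
    Complex.exp_eq_exp_iff_exists_int]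
  refine ⟨-n - 1, ?_⟩
  push_cast
  ring

lemma phG_quarter_sub_pi (z t : ℝ) : phG (1 / 4) 0 (z - Real.pi) t = -I * phG (1 / 4) 0 z t := by
  unfold phG
  rw [← tsum_mul_left]
  refine tsum_congr fun n => ?_
  simp only [phG_term, pow_zero, one_mul]
  have : -I = cexp (-(Real.pi : ℂ) / 2 * I) := Complex.exp_neg_pi_div_two_mul_I.symm
  rw [this, ← Complex.exp_add, Complex.exp_eq_exp_iff_exists_int]
  refine ⟨-n, ?_⟩
  push_cast
  ring

lemma phR_zero_pos (c : ℝ) {t : ℝ} (ht : 0 < t) : 0 < phR c 0 t := by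
  have h : phG c 0 0 t = ((∑' n : ℤ, phBd c 0 t n : ℝ) : ℂ) := by
    rw [Complex.ofReal_tsum]
    unfold phG
    refine tsum_congr fun n => ?_
    simp [phG_term, phBd]
  unfold phR
  rw [h, Complex.ofReal_re]
  exact (phBd_summable c 0 ht).tsum_pos (fun n => by unfold phBd; positivity) 0
    (by unfold phBd; positivity)

/-- Wronskian identities. -/
lemma ph_wronskian {t : ℝ} (ht : 0 < t) : ∃ α : ℝ,
    (∀ x, phR1 0 x t * phR (1 / 2) x t - phR 0 x t * phR1 (1 / 2) x t
      = α * (phR 0 (x - Real.pi / 2) t * phR (1 / 2) (x - Real.pi / 2) t)) ∧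
    (∀ x, phR2 0 x t * phR (1 / 2) x t - phR 0 x t * phR2 (1 / 2) x t
      = α * (2 * phR1 0 (x - Real.pi / 2) t * phR (1 / 2) (x - Real.pi / 2) t
        + α * (phR 0 x t * phR (1 / 2) x t))) := by
  have h2t : 0 < 2 * t := by linarith
  set C : ℝ → ℝ := fun x => (phG (1 / 4) 0 (2 * x) (2 * t)).re with hC
  set S : ℝ → ℝ := fun x => (phG (1 / 4) 0 (2 * x) (2 * t)).im with hS
  have hm : ∀ x, phG (-1 / 4) 0 (2 * x) (2 * t) = (starRingEnd ℂ) (phG (1 / 4) 0 (2 * x) (2 * t)) := by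
    intro x
    rw [phG_conj]; norm_num
  have hneg : ∀ x, phG (1 / 4) 0 (2 * (-x)) (2 * t) = (starRingEnd ℂ) (phG (1 / 4) 0 (2 * x) (2 * t)) := by
    intro x
    rw [phG_conj, mul_neg, phG_neg]
  have Cev : ∀ x, C (-x) = C x := by intro x; simp only [hC, hneg, Complex.conj_re]
  have Sod : ∀ x, S (-x) = -S x := by intro x; simp only [hS, hneg, Complex.conj_im]
  have S0 : S 0 = 0 := by have := Sod 0; rw [neg_zero] at this; linarith
  have key : ∀ x y, phR 0 (x + y) t * phR (1 / 2) (x - y) t = 2 * (C x * C y + S x * S y) := by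
    intro x y
    have := phG_mul x y ht
    rw [phG_zero_real, phG_half_real, hm, hm] at this
    have h := congrArg Complex.re this
    simp only [← Complex.ofReal_mul, Complex.ofReal_re, Complex.add_re, Complex.mul_re,
      Complex.conj_re, Complex.conj_im] at h
    rw [h]
    simp only [hC, hS]
    ring
  have C0 : 0 < C 0 := by
    have := phR_zero_pos (1 / 4) h2t
    simpa [hC, phR] using this
  have Csh : ∀ x, C (x - Real.pi / 2) = S x := by
    intro x
    have : 2 * (x - Real.pi / 2) = 2 * x - Real.pi := by ring
    simp only [hC, hS, this, phG_quarter_sub_pi]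
    simp
  have Sd : ∃ s, HasDerivAt S s 0 := by
    have h := hasDerivAt_im_of (phG_hasDerivAt_z (1 / 4) 0 h2t (2 * 0))
    have h3 : HasDerivAt (fun x : ℝ => 2 * x) 2 0 := by
      simpa using (hasDerivAt_id (0 : ℝ)).const_mul 2
    exact ⟨_, h.comp 0 h3⟩
  obtain ⟨s, hs⟩ := Sd
  have prod : ∀ x, phR 0 (x - Real.pi / 2) t * phR (1 / 2) (x - Real.pi / 2) t = 2 * (S x * C 0) := by
    intro x
    have := key (x - Real.pi / 2) 0
    rw [add_zero, sub_zero] at this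
    rw [this, Csh, S0]
    ring
  have W : ∀ x, phR1 0 x t * phR (1 / 2) x t - phR 0 x t * phR1 (1 / 2) x t
      = s / C 0 * (phR 0 (x - Real.pi / 2) t * phR (1 / 2) (x - Real.pi / 2) t) := by
    intro x
    rw [prod]
    have anti : ∀ y, phR 0 (x + y) t * phR (1 / 2) (x - y) t - phR 0 (x - y) t * phR (1 / 2) (x + y) t
        = 4 * S x * S y := by
      intro y
      have h1 := key x y
      have h2 := key x (-y)
      rw [← sub_eq_add_neg, sub_neg_eq_add, Cev, Sod] at h2
      rw [h1, h2]
      ring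
    have hp : HasDerivAt (fun y : ℝ => x + y) 1 0 := (hasDerivAt_id (0 : ℝ)).const_add x
    have hmn : HasDerivAt (fun y : ℝ => x - y) (-1) 0 := (hasDerivAt_id (0 : ℝ)).const_sub x
    have e : ∀ c, HasDerivAt (fun y => phR c (x + y) t) (phR1 c x t * 1) 0 := fun c => by
      have h := phR_deriv c ht (x + 0)
      have := h.comp 0 hp
      rwa [add_zero] at this
    have e' : ∀ c, HasDerivAt (fun y => phR c (x - y) t) (phR1 c x t * (-1)) 0 := fun c => by
      have h := phR_deriv c ht (x - 0)
      have := h.comp 0 hmn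
      rwa [sub_zero] at this
    have d1 := ((e 0).mul (e' (1 / 2))).sub ((e' 0).mul (e (1 / 2)))
    have d2 := hs.const_mul (4 * S x)
    have d1' : HasDerivAt (fun y => 4 * S x * S y) _ 0 := d1.congr_of_eventuallyEq
      (Filter.Eventually.of_forall fun y => (anti y).symm)
    have := d1'.unique d2
    simp only [add_zero, sub_zero] at this
    field_simp
    linarith
  refine ⟨s / C 0, W, fun x => ?_⟩
  set α := s / C 0
  have hmn : HasDerivAt (fun y : ℝ => y - Real.pi / 2) 1 x := (hasDerivAt_id x).sub_const _
  have e' : ∀ c, HasDerivAt (fun y => phR c (y - Real.pi / 2) t) (phR1 c (x - Real.pi / 2) t * 1) x :=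
    fun c => by
      have h := phR_deriv c ht (x - Real.pi / 2)
      have := h.comp x hmn
      exact this
  have d1 := ((e' 0).mul (e' (1 / 2))).const_mul α
  have d2 := ((phR1_deriv 0 ht x).mul (phR_deriv (1 / 2) ht x)).sub
    ((phR_deriv 0 ht x).mul (phR1_deriv (1 / 2) ht x))
  have d1' := d1.congr_of_eventuallyEq (Filter.Eventually.of_forall W)
  have u := d2.unique d1'
  have W2 := W (x - Real.pi / 2)
  have : x - Real.pi / 2 - Real.pi / 2 = x - Real.pi := by ring
  rw [this, phR_zero_sub_pi, phR_half_sub_pi] at W2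
  linear_combination u + α * (-W2)

/-- Finite `q`-Pochhammer product. -/
def phP (q : ℝ) (n : ℕ) : ℝ := ∏ j ∈ Finset.range n, (1 - q ^ (2 * (j + 1)))

/-- Reciprocal of the Pochhammer product, extended by zero. -/
def phV (q : ℝ) (n : ℤ) : ℝ := if 0 ≤ n then (phP q n.toNat)⁻¹ else 0

lemma ph_prod_bound {q : ℝ} (h0 : 0 < q) (h1 : q < 1) (e : ℕ → ℕ) (he : ∀ j, j + 1 ≤ e j) :
    ∃ L : ℝ, 0 < L ∧ Tendsto (fun n => ∏ j ∈ Finset.range n, (1 - q ^ (e j))) atTop (nhds L) ∧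
      ∀ n, L ≤ ∏ j ∈ Finset.range n, (1 - q ^ (e j)) := by
  have hlt : ∀ j, q ^ (e j) < 1 := fun j => pow_lt_one₀ h0.le h1 (by have := he j; omega)
  have hs : Summable (fun j => -q ^ (e j)) := by
    refine Summable.neg ?_
    refine Summable.of_nonneg_of_le (fun j => by positivity) (fun j => ?_)
      (summable_geometric_of_lt_one h0.le h1)
    exact pow_le_pow_of_le_one h0.le h1.le (by have := he j; omega)
  have hm := Real.multipliable_one_add_of_summable hs
  have ht := hm.hasProd.tendsto_prod_nat
  have hne : ∏' j, (1 + -q ^ (e j)) ≠ 0 := by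
    refine tprod_one_add_ne_zero_of_summable ?_ ?_
    · intro j; have := hlt j; linarith
    · exact hs.norm
  simp only [← sub_eq_add_neg] at ht hne
  have hpos : ∀ n, 0 < ∏ j ∈ Finset.range n, (1 - q ^ (e j)) := fun n =>
    Finset.prod_pos fun j _ => by have := hlt j; linarith
  have hanti : Antitone (fun n => ∏ j ∈ Finset.range n, (1 - q ^ (e j))) := by
    refine antitone_nat_of_succ_le fun n => ?_
    rw [Finset.prod_range_succ]
    have := hpos n
    have h2 : 0 < q ^ (e n) := by positivity
    nlinarith
  refine ⟨_, lt_of_le_of_ne (ge_of_tendsto' ht fun n => (hpos n).le) hne.symm, ht, fun n => ?_⟩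
  exact hanti.le_of_tendsto ht n

lemma phP_pos {q : ℝ} (h0 : 0 < q) (h1 : q < 1) (n : ℕ) : 0 < phP q n :=
  Finset.prod_pos fun j _ => by
    have : q ^ (2 * (j + 1)) < 1 := pow_lt_one₀ h0.le h1 (by omega)
    linarith

lemma phP_le_one {q : ℝ} (h0 : 0 < q) (h1 : q < 1) (n : ℕ) : phP q n ≤ 1 :=
  Finset.prod_le_one (fun j _ => by
    have : q ^ (2 * (j + 1)) < 1 := pow_lt_one₀ h0.le h1 (by omega)
    linarith) (fun j _ => by
    have : 0 < q ^ (2 * (j + 1)) := by positivity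
    linarith)

lemma phV_pred {q : ℝ} (h0 : 0 < q) (h1 : q < 1) (n : ℤ) :
    phV q (n - 1) = (1 - q ^ (2 * n)) * phV q n := by
  unfold phV
  rcases lt_trichotomy n 0 with h | h | h
  · rw [if_neg (by omega), if_neg (by omega)]; simp
  · subst h; simp
  · rw [if_pos (by omega), if_pos (by omega)]
    obtain ⟨m, rfl⟩ : ∃ m : ℕ, n = (m : ℤ) + 1 := ⟨(n - 1).toNat, by omega⟩
    have e1 : ((m : ℤ) + 1 - 1).toNat = m := by omega
    have e2 : ((m : ℤ) + 1).toNat = m + 1 := by omega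
    rw [e1, e2]
    have e3 : phP q (m + 1) = phP q m * (1 - q ^ (2 * (m + 1))) := Finset.prod_range_succ _ _
    have e4 : q ^ (2 * ((m : ℤ) + 1)) = q ^ (2 * (m + 1)) := by
      rw [← zpow_natCast]; push_cast; rfl
    have e5 : q ^ (2 * (m + 1)) < 1 := pow_lt_one₀ h0.le h1 (by omega)
    have := phP_pos h0 h1 m
    have e6 : 1 - q ^ (2 * (m + 1)) ≠ 0 := by linarith
    rw [e3, e4, mul_inv]
    field_simp

/-- Coefficients of the finite triple product. -/
def phC (q : ℝ) (N : ℕ) (k : ℤ) : ℝ := phP q (2 * N) * phV q (N - k) * phV q (N + k)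

lemma phC_succ {q : ℝ} (h0 : 0 < q) (h1 : q < 1) (N : ℕ) (k : ℤ) :
    phC q (N + 1) k = (1 + q ^ (4 * N + 2)) * phC q N k
      + q ^ (2 * (N : ℤ) + 2 - 2 * k) * phC q N (k - 1) + q ^ (2 * (N : ℤ) + 2 + 2 * k) * phC q N (k + 1) := by
  unfold phC
  have hq : q ≠ 0 := h0.ne'
  have eP : phP q (2 * (N + 1)) = phP q (2 * N) * (1 - q ^ (4 * N + 2)) * (1 - q ^ (4 * N + 4)) := by
    have : 2 * (N + 1) = 2 * N + 1 + 1 := by ring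
    rw [this]
    unfold phP
    rw [Finset.prod_range_succ, Finset.prod_range_succ]
    ring_nf
  set X := q ^ (2 * (N : ℤ) + 2 - 2 * k) with hX
  set Y := q ^ (2 * (N : ℤ) + 2 + 2 * k) with hY
  have hXY : X * Y = q ^ (4 * N + 4) := by
    rw [hX, hY, ← zpow_add₀ hq, ← zpow_natCast]; congr 1; push_cast; ring
  have hXY2 : q ^ (4 * N + 4) = q ^ (4 * N + 2) * q ^ 2 := by rw [← pow_add]
  have a1 := phV_pred h0 h1 (N + 1 - k)
  have a2 := phV_pred h0 h1 (N - k)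
  have b1 := phV_pred h0 h1 (N + 1 + k)
  have b2 := phV_pred h0 h1 (N + k)
  have x1 : q ^ (2 * ((N : ℤ) + 1 - k)) = X := by rw [hX]; congr 1; ring
  have y1 : q ^ (2 * ((N : ℤ) + 1 + k)) = Y := by rw [hY]; congr 1; ring
  have x2 : q ^ (2 * ((N : ℤ) - k)) * q ^ 2 = X := by
    rw [hX, ← zpow_natCast q 2, ← zpow_add₀ hq]; congr 1; push_cast; ring
  have y2 : q ^ (2 * ((N : ℤ) + k)) * q ^ 2 = Y := by
    rw [hY, ← zpow_natCast q 2, ← zpow_add₀ hq]; congr 1; push_cast; ring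
  have i1 : (N : ℤ) + 1 - k - 1 = N - k := by ring
  have i2 : (N : ℤ) + 1 + k - 1 = N + k := by ring
  rw [i1, x1] at a1
  rw [i2, y1] at b1
  have i3 : (N : ℤ) - (k - 1) = N + 1 - k := by ring
  have i4 : (N : ℤ) + (k - 1) = N + k - 1 := by ring
  have i5 : (N : ℤ) - (k + 1) = N - k - 1 := by ring
  have i6 : (N : ℤ) + (k + 1) = N + 1 + k := by ring
  push_cast
  rw [i3, i4, i5, i6, a2, b2, a1, b1, eP]
  set A := phV q (N + 1 - k)
  set B := phV q (N + 1 + k)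
  set x := q ^ (2 * ((N : ℤ) - k))
  set y := q ^ (2 * ((N : ℤ) + k))
  have hz : q ^ (4 * N + 2) = x * y * q ^ 2 := by
    have : q ^ (4 * N + 2) * q ^ 2 = (x * y * q ^ 2) * q ^ 2 := by rw [← hXY2, ← hXY, ← x2, ← y2]; ring
    exact mul_right_cancel₀ (by positivity) this
  rw [hXY2, hz, ← x2, ← y2]
  ring

lemma ph_finite_triple {q : ℝ} (h0 : 0 < q) (h1 : q < 1) {x : ℂ} (hx : x ≠ 0) (N : ℕ) :
    HasSum (fun k : ℤ => (phC q N k : ℂ) * ((q : ℂ) ^ (k ^ 2) * x ^ k))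
      (∏ n ∈ Finset.range N, ((1 + x * (q : ℂ) ^ (2 * n + 1)) * (1 + x⁻¹ * (q : ℂ) ^ (2 * n + 1)))) := by
  have hq : (q : ℂ) ≠ 0 := by exact_mod_cast h0.ne'
  induction N with
  | zero =>
    simp only [Finset.range_zero, Finset.prod_empty]
    have := hasSum_single (f := fun k : ℤ => (phC q 0 k : ℂ) * ((q : ℂ) ^ (k ^ 2) * x ^ k)) 0 ?_
    · simpa [phC, phV, phP] using this
    · intro k hk
      have : phC q 0 k = 0 := by
        unfold phC phV
        rcases lt_or_gt_of_ne hk with h | h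
        · rw [if_neg (c := 0 ≤ ((0 : ℕ) : ℤ) + k) (by push_cast; omega)]; simp
        · rw [if_neg (c := 0 ≤ ((0 : ℕ) : ℤ) - k) (by push_cast; omega)]; simp
      simp [this]
  | succ N ih =>
    rw [Finset.prod_range_succ]
    set p := ∏ n ∈ Finset.range N, ((1 + x * (q : ℂ) ^ (2 * n + 1)) * (1 + x⁻¹ * (q : ℂ) ^ (2 * n + 1)))
    set Q := (q : ℂ) ^ (2 * N + 1) with hQ
    have s1 := (Equiv.subRight (1 : ℤ)).hasSum_iff.mpr ih
    have s2 := (Equiv.addRight (1 : ℤ)).hasSum_iff.mpr ih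
    have s := ((ih.mul_left (1 + Q ^ 2)).add (s1.mul_left (x * Q))).add (s2.mul_left (x⁻¹ * Q))
    have e : (1 + Q ^ 2) * p + x * Q * p + x⁻¹ * Q * p = p * ((1 + x * Q) * (1 + x⁻¹ * Q)) := by
      field_simp
      ring
    rw [← e]
    refine s.congr_fun ?_
    intro k
    have t1 : x * Q * ((q : ℂ) ^ ((k - 1) ^ 2) * x ^ (k - 1))
        = (q : ℂ) ^ (2 * (N : ℤ) + 2 - 2 * k) * ((q : ℂ) ^ (k ^ 2) * x ^ k) := by
      have hk : x ^ k = x ^ (k - 1) * x := by rw [← zpow_add_one₀ hx]; congr 1; ring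
      have : Q * (q : ℂ) ^ ((k - 1) ^ 2) = (q : ℂ) ^ (2 * (N : ℤ) + 2 - 2 * k) * (q : ℂ) ^ (k ^ 2) := by
        rw [hQ, ← zpow_natCast, ← zpow_add₀ hq, ← zpow_add₀ hq]
        congr 1; push_cast; ring
      rw [hk]
      linear_combination (x ^ (k - 1) * x) * this
    have t2 : x⁻¹ * Q * ((q : ℂ) ^ ((k + 1) ^ 2) * x ^ (k + 1))
        = (q : ℂ) ^ (2 * (N : ℤ) + 2 + 2 * k) * ((q : ℂ) ^ (k ^ 2) * x ^ k) := by
      have hk : x⁻¹ * x ^ (k + 1) = x ^ k := by rw [zpow_add_one₀ hx]; field_simp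
      have : Q * (q : ℂ) ^ ((k + 1) ^ 2) = (q : ℂ) ^ (2 * (N : ℤ) + 2 + 2 * k) * (q : ℂ) ^ (k ^ 2) := by
        rw [hQ, ← zpow_natCast, ← zpow_add₀ hq, ← zpow_add₀ hq]
        congr 1; push_cast; ring
      rw [← hk]
      linear_combination (x⁻¹ * x ^ (k + 1)) * this
    have hQ2 : Q ^ 2 = (q : ℂ) ^ (4 * N + 2) := by rw [hQ, ← pow_mul]; congr 1; ring
    simp only [Function.comp, Equiv.subRight_apply, Equiv.coe_addRight]
    rw [phC_succ h0 h1, hQ2]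
    push_cast
    linear_combination (-(phC q N (k - 1) : ℂ)) * t1 - (phC q N (k + 1) : ℂ) * t2

lemma phV_bound {q L : ℝ} (hL : 0 < L) (h : ∀ n, L ≤ phP q n) (n : ℤ) : 0 ≤ phV q n ∧ phV q n ≤ L⁻¹ := by
  unfold phV
  split_ifs
  · exact ⟨inv_nonneg.mpr (hL.le.trans (h _)), inv_anti₀ hL (h _)⟩
  · exact ⟨le_rfl, by positivity⟩

/-- Jacobi triple product, as a limit. -/
lemma ph_triple {q : ℝ} (h0 : 0 < q) (h1 : q < 1) : ∃ K : ℝ, 0 < K ∧ ∀ x : ℂ, x ≠ 0 →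
    Summable (fun k : ℤ => ((q : ℂ) ^ (k ^ 2) * x ^ k)) →
    Tendsto (fun N => ∏ n ∈ Finset.range N,
      ((1 + x * (q : ℂ) ^ (2 * n + 1)) * (1 + x⁻¹ * (q : ℂ) ^ (2 * n + 1)))) atTop
      (nhds (K * ∑' k : ℤ, ((q : ℂ) ^ (k ^ 2) * x ^ k))) := by
  obtain ⟨L, hL, ht, hb⟩ := ph_prod_bound h0 h1 (fun j => 2 * (j + 1)) (fun j => by omega)
  have ht : Tendsto (phP q) atTop (nhds L) := ht
  have hb : ∀ n, L ≤ phP q n := hb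
  refine ⟨L * L⁻¹ * L⁻¹, by positivity, fun x hx hs => ?_⟩
  rw [← tsum_mul_left]
  have hV : ∀ f : ℕ → ℤ, Tendsto f atTop atTop → Tendsto (fun N => phV q (f N)) atTop (nhds L⁻¹) := by
    intro f hf
    have hn : Tendsto (fun N => (f N).toNat) atTop atTop := by
      rw [tendsto_atTop] at hf ⊢
      intro b
      filter_upwards [hf b] with N hN
      omega
    have := (ht.comp hn).inv₀ hL.ne'
    refine this.congr' ?_
    filter_upwards [hf.eventually_ge_atTop 0] with N hN
    simp [phV, hN]
  have hlim : ∀ k : ℤ, Tendsto (fun N => phC q N k) atTop (nhds (L * L⁻¹ * L⁻¹)) := by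
    intro k
    unfold phC
    refine ((ht.comp ?_).mul (hV _ ?_)).mul (hV _ ?_)
    · exact tendsto_id.const_mul_atTop' (by norm_num)
    · exact tendsto_atTop_add_const_right _ (-k) tendsto_natCast_atTop_atTop
    · exact tendsto_atTop_add_const_right _ k tendsto_natCast_atTop_atTop
  have main := tendsto_tsum_of_dominated_convergence (𝓕 := atTop)
    (f := fun (N : ℕ) (k : ℤ) => (phC q N k : ℂ) * ((q : ℂ) ^ (k ^ 2) * x ^ k))
    (g := fun k : ℤ => ((L * L⁻¹ * L⁻¹ : ℝ) : ℂ) * ((q : ℂ) ^ (k ^ 2) * x ^ k))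
    (bound := fun k => (1 * L⁻¹ * L⁻¹) * ‖(q : ℂ) ^ (k ^ 2) * x ^ k‖)
    (hs.norm.mul_left _) ?_ ?_
  · refine main.congr fun N => ?_
    exact (ph_finite_triple h0 h1 hx N).tsum_eq
  · intro k
    exact ((Complex.continuous_ofReal.tendsto _).comp (hlim k)).mul_const _
  · refine Eventually.of_forall fun N k => ?_
    rw [norm_mul, Complex.norm_real, Real.norm_eq_abs]
    have v1 := phV_bound hL hb (N - k)
    have v2 := phV_bound hL hb (N + k)
    have p1 := phP_le_one h0 h1 (2 * N)
    have p2 := phP_pos h0 h1 (2 * N)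
    gcongr
    unfold phC
    have hLi : 0 < L⁻¹ := by positivity
    rw [abs_of_nonneg (mul_nonneg (mul_nonneg p2.le v1.1) v2.1)]
    gcongr
    · exact v2.1
    · exact v1.1
    · exact v1.2
    · exact v2.2

lemma phG_term_zero (z t : ℝ) (k : ℤ) :
    phG_term 0 0 z t k = ((Real.exp (-t) : ℝ) : ℂ) ^ (k ^ 2) * (cexp (2 * I * z)) ^ k := by
  rw [Complex.ofReal_exp, ← Complex.exp_int_mul, ← Complex.exp_int_mul, ← Complex.exp_add]
  simp only [phG_term, pow_zero, one_mul]
  congr 1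
  push_cast
  ring

lemma phG_term_half (z t : ℝ) (k : ℤ) :
    phG_term (1 / 2) 0 z t k = cexp (-t / 4 + I * z) *
      (((Real.exp (-t) : ℝ) : ℂ) ^ (k ^ 2) * (cexp (-t + 2 * I * z)) ^ k) := by
  rw [Complex.ofReal_exp, ← Complex.exp_int_mul, ← Complex.exp_int_mul, ← Complex.exp_add,
    ← Complex.exp_add]
  simp only [phG_term, pow_zero, one_mul]
  congr 1
  push_cast
  ring

lemma ph_factor (z Q : ℝ) : (1 + cexp (2 * I * z) * Q) * (1 + (cexp (2 * I * z))⁻¹ * Q)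
    = ((1 + 2 * Q * Real.cos (2 * z) + Q ^ 2 : ℝ) : ℂ) := by
  have h : cexp (2 * I * z) * (cexp (2 * I * z))⁻¹ = 1 := mul_inv_cancel₀ (Complex.exp_ne_zero _)
  have h2 : cexp (2 * I * z) + (cexp (2 * I * z))⁻¹ = 2 * Complex.cos (2 * z) := by
    rw [← Complex.exp_neg, Complex.two_cos]
    congr 1 <;> congr 1 <;> ring
  push_cast
  linear_combination (Q : ℂ) ^ 2 * h + Q * h2

lemma ph_factor_lower (z Q : ℝ) (hQ : 0 ≤ Q) : (1 - Q) ^ 2 ≤ 1 + 2 * Q * Real.cos (2 * z) + Q ^ 2 := by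
  nlinarith [Real.neg_one_le_cos (2 * z)]

/-- `θ₃` product. -/
lemma ph_prod3 {t : ℝ} (ht : 0 < t) : ∃ K : ℝ, 0 < K ∧ ∀ z : ℝ, Tendsto (fun N => ∏ n ∈ Finset.range N,
    (1 + 2 * (Real.exp (-t)) ^ (2 * n + 1) * Real.cos (2 * z) + ((Real.exp (-t)) ^ (2 * n + 1)) ^ 2))
    atTop (nhds (K * phR 0 z t)) := by
  have hq0 : 0 < Real.exp (-t) := Real.exp_pos _
  have hq1 : Real.exp (-t) < 1 := by rw [Real.exp_lt_one_iff]; linarith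
  obtain ⟨K, hK, h⟩ := ph_triple hq0 hq1
  refine ⟨K, hK, fun z => ?_⟩
  have hs : Summable (fun k : ℤ => (((Real.exp (-t) : ℝ) : ℂ) ^ (k ^ 2) * (cexp (2 * I * z)) ^ k)) := by
    have := phG_summable 0 0 z ht
    refine this.congr fun k => phG_term_zero z t k
  have h3 := h _ (Complex.exp_ne_zero (2 * I * z)) hs
  have e : ∑' k : ℤ, (((Real.exp (-t) : ℝ) : ℂ) ^ (k ^ 2) * (cexp (2 * I * z)) ^ k) = phG 0 0 z t :=
    tsum_congr fun k => (phG_term_zero z t k).symm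
  rw [e, phG_zero_real] at h3
  have h4 := (Complex.continuous_re.tendsto _).comp h3
  rw [← Complex.ofReal_mul, Complex.ofReal_re] at h4
  refine h4.congr fun N => ?_
  simp only [Function.comp]
  have : ∏ n ∈ Finset.range N, ((1 + cexp (2 * I * z) * ((Real.exp (-t) : ℝ) : ℂ) ^ (2 * n + 1)) *
      (1 + (cexp (2 * I * z))⁻¹ * ((Real.exp (-t) : ℝ) : ℂ) ^ (2 * n + 1))) =
      ((∏ n ∈ Finset.range N, (1 + 2 * (Real.exp (-t)) ^ (2 * n + 1) * Real.cos (2 * z)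
        + ((Real.exp (-t)) ^ (2 * n + 1)) ^ 2) : ℝ) : ℂ) := by
    rw [Complex.ofReal_prod]
    refine Finset.prod_congr rfl fun n _ => ?_
    rw [← ph_factor, Complex.ofReal_pow]
  rw [this, Complex.ofReal_re]

lemma phR_zero_pos' {t : ℝ} (ht : 0 < t) (z : ℝ) : 0 < phR 0 z t := by
  have hq0 : 0 < Real.exp (-t) := Real.exp_pos _
  have hq1 : Real.exp (-t) < 1 := by rw [Real.exp_lt_one_iff]; linarith
  obtain ⟨K, hK, h⟩ := ph_prod3 ht
  obtain ⟨L, hL, -, hb⟩ := ph_prod_bound hq0 hq1 (fun j => 2 * j + 1) (fun j => by omega)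
  have : L ^ 2 ≤ K * phR 0 z t := by
    refine ge_of_tendsto' (h z) fun N => ?_
    calc L ^ 2 ≤ (∏ j ∈ Finset.range N, (1 - Real.exp (-t) ^ (2 * j + 1))) ^ 2 := by
          gcongr; exact hb N
      _ = ∏ j ∈ Finset.range N, (1 - Real.exp (-t) ^ (2 * j + 1)) ^ 2 := by rw [Finset.prod_pow]
      _ ≤ _ := by
          refine Finset.prod_le_prod (fun j _ => sq_nonneg _) fun j _ => ?_
          exact ph_factor_lower z _ (by positivity)
  have h2 : 0 < K * phR 0 z t := lt_of_lt_of_le (by positivity) this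
  exact pos_of_mul_pos_right h2 hK.le

lemma phR_zero_cmp {t : ℝ} (ht : 0 < t) {z w : ℝ} (h0 : 0 ≤ z) (h1 : z ≤ w) (h2 : w ≤ Real.pi / 2) :
    phR 0 w t * (1 + 2 * Real.exp (-t) * Real.cos (2 * z) + Real.exp (-t) ^ 2) ≤
    phR 0 z t * (1 + 2 * Real.exp (-t) * Real.cos (2 * w) + Real.exp (-t) ^ 2) := by
  have hq0 : 0 < Real.exp (-t) := Real.exp_pos _
  obtain ⟨K, hK, h⟩ := ph_prod3 ht
  have hcos : Real.cos (2 * w) ≤ Real.cos (2 * z) :=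
    Real.cos_le_cos_of_nonneg_of_le_pi (by linarith) (by linarith) (by linarith)
  set q := Real.exp (-t)
  have key := le_of_tendsto_of_tendsto
    ((h w).mul_const (1 + 2 * q * Real.cos (2 * z) + q ^ 2))
    ((h z).mul_const (1 + 2 * q * Real.cos (2 * w) + q ^ 2)) ?_
  · have : K * (phR 0 w t * (1 + 2 * q * Real.cos (2 * z) + q ^ 2))
      ≤ K * (phR 0 z t * (1 + 2 * q * Real.cos (2 * w) + q ^ 2)) := by linarith
    exact le_of_mul_le_mul_left this hK
  · filter_upwards [eventually_ge_atTop 1] with N hN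
    obtain ⟨M, rfl⟩ : ∃ M, N = M + 1 := ⟨N - 1, by omega⟩
    rw [Finset.prod_range_succ', Finset.prod_range_succ']
    have hle : ∏ n ∈ Finset.range M, (1 + 2 * q ^ (2 * (n + 1) + 1) * Real.cos (2 * w) + (q ^ (2 * (n + 1) + 1)) ^ 2)
        ≤ ∏ n ∈ Finset.range M, (1 + 2 * q ^ (2 * (n + 1) + 1) * Real.cos (2 * z) + (q ^ (2 * (n + 1) + 1)) ^ 2) := by
      refine Finset.prod_le_prod (fun j _ => ?_) fun j _ => ?_
      · exact (sq_nonneg _).trans (ph_factor_lower w _ (by positivity))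
      · gcongr
    have f1 := (sq_nonneg _).trans (ph_factor_lower w q hq0.le)
    have f2 := (sq_nonneg _).trans (ph_factor_lower z q hq0.le)
    simp only [mul_zero, zero_add, pow_one]
    have := mul_le_mul_of_nonneg_right hle (mul_nonneg f1 f2)
    linarith

lemma ph_deriv_nonpos {g : ℝ → ℝ} {g' x y : ℝ} (hxy : x < y) (hg : HasDerivAt g g' x) (h0 : g x = 0)
    (h : ∀ w ∈ Ioo x y, g w ≤ 0) : g' ≤ 0 := by
  have h1 := (hasDerivAt_iff_tendsto_slope.mp hg).mono_left
    (nhdsWithin_mono x (fun w (hw : w ∈ Ioi x) => ne_of_gt hw))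
  refine le_of_tendsto h1 ?_
  filter_upwards [Ioo_mem_nhdsGT hxy] with w hw
  rw [slope_def_field, h0, sub_zero]
  exact div_nonpos_of_nonpos_of_nonneg (h w hw) (by linarith [hw.1])

lemma phR1_zero_neg {t : ℝ} (ht : 0 < t) {z : ℝ} (h0 : 0 < z) (h1 : z < Real.pi / 2) :
    phR1 0 z t < 0 := by
  have hq0 : 0 < Real.exp (-t) := Real.exp_pos _
  have hq1 : Real.exp (-t) < 1 := by rw [Real.exp_lt_one_iff]; linarith
  set q := Real.exp (-t) with hq
  have hc : HasDerivAt (fun w : ℝ => Real.cos (2 * w)) (-Real.sin (2 * z) * 2) z := by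
    have h3 : HasDerivAt (fun x : ℝ => 2 * x) 2 z := by
      simpa using (hasDerivAt_id z).const_mul 2
    exact h3.cos
  have hd := ((phR_deriv 0 ht z).mul_const (1 + 2 * q * Real.cos (2 * z) + q ^ 2)).sub
    ((((hc.const_mul (2 * q)).const_add 1).add_const (q ^ 2)).const_mul (phR 0 z t))
  have := ph_deriv_nonpos h1 hd (by simp) (fun w hw => by
    have := phR_zero_cmp ht h0.le hw.1.le hw.2.le
    simp only [Pi.sub_apply]
    linarith)
  have hs : 0 < Real.sin (2 * z) := Real.sin_pos_of_pos_of_lt_pi (by linarith) (by linarith)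
  have hp := phR_zero_pos' ht z
  have hf : 0 < 1 + 2 * q * Real.cos (2 * z) + q ^ 2 :=
    lt_of_lt_of_le (by have : 0 < 1 - q := by linarith
                       positivity) (ph_factor_lower z q hq0.le)
  have h5 : 0 < phR 0 z t * (2 * q * (Real.sin (2 * z) * 2)) := by positivity
  by_contra hcon
  push Not at hcon
  have := mul_nonneg hcon hf.le
  linarith

lemma phR_half_lower {t : ℝ} (ht : 0 < t) : ∃ δ : ℝ, 0 < δ ∧ ∀ z : ℝ, 0 ≤ Real.cos z →
    δ * Real.cos z ≤ phR (1 / 2) z t := by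
  have hq0 : 0 < Real.exp (-t) := Real.exp_pos _
  have hq1 : Real.exp (-t) < 1 := by rw [Real.exp_lt_one_iff]; linarith
  obtain ⟨K, hK, h⟩ := ph_triple hq0 hq1
  obtain ⟨L, hL, -, hb⟩ := ph_prod_bound hq0 hq1 (fun j => 2 * j + 2) (fun j => by omega)
  have hq : ((Real.exp (-t) : ℝ) : ℂ) = cexp (-t) := by push_cast; rfl
  set q := Real.exp (-t) with hqdef
  refine ⟨L ^ 2 * 2 * (1 - q) / (K * Real.exp (t / 4)), by
    have : 0 < 1 - q := by linarith
    positivity, fun z hz => ?_⟩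
  set x := cexp (-t + 2 * I * z) with hx
  set E := cexp (2 * I * z) with hE
  have hxE : x = q * E := by rw [hx, hq, hE, ← Complex.exp_add]
  have hqc : (q : ℂ) ≠ 0 := by exact_mod_cast hq0.ne'
  have hE0 : E ≠ 0 := Complex.exp_ne_zero _
  have hs : Summable (fun k : ℤ => ((q : ℂ) ^ (k ^ 2) * x ^ k)) := by
    have := (phG_summable (1 / 2) 0 z ht).mul_left (cexp (-t / 4 + I * z))⁻¹
    refine this.congr fun k => ?_
    rw [phG_term_half, inv_mul_cancel_left₀ (Complex.exp_ne_zero _)]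
  have h3 := h x (Complex.exp_ne_zero _) hs
  have e : cexp (-t / 4 + I * z) * ∑' k : ℤ, ((q : ℂ) ^ (k ^ 2) * x ^ k) = phG (1 / 2) 0 z t := by
    rw [← tsum_mul_left]
    exact tsum_congr fun k => (phG_term_half z t k).symm
  have h4 := (h3.comp (tendsto_add_atTop_nat 1)).const_mul (cexp (I * z))
  have e2 : cexp (I * z) * (K * ∑' k : ℤ, ((q : ℂ) ^ (k ^ 2) * x ^ k))
      = ((K * Real.exp (t / 4) * phR (1 / 2) z t : ℝ) : ℂ) := by
    push_cast
    rw [← phG_half_real, ← e]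
    have : cexp (I * z) = cexp (t / 4) * cexp (-t / 4 + I * z) := by
      rw [← Complex.exp_add]; congr 1; ring
    rw [this]
    ring
  rw [e2] at h4
  have h5 := (Complex.continuous_re.tendsto _).comp h4
  rw [Complex.ofReal_re] at h5
  set g : ℕ → ℝ := fun N => ∏ n ∈ Finset.range N,
    (1 + 2 * q ^ (2 * n + 2) * Real.cos (2 * z) + (q ^ (2 * n + 2)) ^ 2) with hg
  have hprod : ∀ N, ∏ n ∈ Finset.range (N + 1), ((1 + x * (q : ℂ) ^ (2 * n + 1)) *
      (1 + x⁻¹ * (q : ℂ) ^ (2 * n + 1))) = g N * (1 + E⁻¹) * (1 + E * (q : ℂ) ^ (2 * N + 2)) := by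
    intro N
    induction N with
    | zero =>
      simp only [zero_add, Finset.prod_range_one, mul_zero, pow_one, hg, Finset.range_zero,
        Finset.prod_empty, hxE]
      push_cast
      field_simp
    | succ N ih =>
      rw [Finset.prod_range_succ, ih]
      have gs : g (N + 1) = g N * (1 + 2 * q ^ (2 * N + 2) * Real.cos (2 * z) + (q ^ (2 * N + 2)) ^ 2) := by
        simp only [hg]
        rw [Finset.prod_range_succ]
      rw [gs, Complex.ofReal_mul, ← ph_factor, ← hE, hxE]
      push_cast
      have : (↑q * E)⁻¹ * (q : ℂ) ^ (2 * (N + 1) + 1) = E⁻¹ * (q : ℂ) ^ (2 * N + 2) := by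
        have : (q : ℂ) ^ (2 * (N + 1) + 1) = (q : ℂ) ^ (2 * N + 2) * q := by ring
        rw [this]; field_simp
      rw [this]
      ring
  have hcos : cexp (I * z) * (1 + E⁻¹) = ((2 * Real.cos z : ℝ) : ℂ) := by
    push_cast
    rw [Complex.two_cos, hE, ← Complex.exp_neg, mul_add, mul_one, ← Complex.exp_add]
    congr 1 <;> congr 1 <;> ring
  have key : L ^ 2 * 2 * (1 - q) * Real.cos z ≤ K * Real.exp (t / 4) * phR (1 / 2) z t := by
    refine ge_of_tendsto' h5 fun N => ?_
    simp only [Function.comp]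
    rw [hprod]
    have : cexp (I * z) * (g N * (1 + E⁻¹) * (1 + E * (q : ℂ) ^ (2 * N + 2)))
        = ((g N * (2 * Real.cos z) : ℝ) : ℂ) * (1 + ((q ^ (2 * N + 2) : ℝ) : ℂ) * E) := by
      rw [Complex.ofReal_mul, ← hcos]
      push_cast
      ring
    rw [this, Complex.re_ofReal_mul, Complex.add_re, Complex.one_re, Complex.re_ofReal_mul]
    have hgL : L ^ 2 ≤ g N := by
      calc L ^ 2 ≤ (∏ j ∈ Finset.range N, (1 - q ^ (2 * j + 2))) ^ 2 := by
            gcongr; exact hb N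
        _ = ∏ j ∈ Finset.range N, (1 - q ^ (2 * j + 2)) ^ 2 := by rw [Finset.prod_pow]
        _ ≤ _ := by
            refine Finset.prod_le_prod (fun j _ => sq_nonneg _) fun j _ => ?_
            exact ph_factor_lower z _ (by positivity)
    have hEre : -1 ≤ E.re := by
      have h7 : ‖E‖ = 1 := by
        rw [hE, Complex.norm_exp]; simp
      have := Complex.abs_re_le_norm E
      rw [h7] at this
      exact (abs_le.mp this).1
    have hqN : q ^ (2 * N + 2) ≤ q := by
      calc q ^ (2 * N + 2) ≤ q ^ 1 := pow_le_pow_of_le_one hq0.le hq1.le (by omega)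
        _ = q := pow_one q
    have hqN0 : 0 < q ^ (2 * N + 2) := by positivity
    have h8 : 1 - q ≤ 1 + q ^ (2 * N + 2) * E.re := by nlinarith
    calc L ^ 2 * 2 * (1 - q) * Real.cos z = (L ^ 2 * (2 * Real.cos z)) * (1 - q) := by ring
      _ ≤ (g N * (2 * Real.cos z)) * (1 + q ^ (2 * N + 2) * E.re) := by
        have h9 : 0 ≤ 1 - q := by linarith
        gcongr
        exact mul_nonneg ((sq_nonneg L).trans hgL) (by linarith)
  have hKe : 0 < K * Real.exp (t / 4) := by positivity
  rw [div_mul_eq_mul_div, div_le_iff₀ hKe]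
  linarith

lemma phR_zero_neg (z t : ℝ) : phR 0 (-z) t = phR 0 z t := by
  unfold phR
  rw [phG_neg, neg_zero]

lemma phR_half_neg (z t : ℝ) : phR (1 / 2) (-z) t = phR (1 / 2) z t := by
  unfold phR
  rw [phG_neg, ← phG_conj, Complex.conj_re]

lemma phR1_zero_odd {t : ℝ} (ht : 0 < t) (z : ℝ) : phR1 0 (-z) t = -phR1 0 z t := by
  have h1 := phR_deriv 0 ht z
  have h2 : HasDerivAt (fun w => phR 0 (-w) t) (phR1 0 (-z) t * (-1)) z :=
    HasDerivAt.comp z (phR_deriv 0 ht (-z)) (hasDerivAt_neg z)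
  simp only [phR_zero_neg] at h2
  have := h1.unique h2
  linarith

lemma phR_half_neg_half_pi (t : ℝ) : phR (1 / 2) (-(Real.pi / 2)) t = 0 := by
  have h := phR_half_sub_pi (Real.pi / 2) t
  have e : Real.pi / 2 - Real.pi = -(Real.pi / 2) := by ring
  rw [e] at h
  have h2 := phR_half_neg (Real.pi / 2) t
  linarith

/-- The theta quotient. -/
def phY (z t : ℝ) : ℝ := phR (1 / 2) 0 t * phR 0 z t / (phR 0 0 t * phR (1 / 2) z t)

lemma phR_half_pos {t : ℝ} (ht : 0 < t) {z : ℝ} (hz : 0 < Real.cos z) : 0 < phR (1 / 2) z t := by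
  obtain ⟨δ, hδ, h⟩ := phR_half_lower ht
  exact lt_of_lt_of_le (mul_pos hδ hz) (h z hz.le)

lemma phY_pos {t : ℝ} (ht : 0 < t) {z : ℝ} (hz : 0 < Real.cos z) : 0 < phY z t :=
  div_pos (mul_pos (phR_zero_pos _ ht) (phR_zero_pos' ht z))
    (mul_pos (phR_zero_pos _ ht) (phR_half_pos ht hz))

lemma phR1_half_pos {t : ℝ} (ht : 0 < t) : 0 < phR1 (1 / 2) (-(Real.pi / 2)) t := by
  obtain ⟨δ, hδ, h⟩ := phR_half_lower ht
  have hd : HasDerivAt (fun w => δ * Real.cos w - phR (1 / 2) w t)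
      (δ * (-Real.sin (-(Real.pi / 2))) - phR1 (1 / 2) (-(Real.pi / 2)) t) (-(Real.pi / 2)) :=
    ((Real.hasDerivAt_cos _).const_mul δ).sub (phR_deriv _ ht _)
  have hpi := Real.pi_pos
  have := ph_deriv_nonpos (y := 0) (by linarith) hd (by
      rw [phR_half_neg_half_pi]; simp) (by
      intro w hw
      have : 0 ≤ Real.cos w := Real.cos_nonneg_of_mem_Icc ⟨hw.1.le, by linarith [hw.2]⟩
      linarith [h w this])
  simp at this
  linarith

lemma ph_alpha_pos {t α : ℝ} (ht : 0 < t)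
    (h : ∀ x, phR1 0 x t * phR (1/2) x t - phR 0 x t * phR1 (1/2) x t =
      α * (phR 0 (x - Real.pi/2) t * phR (1/2) (x - Real.pi/2) t)) : 0 < α := by
  have h1 := h (-(Real.pi / 2))
  have e : -(Real.pi / 2) - Real.pi / 2 = 0 - Real.pi := by ring
  rw [e, phR_zero_sub_pi, phR_half_sub_pi, phR_half_neg_half_pi] at h1
  have h2 := phR_zero_pos 0 ht
  have h3 := phR_zero_pos (1/2) ht
  have h4 := phR_zero_pos' ht (-(Real.pi / 2))
  have h5 := mul_pos h4 (phR1_half_pos ht)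
  have h6 := mul_pos h2 h3
  by_contra hc
  push Not at hc
  nlinarith [mul_nonneg_of_nonpos_of_nonpos hc (neg_nonpos.2 h6.le)]

lemma phY_strictMono {z : ℝ} (h0 : 0 < z) (h1 : z < Real.pi / 2) :
    StrictMonoOn (phY z) (Ioi 0) := by
  have hpi := Real.pi_pos
  have hc : 0 < Real.cos z := Real.cos_pos_of_mem_Ioo ⟨by linarith, h1⟩
  have hd : ∀ t : ℝ, 0 < t → ∃ d, 0 < d ∧ HasDerivAt (phY z) d t := by
    intro t ht
    obtain ⟨α, hα1, hα2⟩ := ph_wronskian ht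
    have hα := ph_alpha_pos ht hα1
    have p1 := phR_zero_pos 0 ht
    have p2 := phR_zero_pos (1/2) ht
    have p3 := phR_zero_pos' ht z
    have p4 := phR_half_pos ht hc
    refine ⟨_, ?_, ((phR_deriv_t (1/2) ht 0).mul (phR_deriv_t 0 ht z)).div
      ((phR_deriv_t 0 ht 0).mul (phR_deriv_t (1/2) ht z)) (mul_pos p1 p4).ne'⟩
    refine div_pos ?_ (pow_pos (mul_pos p1 p4) 2)
    have w1 := hα2 z
    have w0 := hα2 0
    rw [zero_sub, phR_half_neg_half_pi] at w0
    have q1 : 0 < phR1 0 (z - Real.pi / 2) t := by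
      have := phR1_zero_neg ht (z := Real.pi / 2 - z) (by linarith) (by linarith)
      have e := phR1_zero_odd ht (Real.pi / 2 - z)
      rw [neg_sub] at e
      linarith
    have q2 : 0 < phR (1/2) (z - Real.pi / 2) t :=
      phR_half_pos ht (Real.cos_pos_of_mem_Ioo ⟨by linarith, by linarith⟩)
    have key : 0 < phR 0 0 t * phR (1/2) 0 t *
        (α * (phR1 0 (z - Real.pi / 2) t * phR (1/2) (z - Real.pi / 2) t)) / 2 := by positivity
    refine lt_of_lt_of_eq key ?_
    simp only [Pi.mul_apply]
    linear_combination (-1/4) * phR 0 0 t * phR (1/2) 0 t * w1 + (1/4) * phR 0 z t * phR (1/2) z t * w0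
  refine strictMonoOn_of_deriv_pos (convex_Ioi 0) (fun t ht => ?_) (fun t ht => ?_)
  · obtain ⟨d, _, h⟩ := hd t ht
    exact h.continuousAt.continuousWithinAt
  · rw [interior_Ioi] at ht
    obtain ⟨d, hp, h⟩ := hd t ht
    rw [h.deriv]
    exact hp

/-- Real integrand of the complete elliptic integral. -/
def phI (m t : ℝ) : ℝ := 1 / ((1 - t ^ 2) * (1 - m * t ^ 2)) ^ ((1 : ℝ) / 2)

lemma phI_base_pos {m t : ℝ} (hm : m ∈ Ioo (0 : ℝ) 1) (ht : t ∈ Ioo (0 : ℝ) 1) :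
    0 < (1 - t ^ 2) * (1 - m * t ^ 2) := by
  have h1 : t ^ 2 < 1 := by nlinarith [ht.1, ht.2]
  have h2 : m * t ^ 2 < 1 := by nlinarith [hm.1, hm.2, sq_nonneg t]
  exact mul_pos (by linarith) (by linarith)

lemma phI_pos {m t : ℝ} (hm : m ∈ Ioo (0 : ℝ) 1) (ht : t ∈ Ioo (0 : ℝ) 1) : 0 < phI m t :=
  one_div_pos.2 (Real.rpow_pos_of_pos (phI_base_pos hm ht) _)

lemma phI_lt {m m' t : ℝ} (hm' : m' ∈ Ioo (0 : ℝ) 1) (h : m < m')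
    (ht : t ∈ Ioo (0 : ℝ) 1) : phI m t < phI m' t := by
  have hb := phI_base_pos hm' ht
  refine one_div_lt_one_div_of_lt (Real.rpow_pos_of_pos hb _) ?_
  refine Real.rpow_lt_rpow hb.le ?_ (by norm_num)
  have h1 : t ^ 2 < 1 := by nlinarith [ht.1, ht.2]
  have h2 : 0 < t ^ 2 := pow_pos ht.1 2
  exact mul_lt_mul_of_pos_left (by nlinarith) (by linarith)

lemma phI_integrable {m : ℝ} (hm : m ∈ Ioo (0 : ℝ) 1) :
    IntervalIntegrable (phI m) MeasureTheory.volume 0 1 := by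
  have h0 : IntervalIntegrable (fun x : ℝ => x ^ (-(1 / 2) : ℝ)) MeasureTheory.volume 0 1 :=
    intervalIntegral.intervalIntegrable_rpow' (by norm_num)
  have h1 : IntervalIntegrable (fun x : ℝ => (1 - x) ^ (-(1 / 2) : ℝ)) MeasureTheory.volume 0 1 := by
    have := (h0.comp_sub_left 1).symm
    simpa using this
  have h2 := h1.const_mul ((1 - m) ^ (-(1 / 2) : ℝ))
  refine h2.mono_fun ?_ ?_
  · refine Measurable.aestronglyMeasurable ?_
    unfold phI
    fun_prop
  · rw [uIoc_of_le zero_le_one]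
    have hae : ∀ᵐ x : ℝ ∂(MeasureTheory.volume.restrict (Ioc (0 : ℝ) 1)), x ∈ Ioo (0 : ℝ) 1 := by
      rw [← MeasureTheory.restrict_Ioo_eq_restrict_Ioc]
      exact MeasureTheory.ae_restrict_mem measurableSet_Ioo
    filter_upwards [hae] with x hx
    have hm1 : 0 < 1 - m := by linarith [hm.2]
    have hx1 : 0 < 1 - x := by linarith [hx.2]
    rw [Real.norm_of_nonneg (phI_pos hm hx).le, Real.norm_of_nonneg (by positivity),
      ← Real.mul_rpow hm1.le hx1.le, Real.rpow_neg (by positivity), ← one_div]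
    refine one_div_le_one_div_of_le (by positivity) ?_
    refine Real.rpow_le_rpow (by positivity) ?_ (by norm_num)
    have a1 : 1 - x ≤ 1 - x ^ 2 := by nlinarith [hx.1, hx.2]
    have a2 : 1 - m ≤ 1 - m * x ^ 2 := by nlinarith [hx.1, hx.2, hm.1, sq_nonneg x]
    rw [mul_comm]
    exact mul_le_mul a1 a2 hm1.le (by linarith)

lemma ellK_eq_s13 {m : ℝ} (hm : m ∈ Ioo (0 : ℝ) 1) :
    ellK (m : ℂ) = ((∫ t in (0:ℝ)..1, phI m t : ℝ) : ℂ) := by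
  unfold ellK
  rw [← intervalIntegral.integral_ofReal]
  refine intervalIntegral.integral_congr fun t ht => ?_
  rw [uIcc_of_le zero_le_one] at ht
  have hb : 0 ≤ (1 - t ^ 2) * (1 - m * t ^ 2) := by
    have h1 : t ^ 2 ≤ 1 := by nlinarith [ht.1, ht.2]
    have h2 : m * t ^ 2 ≤ 1 := by nlinarith [hm.1, hm.2, sq_nonneg t]
    exact mul_nonneg (by linarith) (by linarith)
  simp only [phI]
  rw [Complex.ofReal_div, Complex.ofReal_cpow hb]
  push_cast
  rfl

lemma KR_eq {m : ℝ} (hm : m ∈ Ioo (0 : ℝ) 1) : KR m = ∫ t in (0:ℝ)..1, phI m t := by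
  unfold KR
  rw [ellK_eq_s13 hm, Complex.ofReal_re]

lemma ellK_KR {m : ℝ} (hm : m ∈ Ioo (0 : ℝ) 1) : ellK (m : ℂ) = (KR m : ℂ) := by
  rw [KR_eq hm, ellK_eq_s13 hm]

lemma KR_pos {m : ℝ} (hm : m ∈ Ioo (0 : ℝ) 1) : 0 < KR m := by
  rw [KR_eq hm]
  exact intervalIntegral.intervalIntegral_pos_of_pos_on (phI_integrable hm)
    (fun x hx => phI_pos hm hx) zero_lt_one

lemma KR_lt {m m' : ℝ} (hm : m ∈ Ioo (0 : ℝ) 1) (hm' : m' ∈ Ioo (0 : ℝ) 1) (h : m < m') :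
    KR m < KR m' := by
  rw [KR_eq hm, KR_eq hm', ← sub_pos, ← intervalIntegral.integral_sub (phI_integrable hm')
    (phI_integrable hm)]
  exact intervalIntegral.intervalIntegral_pos_of_pos_on ((phI_integrable hm').sub (phI_integrable hm))
    (fun x hx => sub_pos.2 (phI_lt hm' h hx)) zero_lt_one

/-- Minus the logarithm of the nome. -/
def phT (m : ℝ) : ℝ := Real.pi * KR (1 - m) / KR m

lemma one_sub_mem {m : ℝ} (hm : m ∈ Ioo (0 : ℝ) 1) : 1 - m ∈ Ioo (0 : ℝ) 1 :=
  ⟨by linarith [hm.2], by linarith [hm.1]⟩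

lemma phT_pos {m : ℝ} (hm : m ∈ Ioo (0 : ℝ) 1) : 0 < phT m :=
  div_pos (mul_pos Real.pi_pos (KR_pos (one_sub_mem hm))) (KR_pos hm)

lemma phT_lt {m m' : ℝ} (hm : m ∈ Ioo (0 : ℝ) 1) (hm' : m' ∈ Ioo (0 : ℝ) 1) (h : m < m') :
    phT m' < phT m := by
  have h1 := KR_lt hm hm' h
  have h2 := KR_lt (one_sub_mem hm') (one_sub_mem hm) (by linarith)
  exact div_lt_div₀ (mul_lt_mul_of_pos_left h2 Real.pi_pos) h1.le
    (mul_pos Real.pi_pos (KR_pos (one_sub_mem hm))).le (KR_pos hm)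

lemma nome_eq {m : ℝ} (hm : m ∈ Ioo (0 : ℝ) 1) :
    nome (m : ℂ) = cexp (-(phT m : ℂ)) := by
  unfold nome phT
  have e : (1 - (m : ℂ)) = ((1 - m : ℝ) : ℂ) := by push_cast; rfl
  rw [e, ellK_KR hm, ellK_KR (one_sub_mem hm)]
  congr 1
  push_cast
  ring

lemma theta3_eq (z : ℝ) {t : ℝ} (ht : 0 < t) : theta3 z (cexp (-(t : ℂ))) = (phR 0 z t : ℂ) := by
  rw [← phG_zero_real]
  have hs := phG_summable 0 0 z ht
  have s1 : Summable (fun n : ℕ => phG_term 0 0 z t n) :=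
    hs.comp_injective Nat.cast_injective
  have s2 : Summable (fun n : ℕ => phG_term 0 0 z t (-(n + 1))) :=
    hs.comp_injective (i := fun n : ℕ => (-((n : ℤ) + 1))) (fun a b h => by simpa using h)
  have s1' : Summable (fun n : ℕ => phG_term 0 0 z t ((n + 1 : ℕ) : ℤ)) :=
    s1.comp_injective (i := fun n : ℕ => n + 1) (fun a b h => by simpa using h)
  unfold phG theta3
  rw [tsum_of_nat_of_neg_add_one s1 s2, s1.tsum_eq_zero_add, add_assoc, ← s1'.tsum_add s2, ← tsum_mul_left]
  congr 1
  · simp [phG_term]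
  · refine tsum_congr fun n => ?_
    simp only [phG_term, pow_zero, one_mul, Complex.cos, ← Complex.exp_nat_mul]
    push_cast
    have e : ∀ A X Y : ℂ, 2 * (A * ((X + Y) / 2)) = A * X + A * Y := fun A X Y => by ring
    rw [e, ← Complex.exp_add, ← Complex.exp_add]
    congr 2 <;> ring

lemma theta2_eq (z : ℝ) {t : ℝ} (ht : 0 < t) : theta2 z (cexp (-(t : ℂ))) = (phR (1 / 2) z t : ℂ) := by
  rw [← phG_half_real]
  have hs := phG_summable (1 / 2) 0 z ht
  have s1 : Summable (fun n : ℕ => phG_term (1 / 2) 0 z t n) :=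
    hs.comp_injective Nat.cast_injective
  have s2 : Summable (fun n : ℕ => phG_term (1 / 2) 0 z t (-(n + 1))) :=
    hs.comp_injective (i := fun n : ℕ => (-((n : ℤ) + 1))) (fun a b h => by simpa using h)
  unfold phG theta2
  rw [tsum_of_nat_of_neg_add_one s1 s2, ← s1.tsum_add s2, ← tsum_mul_left]
  refine tsum_congr fun n => ?_
  have hl : Complex.log (cexp (-(t : ℂ))) = -(t : ℂ) := by
    rw [Complex.log_exp] <;> simp [Real.pi_pos, Real.pi_pos.le]
  rw [Complex.cpow_def_of_ne_zero (Complex.exp_ne_zero _), hl]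
  simp only [phG_term, pow_zero, one_mul, Complex.cos]
  push_cast
  have e : ∀ A X Y : ℂ, 2 * (A * ((X + Y) / 2)) = A * X + A * Y := fun A X Y => by ring
  rw [e, ← Complex.exp_add, ← Complex.exp_add]
  congr 2 <;> ring

lemma theta4_eq (z : ℝ) {t : ℝ} (ht : 0 < t) :
    theta4 z (cexp (-(t : ℂ))) = (phR 0 (z - Real.pi / 2) t : ℂ) := by
  rw [← theta3_eq _ ht]
  unfold theta4 theta3
  congr 2
  refine tsum_congr fun n => ?_
  have e : 2 * ((n : ℂ) + 1) * ((z - Real.pi / 2 : ℝ) : ℂ) =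
      2 * ((n : ℂ) + 1) * z - ((n + 1 : ℕ) : ℂ) * Real.pi := by
    push_cast
    ring
  rw [e, Complex.cos_antiperiodic.sub_nat_mul_eq]
  ring

lemma ph_dc {u m : ℝ} (hu : u ∈ Ioo (0 : ℝ) 1) (hm : m ∈ Ioo (0 : ℝ) 1) :
    dnR (KR m * u) m / cnR (KR m * u) m = phY (Real.pi * u / 2) (phT m) := by
  have ht := phT_pos hm
  have hK := KR_pos hm
  have hpi := Real.pi_pos
  have hz : 0 < Real.cos (Real.pi * u / 2) :=
    Real.cos_pos_of_mem_Ioo ⟨by nlinarith [hu.1], by nlinarith [hu.2]⟩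
  have harg : (Real.pi : ℂ) * ((KR m * u : ℝ) : ℂ) / (2 * ellK (m : ℂ)) =
      ((Real.pi * u / 2 : ℝ) : ℂ) := by
    rw [ellK_KR hm]
    have : (KR m : ℂ) ≠ 0 := by exact_mod_cast hK.ne'
    push_cast
    field_simp
  have h0 : (0 : ℂ) = ((0 : ℝ) : ℂ) := by simp
  unfold dnR cnR dn cn phY
  rw [harg, nome_eq hm, h0, theta2_eq _ ht, theta2_eq _ ht, theta3_eq _ ht, theta3_eq _ ht,
    theta4_eq _ ht, theta4_eq _ ht]
  simp only [← Complex.ofReal_div, ← Complex.ofReal_mul, Complex.ofReal_re]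
  have p1 := (phR_zero_pos 0 ht).ne'
  have p2 := (phR_zero_pos (1/2) ht).ne'
  have p3 := (phR_zero_pos' ht (Real.pi * u / 2)).ne'
  have p4 := (phR_half_pos ht hz).ne'
  have p5 := (phR_zero_pos' ht (Real.pi * u / 2 - Real.pi / 2)).ne'
  have p6 := (phR_zero_pos' ht (0 - Real.pi / 2)).ne'
  generalize phR 0 (Real.pi * u / 2 - Real.pi / 2) (phT m) = A at *
  generalize phR 0 (0 - Real.pi / 2) (phT m) = B at *
  field_simp

/-- For fixed `u ∈ (0,1)`, the function
`μ ↦ φ(u,μ) = dc²(K(1−μ)u | 1−μ) − dc²(K(μ)u | μ)` is strictly increasing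
on `(0,1)`. -/
theorem phi_strictMonoOn (u : ℝ) (hu : u ∈ Set.Ioo (0 : ℝ) 1) :
    StrictMonoOn (phi u) (Set.Ioo (0 : ℝ) 1) := by
  intro m hm m' hm' hlt
  have hpi := Real.pi_pos
  have z0 : 0 < Real.pi * u / 2 := by nlinarith [hu.1, mul_pos hpi hu.1]
  have z1 : Real.pi * u / 2 < Real.pi / 2 := by nlinarith [hu.2]
  have hz : 0 < Real.cos (Real.pi * u / 2) := Real.cos_pos_of_mem_Ioo ⟨by linarith, z1⟩
  have hY := phY_strictMono z0 z1
  unfold phi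
  rw [ph_dc hu hm, ph_dc hu hm', ph_dc hu (one_sub_mem hm), ph_dc hu (one_sub_mem hm')]
  have a1 := hY (phT_pos hm') (phT_pos hm) (phT_lt hm hm' hlt)
  have a2 := hY (phT_pos (one_sub_mem hm)) (phT_pos (one_sub_mem hm'))
    (phT_lt (one_sub_mem hm') (one_sub_mem hm) (by linarith))
  have b1 := pow_lt_pow_left₀ a1 (phY_pos (phT_pos hm') hz).le two_ne_zero
  have b2 := pow_lt_pow_left₀ a2 (phY_pos (phT_pos (one_sub_mem hm)) hz).le two_ne_zero
  linarith
end
end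

section
/- For every u ∈ (0,1/2] and every μ ∈ (0,1), one has φ(u,μ) < 1, where φ(u,μ) := dc²(K(1−μ)u | 1−μ) − dc²(K(μ)u | μ). -/
noncomputable section

open Complex Filter Set Asymptotics

theorem aux_split {α β : Type} {f g : α → β} (hf : Function.Injective f)
    (hg : Function.Injective g) (hc : IsCompl (Set.range f) (Set.range g)) {F : β → ℝ}
    (hF : Summable F) : ∑' b, F b = ∑' a, F (f a) + ∑' a, F (g a) := by
  have h1 : HasSum (F ∘ ((↑) : Set.range f → β)) (∑' a, F (f a)) :=
    (hf.hasSum_range_iff (f := F)).2 ((hF.comp_injective hf).hasSum)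
  have h2 : HasSum (F ∘ ((↑) : Set.range g → β)) (∑' a, F (g a)) :=
    (hg.hasSum_range_iff (f := F)).2 ((hF.comp_injective hg).hasSum)
  exact (h1.add_isCompl hc h2).tsum_eq

theorem aux_split_int {F : ℤ → ℝ} (hF : Summable F) :
    ∑' b, F b = ∑' n : ℤ, F (2 * n) + ∑' n : ℤ, F (-1 - 2 * n) := by
  refine aux_split (f := fun n : ℤ => 2 * n) (g := fun n : ℤ => -1 - 2 * n) ?_ ?_ ?_ hF
  · intro a b h; simp only at h; omega
  · intro a b h; simp only at h; omega
  · refine ⟨?_, ?_⟩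
    · rw [Set.disjoint_left]
      rintro _ ⟨a, rfl⟩ ⟨b, h⟩
      simp only at h; omega
    · rw [codisjoint_iff_le_sup]
      rintro n -
      rcases Int.even_or_odd' n with ⟨k, h | h⟩
      · left; exact ⟨k, h.symm⟩
      · right; exact ⟨-k - 1, by simp only; omega⟩

theorem aux_split_prod {F : ℤ × ℤ → ℝ} (hF : Summable F) :
    ∑' b, F b = ∑' n : ℤ × ℤ, F (n.1 + n.2, n.1 - n.2) +
      ∑' n : ℤ × ℤ, F (-1 - n.1 - n.2, n.1 - n.2) := by
  refine aux_split (f := fun n : ℤ × ℤ => (n.1 + n.2, n.1 - n.2))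
    (g := fun n : ℤ × ℤ => (-1 - n.1 - n.2, n.1 - n.2)) ?_ ?_ ?_ hF
  · rintro ⟨a, b⟩ ⟨c, d⟩ h
    simp only [Prod.mk.injEq] at h ⊢; omega
  · rintro ⟨a, b⟩ ⟨c, d⟩ h
    simp only [Prod.mk.injEq] at h ⊢; omega
  · refine ⟨?_, ?_⟩
    · rw [Set.disjoint_left]
      rintro _ ⟨⟨a, b⟩, rfl⟩ ⟨⟨c, d⟩, h⟩
      simp only [Prod.mk.injEq] at h; omega
    · rw [codisjoint_iff_le_sup]
      rintro ⟨a, b⟩ -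
      rcases Int.even_or_odd' (a + b) with ⟨k, h | h⟩
      · left; exact ⟨(k, a - k), by simp only [Prod.mk.injEq]; omega⟩
      · right; exact ⟨(b - k - 1, - k - 1), by simp only [Prod.mk.injEq]; omega⟩

theorem aux_summ0 {s : ℝ} (hs : 0 < s) : Summable fun n : ℤ => Real.exp (-s * (n : ℝ) ^ 2) := by
  have hN : Summable fun n : ℕ => Real.exp (-s * (n : ℝ) ^ 2) := by
    refine Summable.of_nonneg_of_le (fun n => (Real.exp_pos _).le) (fun n => ?_)
      (Real.summable_exp_nat_mul_iff.2 (neg_neg_of_pos hs))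
    apply Real.exp_le_exp.2
    have h : (n : ℝ) ≤ (n : ℝ) ^ 2 := by exact_mod_cast Nat.le_self_pow (by norm_num) n
    nlinarith
  exact Summable.of_nat_of_neg (by simpa using hN) (by simpa using hN)

def auxW (s : ℝ) (n : ℤ) : ℝ := Real.exp (-s * ((n : ℝ) + 1 / 2) ^ 2)

def auxV (s : ℝ) (n : ℤ) : ℝ := Real.exp (-s * (n : ℝ) ^ 2)

theorem aux_sV {s : ℝ} (hs : 0 < s) : Summable (auxV s) := aux_summ0 hs

theorem aux_sW {s : ℝ} (hs : 0 < s) : Summable (auxW s) := by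
  refine Summable.of_nonneg_of_le (fun n => (Real.exp_pos _).le) (fun n => ?_)
    ((aux_summ0 (half_pos hs)).mul_left (Real.exp (s / 4)))
  rw [auxW, ← Real.exp_add]
  apply Real.exp_le_exp.2
  nlinarith [mul_nonneg hs.le (sq_nonneg ((n : ℝ) + 1))]

theorem auxW_pos (s : ℝ) (n : ℤ) : 0 < auxW s n := Real.exp_pos _
theorem auxV_pos (s : ℝ) (n : ℤ) : 0 < auxV s n := Real.exp_pos _

theorem aux_norm_le {w c : ℝ} (hw : 0 < w) (hc : |c| ≤ 1) : ‖w * c‖ ≤ w := by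
  rw [Real.norm_eq_abs, abs_mul, abs_of_pos hw]
  nlinarith

def T2 (s z : ℝ) : ℝ := ∑' n : ℤ, auxW s n * Real.cos ((2 * (n : ℝ) + 1) * z)

def T3 (s z : ℝ) : ℝ := ∑' n : ℤ, auxV s n * Real.cos (2 * (n : ℝ) * z)

def CC (s z : ℝ) : ℝ := ∑' n : ℤ, auxW s (2 * n) * Real.cos ((4 * (n : ℝ) + 1) * z)

def SS (s z : ℝ) : ℝ := ∑' n : ℤ, auxW s (2 * n) * Real.sin ((4 * (n : ℝ) + 1) * z)

theorem aux_sWn {s : ℝ} (hs : 0 < s) (z : ℝ) :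
    Summable fun n : ℤ => ‖auxW s n * Real.cos ((2 * (n : ℝ) + 1) * z)‖ :=
  Summable.of_nonneg_of_le (fun _ => norm_nonneg _)
    (fun n => aux_norm_le (auxW_pos s n) (Real.abs_cos_le_one _)) (aux_sW hs)

theorem aux_sVn {s : ℝ} (hs : 0 < s) (z : ℝ) :
    Summable fun n : ℤ => ‖auxV s n * Real.cos (2 * (n : ℝ) * z)‖ :=
  Summable.of_nonneg_of_le (fun _ => norm_nonneg _)
    (fun n => aux_norm_le (auxV_pos s n) (Real.abs_cos_le_one _)) (aux_sV hs)

theorem aux_sW2 {s : ℝ} (hs : 0 < s) : Summable fun n : ℤ => auxW s (2 * n) :=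
  (aux_sW hs).comp_injective (i := fun n : ℤ => 2 * n) (fun a b h => by simp only at h; omega)

theorem aux_sCn {s : ℝ} (hs : 0 < s) (z : ℝ) :
    Summable fun n : ℤ => ‖auxW s (2 * n) * Real.cos ((4 * (n : ℝ) + 1) * z)‖ :=
  Summable.of_nonneg_of_le (fun _ => norm_nonneg _)
    (fun _ => aux_norm_le (auxW_pos s _) (Real.abs_cos_le_one _)) (aux_sW2 hs)

theorem aux_sSn {s : ℝ} (hs : 0 < s) (z : ℝ) :
    Summable fun n : ℤ => ‖auxW s (2 * n) * Real.sin ((4 * (n : ℝ) + 1) * z)‖ :=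
  Summable.of_nonneg_of_le (fun _ => norm_nonneg _)
    (fun _ => aux_norm_le (auxW_pos s _) (Real.abs_sin_le_one _)) (aux_sW2 hs)

theorem auxW_refl (s : ℝ) (n : ℤ) : auxW s (-1 - n) = auxW s n := by
  unfold auxW; congr 1; push_cast; ring

theorem T2_eq {s : ℝ} (hs : 0 < s) (z : ℝ) : T2 s z = 2 * CC s z := by
  unfold T2 CC
  rw [aux_split_int (aux_sWn hs z).of_norm, two_mul]
  congr 1
  · refine tsum_congr fun n => ?_
    push_cast; ring_nf
  · refine tsum_congr fun n => ?_
    rw [auxW_refl, ← Real.cos_neg]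
    push_cast; ring_nf

theorem aux_cos_shift (n : ℤ) (x : ℝ) :
    Real.cos (n * (2 * Real.pi) + Real.pi / 2 - x) = Real.sin x := by
  rw [← Real.cos_pi_div_two_sub, add_sub_assoc, add_comm, Real.cos_add_int_mul_two_pi]

theorem T1_eq {s : ℝ} (hs : 0 < s) (z : ℝ) : T2 s (Real.pi / 2 - z) = 2 * SS s z := by
  rw [T2_eq hs]
  unfold CC SS
  congr 1
  refine tsum_congr fun n => ?_
  rw [← aux_cos_shift n]
  ring_nf

theorem aux_weight (s : ℝ) (n m : ℤ) :
    auxW (2 * s) (n + m) * auxV (2 * s) (n - m) = auxW s (2 * n) * auxW s (2 * m) := by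
  unfold auxW auxV
  rw [← Real.exp_add, ← Real.exp_add]
  congr 1; push_cast; ring

theorem aux_master {s : ℝ} (hs : 0 < s) (x y : ℝ) :
    T2 (2 * s) x * T3 (2 * s) y = 2 * ∑' n : ℤ × ℤ, auxW s (2 * n.1) * auxW s (2 * n.2) *
      (Real.cos ((2 * ((n.1 : ℝ) + n.2) + 1) * x) * Real.cos (2 * ((n.1 : ℝ) - n.2) * y)) := by
  have h2 : 0 < 2 * s := by linarith
  unfold T2 T3
  rw [tsum_mul_tsum_of_summable_norm (aux_sWn h2 x) (aux_sVn h2 y),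
    aux_split_prod (summable_mul_of_summable_norm (aux_sWn h2 x) (aux_sVn h2 y)),
    two_mul (∑' n : ℤ × ℤ, _)]
  refine congrArg₂ (· + ·) ?_ ?_
  · refine tsum_congr fun n => ?_
    rw [← aux_weight]; push_cast; ring
  · refine tsum_congr fun n => ?_
    simp only
    rw [← aux_weight, sub_sub, auxW_refl, ← Real.cos_neg ((2 * ((n.1 : ℝ) + n.2) + 1) * x)]
    push_cast; ring_nf

theorem aux_cc {s : ℝ} (hs : 0 < s) (z : ℝ) : CC s z * CC s z =
    ∑' n : ℤ × ℤ, auxW s (2 * n.1) * auxW s (2 * n.2) *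
      (Real.cos ((4 * (n.1 : ℝ) + 1) * z) * Real.cos ((4 * (n.2 : ℝ) + 1) * z)) := by
  unfold CC
  rw [tsum_mul_tsum_of_summable_norm (aux_sCn hs z) (aux_sCn hs z)]
  exact tsum_congr fun n => by ring

theorem aux_ss {s : ℝ} (hs : 0 < s) (z : ℝ) : SS s z * SS s z =
    ∑' n : ℤ × ℤ, auxW s (2 * n.1) * auxW s (2 * n.2) *
      (Real.sin ((4 * (n.1 : ℝ) + 1) * z) * Real.sin ((4 * (n.2 : ℝ) + 1) * z)) := by
  unfold SS
  rw [tsum_mul_tsum_of_summable_norm (aux_sSn hs z) (aux_sSn hs z)]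
  exact tsum_congr fun n => by ring

theorem aux_prod_summ {s : ℝ} (hs : 0 < s) (f : ℤ × ℤ → ℝ) (hf : ∀ n, |f n| ≤ 1) :
    Summable fun n : ℤ × ℤ => auxW s (2 * n.1) * auxW s (2 * n.2) * f n := by
  refine Summable.of_norm_bounded (g := fun n : ℤ × ℤ => auxW s (2 * n.1) * auxW s (2 * n.2))
    ?_ (fun n => aux_norm_le (mul_pos (auxW_pos _ _) (auxW_pos _ _)) (hf n))
  exact summable_mul_of_summable_norm (f := fun n : ℤ => auxW s (2 * n))
    (g := fun n : ℤ => auxW s (2 * n)) (aux_sW2 hs).norm (aux_sW2 hs).norm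

theorem aux_abs_mul {a b : ℝ} (ha : |a| ≤ 1) (hb : |b| ≤ 1) : |a * b| ≤ 1 := by
  rw [abs_mul]; exact mul_le_one₀ ha (abs_nonneg _) hb

theorem aux_I1 {s : ℝ} (hs : 0 < s) (z : ℝ) :
    T2 s z ^ 2 - T2 s (Real.pi / 2 - z) ^ 2 = 2 * (T2 (2 * s) (2 * z) * T3 (2 * s) 0) := by
  rw [T1_eq hs, T2_eq hs, aux_master hs]
  have : (2 * CC s z) ^ 2 - (2 * SS s z) ^ 2 = 4 * (CC s z * CC s z - SS s z * SS s z) := by ring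
  rw [this, aux_cc hs, aux_ss hs, ← Summable.tsum_sub]
  · rw [← mul_assoc]
    norm_num
    refine tsum_congr fun n => ?_
    rw [← mul_sub, ← Real.cos_add]
    ring_nf
  · exact aux_prod_summ hs _ fun n => aux_abs_mul (Real.abs_cos_le_one _) (Real.abs_cos_le_one _)
  · exact aux_prod_summ hs _ fun n => aux_abs_mul (Real.abs_sin_le_one _) (Real.abs_sin_le_one _)

theorem aux_I3 {s : ℝ} (hs : 0 < s) (z : ℝ) :
    T2 s z ^ 2 + T2 s (Real.pi / 2 - z) ^ 2 = 2 * (T2 (2 * s) 0 * T3 (2 * s) (2 * z)) := by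
  rw [T1_eq hs, T2_eq hs, aux_master hs]
  have : (2 * CC s z) ^ 2 + (2 * SS s z) ^ 2 = 4 * (CC s z * CC s z + SS s z * SS s z) := by ring
  rw [this, aux_cc hs, aux_ss hs, ← Summable.tsum_add]
  · rw [← mul_assoc]
    norm_num
    refine tsum_congr fun n => ?_
    rw [← mul_add, ← Real.cos_sub]
    ring_nf
  · exact aux_prod_summ hs _ fun n => aux_abs_mul (Real.abs_cos_le_one _) (Real.abs_cos_le_one _)
  · exact aux_prod_summ hs _ fun n => aux_abs_mul (Real.abs_sin_le_one _) (Real.abs_sin_le_one _)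

theorem aux_I2 {s : ℝ} (hs : 0 < s) (z : ℝ) :
    T2 s z * T2 s (Real.pi / 2 - z) =
      T2 (2 * s) (Real.pi / 2 - 2 * z) * T3 (2 * s) (Real.pi / 2) := by
  rw [T1_eq hs, T2_eq hs, aux_master hs]
  have : 2 * CC s z * (2 * SS s z) = 2 * (SS s z * CC s z + CC s z * SS s z) := by ring
  rw [this]
  unfold SS CC
  rw [tsum_mul_tsum_of_summable_norm (aux_sSn hs z) (aux_sCn hs z),
    tsum_mul_tsum_of_summable_norm (aux_sCn hs z) (aux_sSn hs z), ← Summable.tsum_add]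
  · congr 1
    refine tsum_congr fun n => ?_
    have h1 := aux_cos_shift n.1 ((4 * (n.1 : ℝ) + 1) * z + (4 * (n.2 : ℝ) + 1) * z)
    have h2 := aux_cos_shift n.2 ((4 * (n.1 : ℝ) + 1) * z + (4 * (n.2 : ℝ) + 1) * z)
    set A := (2 * ((n.1 : ℝ) + n.2) + 1) * (Real.pi / 2 - 2 * z) with hA
    set B := 2 * ((n.1 : ℝ) - n.2) * (Real.pi / 2) with hB
    have e1 : (n.1 : ℝ) * (2 * Real.pi) + Real.pi / 2 -
      ((4 * (n.1 : ℝ) + 1) * z + (4 * (n.2 : ℝ) + 1) * z) = A + B := by rw [hA, hB]; ring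
    have e2 : (n.2 : ℝ) * (2 * Real.pi) + Real.pi / 2 -
      ((4 * (n.1 : ℝ) + 1) * z + (4 * (n.2 : ℝ) + 1) * z) = A - B := by rw [hA, hB]; ring
    rw [e1, Real.cos_add, Real.sin_add] at h1
    rw [e2, Real.cos_sub, Real.sin_add] at h2
    have h3 : Real.cos A * Real.cos B = Real.sin ((4 * (n.1 : ℝ) + 1) * z) *
      Real.cos ((4 * (n.2 : ℝ) + 1) * z) + Real.cos ((4 * (n.1 : ℝ) + 1) * z) *
      Real.sin ((4 * (n.2 : ℝ) + 1) * z) := by linarith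
    rw [h3]; ring
  · exact summable_mul_of_summable_norm (f := fun n : ℤ => auxW s (2 * n) * Real.sin ((4 * (n : ℝ) + 1) * z))
      (g := fun n : ℤ => auxW s (2 * n) * Real.cos ((4 * (n : ℝ) + 1) * z)) (aux_sSn hs z) (aux_sCn hs z)
  · exact summable_mul_of_summable_norm (f := fun n : ℤ => auxW s (2 * n) * Real.cos ((4 * (n : ℝ) + 1) * z))
      (g := fun n : ℤ => auxW s (2 * n) * Real.sin ((4 * (n : ℝ) + 1) * z)) (aux_sCn hs z) (aux_sSn hs z)

theorem aux_summ_shift {c : ℝ} (hc : 0 < c) (x : ℝ) :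
    Summable fun n : ℤ => Real.exp (-c * ((n : ℝ) - x) ^ 2) := by
  refine Summable.of_nonneg_of_le (fun n => (Real.exp_pos _).le) (fun n => ?_)
    ((aux_summ0 (half_pos hc)).mul_left (Real.exp (c * x ^ 2)))
  rw [← Real.exp_add]
  apply Real.exp_le_exp.2
  nlinarith [mul_nonneg hc.le (sq_nonneg ((n : ℝ) - 2 * x))]

theorem T3_pos {s : ℝ} (hs : 0 < s) (z : ℝ) : 0 < T3 s z := by
  have hpi := Real.pi_pos
  have ha : 0 < s / Real.pi := by positivity
  have key := Complex.tsum_exp_neg_quadratic (a := ((s / Real.pi : ℝ) : ℂ))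
    (by rwa [Complex.ofReal_re]) (Complex.I * ((z / Real.pi : ℝ) : ℂ))
  have hpc : (Real.pi : ℂ) ≠ 0 := by exact_mod_cast hpi.ne'
  have hsc : (s : ℂ) ≠ 0 := by exact_mod_cast hs.ne'
  have h1 : ∀ n : ℤ, cexp (-Real.pi * ((s / Real.pi : ℝ) : ℂ) * n ^ 2 +
      2 * Real.pi * (Complex.I * ((z / Real.pi : ℝ) : ℂ)) * n) =
      ((auxV s n : ℝ) : ℂ) * cexp (((2 * (n : ℝ) * z : ℝ) : ℂ) * Complex.I) := by
    intro n
    unfold auxV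
    rw [Complex.ofReal_exp, ← Complex.exp_add]
    congr 1
    push_cast
    field_simp
  have h1re : ∀ n : ℤ, (((auxV s n : ℝ) : ℂ) * cexp (((2 * (n : ℝ) * z : ℝ) : ℂ) * Complex.I)).re
      = auxV s n * Real.cos (2 * (n : ℝ) * z) := by
    intro n
    rw [Complex.re_ofReal_mul, Complex.exp_ofReal_mul_I_re]
  have h1s : Summable fun n : ℤ =>
      ((auxV s n : ℝ) : ℂ) * cexp (((2 * (n : ℝ) * z : ℝ) : ℂ) * Complex.I) := by
    refine Summable.of_norm_bounded (aux_sV hs) fun n => ?_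
    rw [norm_mul, Complex.norm_exp_ofReal_mul_I, mul_one, Complex.norm_real, Real.norm_eq_abs,
      abs_of_pos (auxV_pos s n)]
  set c : ℝ := Real.pi / (s / Real.pi) with hc
  have hcpos : 0 < c := by positivity
  have h2 : ∀ n : ℤ, cexp (-Real.pi / ((s / Real.pi : ℝ) : ℂ) *
      (n + Complex.I * (Complex.I * ((z / Real.pi : ℝ) : ℂ))) ^ 2) =
      ((Real.exp (-c * ((n : ℝ) - z / Real.pi) ^ 2) : ℝ) : ℂ) := by
    intro n
    rw [Complex.ofReal_exp, ← mul_assoc, Complex.I_mul_I, hc]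
    congr 1
    push_cast
    ring
  have h3 : (1 : ℂ) / ((s / Real.pi : ℝ) : ℂ) ^ (1 / 2 : ℂ) =
      ((1 / (s / Real.pi) ^ (1 / 2 : ℝ) : ℝ) : ℂ) := by
    rw [Complex.ofReal_div (1 : ℝ), Complex.ofReal_cpow ha.le]
    norm_num
  rw [tsum_congr h1, tsum_congr h2, h3, ← Complex.ofReal_tsum, ← Complex.ofReal_mul] at key
  have key2 := congrArg Complex.re key
  rw [Complex.re_tsum h1s, tsum_congr h1re, Complex.ofReal_re] at key2
  unfold T3
  rw [key2]
  have := (aux_summ_shift hcpos (z / Real.pi)).tsum_pos (fun n => (Real.exp_pos _).le) 0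
    (Real.exp_pos _)
  positivity

theorem T2_cont {s : ℝ} (hs : 0 < s) : Continuous (T2 s) :=
  continuous_tsum (fun n => by fun_prop) (aux_sW hs)
    fun n x => aux_norm_le (auxW_pos s n) (Real.abs_cos_le_one _)

theorem T2_zero_pos {s : ℝ} (hs : 0 < s) : 0 < T2 s 0 := by
  unfold T2
  simp only [mul_zero, Real.cos_zero, mul_one]
  exact (aux_sW hs).tsum_pos (fun n => (auxW_pos s n).le) 0 (auxW_pos s 0)

theorem T2_half_pi (s : ℝ) : T2 s (Real.pi / 2) = 0 := by
  unfold T2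
  rw [← tsum_zero (α := ℝ) (β := ℤ)]
  refine tsum_congr fun n => ?_
  rw [Real.cos_eq_zero_iff.2 ⟨n, by ring⟩, mul_zero]

theorem T2_nat {s : ℝ} (hs : 0 < s) (z : ℝ) : T2 s z =
    2 * ∑' n : ℕ, auxW s n * Real.cos ((2 * (n : ℝ) + 1) * z) := by
  unfold T2
  rw [← tsum_nat_add_neg_add_one (aux_sWn hs z).of_norm, ← tsum_mul_left]
  refine tsum_congr fun n => ?_
  have : (-((n : ℤ) + 1)) = -1 - (n : ℤ) := by ring
  have h2 : (2 * ((-1 - (n : ℤ) : ℤ) : ℝ) + 1) * z = -((2 * (n : ℝ) + 1) * z) := by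
    push_cast; ring
  rw [this, auxW_refl, h2, Real.cos_neg]
  push_cast; ring

theorem aux_cos_bound (y : ℝ) (n : ℕ) :
    |Real.cos ((2 * (n : ℝ) + 1) * y)| ≤ (2 * (n : ℝ) + 1) * |Real.cos y| := by
  induction n with
  | zero => simp
  | succ k ih =>
    have e : (2 * ((k + 1 : ℕ) : ℝ) + 1) * y = (2 * (k : ℝ) + 1) * y + 2 * y := by push_cast; ring
    rw [e, Real.cos_add, Real.sin_two_mul]
    set A := Real.cos ((2 * (k : ℝ) + 1) * y)
    set B := Real.sin ((2 * (k : ℝ) + 1) * y)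
    have h1 : |A * Real.cos (2 * y)| ≤ |A| := by
      rw [abs_mul]; nlinarith [Real.abs_cos_le_one (2 * y), abs_nonneg A]
    have h2 : |B * (2 * Real.sin y * Real.cos y)| ≤ 2 * |Real.cos y| := by
      have : B * (2 * Real.sin y * Real.cos y) = 2 * ((B * Real.sin y) * Real.cos y) := by ring
      rw [this, abs_mul, abs_mul, abs_two]
      have := aux_abs_mul (Real.abs_sin_le_one ((2 * (k : ℝ) + 1) * y)) (Real.abs_sin_le_one y)
      nlinarith [abs_nonneg (Real.cos y)]
    have h3 := abs_sub (A * Real.cos (2 * y)) (B * (2 * Real.sin y * Real.cos y))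
    push_cast
    linarith

theorem aux_three (n : ℕ) : (2 * (n : ℝ) + 1) ≤ 3 ^ n := by
  induction n with
  | zero => simp
  | succ k ih => push_cast; rw [pow_succ]; nlinarith [Nat.cast_nonneg (α := ℝ) k]

theorem T2_base {s : ℝ} (hs : 1 ≤ s) {y : ℝ} (hy : 0 < Real.cos y) : 0 < T2 s y := by
  have hs0 : 0 < s := by linarith
  rw [T2_nat hs0]
  set x := Real.exp (-2 * s) with hx
  have hx0 : 0 < x := Real.exp_pos _
  have hx1 : 6 * x < 1 := by
    have h1 : x ≤ Real.exp (-2) := Real.exp_le_exp.2 (by linarith)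
    have h2 : Real.exp (-2) * (Real.exp 1 * Real.exp 1) = 1 := by
      rw [← Real.exp_add, ← Real.exp_add]; norm_num
    have h3 := Real.exp_one_gt_d9
    have h4 := Real.exp_pos (-2)
    have h5 : 6 < Real.exp 1 * Real.exp 1 := by nlinarith
    nlinarith
  have hsum : Summable fun n : ℕ => auxW s n * Real.cos ((2 * (n : ℝ) + 1) * y) := by
    have := (aux_sWn hs0 y).of_norm.comp_injective (i := fun n : ℕ => (n : ℤ)) Nat.cast_injective
    simpa [Function.comp_def] using this
  set w := auxW s 0 with hw
  have hw0 : 0 < w := auxW_pos _ _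
  have hb : ∀ n : ℕ, |auxW s n * Real.cos ((2 * (n : ℝ) + 1) * y)| ≤
      w * Real.cos y * (3 * x) ^ n := by
    intro n
    rw [abs_mul, abs_of_pos (auxW_pos s n), mul_pow]
    have h1 : auxW s n ≤ w * x ^ n := by
      rw [hw, hx, ← Real.exp_nat_mul]
      unfold auxW
      rw [← Real.exp_add]
      apply Real.exp_le_exp.2
      have h : (n : ℝ) ≤ (n : ℝ) ^ 2 := by exact_mod_cast Nat.le_self_pow (by norm_num) n
      push_cast
      nlinarith
    have h2 : |Real.cos ((2 * (n : ℝ) + 1) * y)| ≤ 3 ^ n * Real.cos y := by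
      have := aux_cos_bound y n
      rw [abs_of_pos hy] at this
      nlinarith [aux_three n]
    calc _ ≤ (w * x ^ n) * (3 ^ n * Real.cos y) :=
          mul_le_mul h1 h2 (abs_nonneg _) (by positivity)
      _ = _ := by ring
  rw [hsum.tsum_eq_zero_add]
  have hgeo : HasSum (fun n : ℕ => w * Real.cos y * (3 * x) ^ (n + 1))
      (w * Real.cos y * ((3 * x) * (1 - 3 * x)⁻¹)) := by
    have := (hasSum_geometric_of_lt_one (r := 3 * x) (by positivity) (by linarith)).mul_left
      (w * Real.cos y * (3 * x))
    have e : (fun n : ℕ => w * Real.cos y * (3 * x) ^ (n + 1)) =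
        fun n : ℕ => w * Real.cos y * (3 * x) * (3 * x) ^ n := by
      funext n; rw [pow_succ]; ring
    rw [e, ← mul_assoc (w * Real.cos y) (3 * x) (1 - 3 * x)⁻¹]
    exact this
  have htail := tsum_of_norm_bounded (f := fun n : ℕ =>
    auxW s ((n + 1 : ℕ) : ℤ) * Real.cos ((2 * ((n + 1 : ℕ) : ℝ) + 1) * y)) hgeo
    (fun n => hb (n + 1))
  rw [Real.norm_eq_abs] at htail
  have h6 : (3 * x) * (1 - 3 * x)⁻¹ < 1 := by
    rw [← div_eq_mul_inv, div_lt_one (by linarith)]; linarith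
  have h7 := (abs_le.1 htail).1
  have h8 : 0 < w * Real.cos y := by positivity
  have h9 : auxW s ((0 : ℕ) : ℤ) * Real.cos ((2 * ((0 : ℕ) : ℝ) + 1) * y) = w * Real.cos y := by
    simp [hw]
  rw [h9]
  nlinarith

theorem aux_step {s : ℝ} (hs : 0 < s)
    (ih : ∀ y ∈ Set.Ico (0 : ℝ) (Real.pi / 2), 0 < T2 (2 * s) y) :
    ∀ y ∈ Set.Ico (0 : ℝ) (Real.pi / 2), 0 < T2 s y := by
  have hpi := Real.pi_pos
  have h2s : 0 < 2 * s := by linarith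
  have hne : ∀ y ∈ Set.Ico (0 : ℝ) (Real.pi / 2), T2 s y ≠ 0 := by
    intro y hy h0
    rcases lt_or_ge y (Real.pi / 4) with h | h
    · have h1 := aux_I1 hs y
      have h2 := ih (2 * y) ⟨by linarith [hy.1], by linarith⟩
      have h3 := mul_pos h2 (T3_pos h2s 0)
      rw [h0] at h1
      nlinarith [sq_nonneg (T2 s (Real.pi / 2 - y))]
    · have h1 := aux_I2 hs (Real.pi / 2 - y)
      have h2 := ih (Real.pi / 2 - 2 * (Real.pi / 2 - y)) ⟨by linarith, by linarith [hy.2]⟩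
      have h3 := mul_pos h2 (T3_pos h2s (Real.pi / 2))
      rw [sub_sub_cancel, h0, mul_zero] at h1
      linarith
  intro y hy
  by_contra hcon
  have hle : T2 s y ≤ 0 := not_lt.1 hcon
  have := intermediate_value_Icc' hy.1 (T2_cont hs).continuousOn
  obtain ⟨x, hx, hx0⟩ := this ⟨hle, (T2_zero_pos hs).le⟩
  exact hne x ⟨hx.1, lt_of_le_of_lt hx.2 hy.2⟩ hx0

theorem T2_pos {s : ℝ} (hs : 0 < s) : ∀ y ∈ Set.Ico (0 : ℝ) (Real.pi / 2), 0 < T2 s y := by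
  have main : ∀ n : ℕ, ∀ s : ℝ, 0 < s → 1 ≤ 2 ^ n * s →
      ∀ y ∈ Set.Ico (0 : ℝ) (Real.pi / 2), 0 < T2 s y := by
    intro n
    induction n with
    | zero =>
      intro s hs h1 y hy
      exact T2_base (by simpa using h1)
        (Real.cos_pos_of_mem_Ioo ⟨by linarith [hy.1, Real.pi_pos], hy.2⟩)
    | succ k ih =>
      intro s hs h1
      exact aux_step hs (ih (2 * s) (by linarith) (by rw [pow_succ] at h1; linarith))
  obtain ⟨n, hn⟩ := pow_unbounded_of_one_lt (1 / s) (one_lt_two)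
  refine main n s hs ?_
  rw [div_lt_iff₀ hs] at hn
  exact hn.le

theorem T3_lt {s : ℝ} (hs : 0 < s) : T3 s (Real.pi / 2) < T3 s 0 := by
  unfold T3
  refine Summable.tsum_lt_tsum (i := 1) (fun n => ?_) ?_ (aux_sVn hs _).of_norm
    (aux_sVn hs _).of_norm
  · simp only [mul_zero, Real.cos_zero]
    exact mul_le_mul_of_nonneg_left (Real.cos_le_one _) (auxV_pos s n).le
  · have : (2 : ℝ) * ((1 : ℤ) : ℝ) * (Real.pi / 2) = Real.pi := by push_cast; ring
    rw [this, Real.cos_pi, mul_zero, Real.cos_zero]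
    linarith [auxV_pos s 1]

theorem aux_main {s : ℝ} (hs : 0 < s) {z : ℝ} (hz : z ∈ Set.Ioc (0 : ℝ) (Real.pi / 4)) :
    1 ≤ ((T2 s 0 * T3 s z) / (T3 s 0 * T2 s z)) ^ 2 ∧
    ((T2 s 0 * T3 s z) / (T3 s 0 * T2 s z)) ^ 2 < 2 := by
  have hpi := Real.pi_pos
  have h2s : 0 < s / 2 := by linarith
  have e : 2 * (s / 2) = s := by ring
  have ez : 2 * (z / 2) = z := by ring
  have i1 := aux_I1 h2s (z / 2)
  have i2 := aux_I2 h2s (z / 2)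
  have i3 := aux_I3 h2s (z / 2)
  rw [e, ez] at i1 i2 i3
  have p2 := T2_pos hs z ⟨hz.1.le, by linarith [hz.2]⟩
  have p30 := T3_pos hs 0
  have p4 := T3_pos hs (Real.pi / 2)
  have lt := T3_lt hs
  have j1 := aux_I1 hs z
  have jp : 0 ≤ T2 (2 * s) (2 * z) := by
    rcases eq_or_lt_of_le hz.2 with h | h
    · have : 2 * z = Real.pi / 2 := by rw [h]; ring
      rw [this, T2_half_pi]
    · exact (T2_pos (by linarith) (2 * z) ⟨by linarith [hz.1], by linarith⟩).le
  have jq := mul_nonneg jp (T3_pos (s := 2 * s) (by linarith) 0).le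
  set a := T2 (s / 2) (z / 2)
  set b := T2 (s / 2) (Real.pi / 2 - z / 2)
  set P := T2 s 0 * T3 s z
  set c := T2 s (Real.pi / 2 - z)
  set d := T3 s (Real.pi / 2)
  set Q := T3 s 0 * T2 s z with hQ
  have hQ0 : 0 < Q := mul_pos p30 p2
  rw [mul_comm (T2 s z)] at i1
  have id : P ^ 2 = Q ^ 2 + (c * d) ^ 2 := by
    rw [← i2]
    have : P = (a ^ 2 + b ^ 2) / 2 := by linarith
    have h' : Q = (a ^ 2 - b ^ 2) / 2 := by linarith
    rw [this, h']; ring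
  have hlt : (c * d) ^ 2 < Q ^ 2 := by
    rw [hQ, mul_pow, mul_pow]
    have hc : c ^ 2 ≤ T2 s z ^ 2 := by linarith
    have hd : d ^ 2 < T3 s 0 ^ 2 := by nlinarith
    have : 0 < T2 s z ^ 2 := by positivity
    nlinarith [sq_nonneg d]
  rw [div_pow, one_le_div (by positivity), div_lt_iff₀ (by positivity)]
  constructor
  · nlinarith [sq_nonneg (c * d)]
  · linarith

theorem aux_theta2 {s : ℝ} (hs : 0 < s) (z : ℝ) :
    theta2 (z : ℂ) ((Real.exp (-s) : ℝ) : ℂ) = ((T2 s z : ℝ) : ℂ) := by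
  rw [T2_nat hs, theta2, Complex.ofReal_mul, Complex.ofReal_tsum]
  congr 1
  refine tsum_congr fun n => ?_
  have h1 : ((n : ℂ) + 1 / 2) ^ 2 = ((((n : ℝ) + 1 / 2) ^ 2 : ℝ) : ℂ) := by push_cast; rfl
  have h2 : (2 * (n : ℂ) + 1) * (z : ℂ) = (((2 * (n : ℝ) + 1) * z : ℝ) : ℂ) := by push_cast; rfl
  rw [h1, h2, ← Complex.ofReal_cpow (Real.exp_pos _).le, ← Complex.ofReal_cos,
    ← Complex.ofReal_mul, ← Real.exp_mul, auxW, Int.cast_natCast]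

theorem T3_nat {s : ℝ} (hs : 0 < s) (z : ℝ) : T3 s z =
    1 + 2 * ∑' n : ℕ, Real.exp (-s) ^ ((n + 1) ^ 2) * Real.cos (2 * ((n : ℝ) + 1) * z) := by
  have hS := (aux_sVn hs z).of_norm
  have e1 : ∀ n : ℕ, auxV s ((n : ℤ) + 1) * Real.cos (2 * (((n : ℤ) + 1 : ℤ) : ℝ) * z) =
      Real.exp (-s) ^ ((n + 1) ^ 2) * Real.cos (2 * ((n : ℝ) + 1) * z) := by
    intro n
    rw [auxV, ← Real.exp_nat_mul]
    push_cast
    ring_nf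
  have e2 : ∀ n : ℕ, auxV s (-((n : ℤ) + 1)) * Real.cos (2 * ((-((n : ℤ) + 1) : ℤ) : ℝ) * z) =
      Real.exp (-s) ^ ((n + 1) ^ 2) * Real.cos (2 * ((n : ℝ) + 1) * z) := by
    intro n
    rw [auxV, ← Real.exp_nat_mul, ← Real.cos_neg]
    push_cast
    ring_nf
  unfold T3
  rw [tsum_of_add_one_of_neg_add_one (f := fun n : ℤ => auxV s n * Real.cos (2 * (n : ℝ) * z))
    (hS.comp_injective (i := fun n : ℕ => (n : ℤ) + 1) (fun a b h => by simpa using h))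
    (hS.comp_injective (i := fun n : ℕ => -((n : ℤ) + 1)) (fun a b h => by simpa using h)),
    tsum_congr e1, tsum_congr e2]
  have e3 : auxV s 0 * Real.cos (2 * ((0 : ℤ) : ℝ) * z) = 1 := by simp [auxV]
  rw [e3]; ring

theorem aux_theta3 {s : ℝ} (hs : 0 < s) (z : ℝ) :
    theta3 (z : ℂ) ((Real.exp (-s) : ℝ) : ℂ) = ((T3 s z : ℝ) : ℂ) := by
  rw [T3_nat hs, theta3, Complex.ofReal_add, Complex.ofReal_mul, Complex.ofReal_tsum]
  congr 2
  refine tsum_congr fun n => ?_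
  push_cast; rfl

theorem aux_theta4 {s : ℝ} (hs : 0 < s) (z : ℝ) :
    theta4 (z : ℂ) ((Real.exp (-s) : ℝ) : ℂ) = ((T3 s (Real.pi / 2 - z) : ℝ) : ℂ) := by
  rw [T3_nat hs, theta4, Complex.ofReal_add, Complex.ofReal_mul, Complex.ofReal_tsum]
  congr 2
  refine tsum_congr fun n => ?_
  have h : Real.cos (2 * ((n : ℝ) + 1) * (Real.pi / 2 - z)) =
      (-1) ^ (n + 1) * Real.cos (2 * ((n : ℝ) + 1) * z) := by
    have := Real.cos_nat_mul_pi_sub (2 * ((n : ℝ) + 1) * z) (n + 1)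
    rw [← this]
    push_cast; ring_nf
  rw [h]
  push_cast; ring

theorem aux_ellK {μ : ℝ} (hμ : μ ∈ Set.Ioo (0 : ℝ) 1) :
    ∃ r : ℝ, 0 < r ∧ ellK (μ : ℂ) = (r : ℂ) := by
  obtain ⟨h0, h1⟩ := hμ
  set g : ℝ → ℝ := fun t => 1 / ((1 - t ^ 2) * (1 - μ * t ^ 2)) ^ ((1 : ℝ) / 2) with hg
  have hposin : ∀ t ∈ Set.Ioo (0 : ℝ) 1, 0 < (1 - t ^ 2) * (1 - μ * t ^ 2) := by
    intro t ht
    have : t ^ 2 < 1 := by nlinarith [ht.1, ht.2]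
    have h2 : μ * t ^ 2 < 1 := by nlinarith [sq_nonneg t]
    exact mul_pos (by linarith) (by linarith)
  have hpos : ∀ t ∈ Set.Ioo (0 : ℝ) 1, 0 < g t := by
    intro t ht
    have := Real.rpow_pos_of_pos (hposin t ht) ((1 : ℝ) / 2)
    simp only [hg]; positivity
  have hint : IntervalIntegrable g MeasureTheory.volume 0 1 := by
    have hb : IntervalIntegrable (fun t : ℝ => (1 - μ) ^ (-(1 / 2) : ℝ) * (1 - t) ^ (-(1 / 2) : ℝ))
        MeasureTheory.volume 0 1 := by
      have := (intervalIntegral.intervalIntegrable_rpow' (a := 0) (b := 1)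
        (r := (-(1 / 2) : ℝ)) (by norm_num)).comp_sub_left 1
      simp only [sub_zero, sub_self] at this
      exact this.symm.const_mul _
    refine hb.mono_fun' ?_ ?_
    · apply Measurable.aestronglyMeasurable
      simp only [hg]
      fun_prop
    · rw [Filter.EventuallyLE, MeasureTheory.ae_restrict_iff' measurableSet_uIoc]
      have hne : ∀ᵐ t : ℝ, t ≠ 1 := by
        simp [MeasureTheory.ae_iff]
      filter_upwards [hne] with t ht1 ht
      rw [Set.uIoc_of_le zero_le_one] at ht
      have ht' : t ∈ Set.Ioo (0 : ℝ) 1 := ⟨ht.1, lt_of_le_of_ne ht.2 ht1⟩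
      rw [Real.norm_eq_abs, abs_of_pos (hpos t ht')]
      have hm : 0 < 1 - μ := by linarith
      have hmt : 0 < 1 - t := by linarith [ht'.2]
      rw [← Real.mul_rpow hm.le hmt.le, Real.rpow_neg (by positivity)]
      simp only [hg, one_div]
      apply inv_anti₀ (Real.rpow_pos_of_pos (by positivity) _)
      apply Real.rpow_le_rpow (by positivity) _ (by norm_num)
      have ha : 1 - t ≤ 1 - t ^ 2 := by nlinarith [ht'.1, ht'.2]
      have hb : 1 - μ ≤ 1 - μ * t ^ 2 := by nlinarith [ht'.1, ht'.2]
      rw [mul_comm]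
      exact mul_le_mul ha hb hm.le (by linarith)
  refine ⟨∫ t in (0:ℝ)..1, g t, ?_, ?_⟩
  · exact intervalIntegral.intervalIntegral_pos_of_pos_on hint hpos one_pos
  · rw [ellK, ← intervalIntegral.integral_ofReal]
    refine intervalIntegral.integral_congr_ae ?_
    have hne : ∀ᵐ t : ℝ, t ≠ 1 := by
      simp [MeasureTheory.ae_iff]
    filter_upwards [hne] with t ht1 ht
    rw [Set.uIoc_of_le zero_le_one] at ht
    have ht' : t ∈ Set.Ioo (0 : ℝ) 1 := ⟨ht.1, lt_of_le_of_ne ht.2 ht1⟩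
    simp only [hg]
    rw [Complex.ofReal_div, Complex.ofReal_cpow (hposin t ht').le]
    push_cast; rfl

theorem aux_dc {u : ℝ} (hu : u ∈ Set.Ioc (0 : ℝ) (1 / 2)) {μ : ℝ} (hμ : μ ∈ Set.Ioo (0 : ℝ) 1) :
    1 ≤ (dnR (KR μ * u) μ / cnR (KR μ * u) μ) ^ 2 ∧
    (dnR (KR μ * u) μ / cnR (KR μ * u) μ) ^ 2 < 2 := by
  have hpi := Real.pi_pos
  obtain ⟨r, hr, hrK⟩ := aux_ellK hμ
  obtain ⟨r', hr', hrK'⟩ := aux_ellK (μ := 1 - μ) ⟨by linarith [hμ.2], by linarith [hμ.1]⟩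
  rw [Complex.ofReal_sub, Complex.ofReal_one] at hrK'
  set s : ℝ := Real.pi * r' / r with hsdef
  have hs : 0 < s := by positivity
  have hnome : nome (μ : ℂ) = ((Real.exp (-s) : ℝ) : ℂ) := by
    rw [nome, hrK, hrK', Complex.ofReal_exp, hsdef]
    congr 1
    push_cast; ring
  have hKR : KR μ = r := by rw [KR, hrK, Complex.ofReal_re]
  set z : ℝ := Real.pi * u / 2 with hz
  have hrc : (r : ℂ) ≠ 0 := by exact_mod_cast hr.ne'
  have harg : (Real.pi : ℂ) * ((KR μ * u : ℝ) : ℂ) / (2 * ellK μ) = (z : ℂ) := by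
    rw [hKR, hrK, hz]
    push_cast
    field_simp
  have hzm : z ∈ Set.Ioc (0 : ℝ) (Real.pi / 4) :=
    ⟨by have := hu.1; positivity, by rw [hz]; nlinarith [hu.2]⟩
  have z0 : (0 : ℂ) = ((0 : ℝ) : ℂ) := by simp
  have hdn : dnR (KR μ * u) μ = (T3 s (Real.pi / 2 - 0) / T3 s 0) *
      (T3 s z / T3 s (Real.pi / 2 - z)) := by
    rw [dnR, dn, harg, hnome, z0, aux_theta4 hs, aux_theta4 hs, aux_theta3 hs, aux_theta3 hs]
    norm_cast
  have hcn : cnR (KR μ * u) μ = (T3 s (Real.pi / 2 - 0) / T2 s 0) *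
      (T2 s z / T3 s (Real.pi / 2 - z)) := by
    rw [cnR, cn, harg, hnome, z0, aux_theta4 hs, aux_theta4 hs, aux_theta2 hs, aux_theta2 hs]
    norm_cast
  have p1 := T3_pos hs (Real.pi / 2 - 0)
  have p2 := T3_pos hs (Real.pi / 2 - z)
  have p3 := T3_pos hs 0
  have p4 := T2_zero_pos hs
  have p5 := T2_pos hs z ⟨hzm.1.le, by linarith [hzm.2]⟩
  have hq : dnR (KR μ * u) μ / cnR (KR μ * u) μ = (T2 s 0 * T3 s z) / (T3 s 0 * T2 s z) := by
    rw [hdn, hcn]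
    generalize T3 s (Real.pi / 2 - 0) = a at p1
    generalize T3 s (Real.pi / 2 - z) = b at p2
    field_simp
  rw [hq]
  exact aux_main hs hzm

/-- For `u ∈ (0,1/2]` and every `μ ∈ (0,1)`, `φ(u,μ) < 1`. -/
theorem phi_lt_one (u : ℝ) (hu : u ∈ Set.Ioc (0 : ℝ) (1 / 2)) :
    ∀ μ ∈ Set.Ioo (0 : ℝ) 1, phi u μ < 1 := by
  intro μ hμ
  have h1 := aux_dc hu hμ
  have h2 := aux_dc hu (μ := 1 - μ) ⟨by linarith [hμ.2], by linarith [hμ.1]⟩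
  unfold phi
  linarith [h1.1, h2.2]
end
end
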